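/- For the Table W bound quiver algebras over an algebraically closed field K, the number of isomorphism classes of bricks in mod Wᵢ is: W₄: 3, W₆: 4, W₇: 6, W₈: 6, W₉: 4, W₁₀: 4, W₁₁: 5, W₁₂: 3, W₁₃: 3, W₁₄: 8, W₁₅: 7, W₁₆: 6, W₁₇: 7, W₁₈: 6, W₁₉: 5, W₂₀: 5, W₂₁: 5, W₂₂: 5, W₂₃: 6, W₂₄: 8, W₂₅: 5, W₂₆: 5, W₂₇: 6, W₂₈: 6, W₂₉: 6, W₃₀: 6, W₃₁: 4, W₃₂: 4, W₃₃: 4, W₃₄: 4. -/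

import Mathlib

/-!
Core definitions for τ-tilting theory of finite dimensional algebras.

Throughout, for an algebra `Λ`, *right* `Λ`-modules are formalized as left modules
over the opposite ring `Λᵐᵒᵖ` (the category `RMod Λ := ModuleCat Λᵐᵒᵖ`).

τ-rigidity is formalized via the standard projective-presentation criterion of
Auslander–Smalø/Adachi–Iyama–Reiten: a finitely generated module `M` is τ-rigid iff it admits
a (finite) projective presentation `P₁ → P₀ → M → 0` such that
`Hom(P₀, M) → Hom(P₁, M)` is surjective.
-/

noncomputable section

namespace TwoPoint

/-- A module is indecomposable if it is nonzero and admits no nontrivial direct sum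
decomposition. -/
def IsIndecModule (R : Type) [Ring R] (M : Type) [AddCommGroup M] [Module R M] : Prop :=
  Nontrivial M ∧ ∀ N₁ N₂ : Submodule R M, IsCompl N₁ N₂ → N₁ = ⊥ ∨ N₂ = ⊥

/-- `M` decomposes as a finite direct sum of indecomposable submodules having exactly `n`
isomorphism classes. -/
def HasIndecClassCount (R : Type) [Ring R] (M : ModuleCat.{0} R) (n : ℕ) : Prop :=
  ∃ (k : ℕ) (N : Fin k → Submodule R M),
    DirectSum.IsInternal N ∧ (∀ i, IsIndecModule R (N i)) ∧
    ∃ c : Fin k → Fin n, Function.Surjective c ∧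
      ∀ i j, (c i = c j ↔ Nonempty ((N i) ≃ₗ[R] (N j)))

/-- `M` is basic: it decomposes as a finite direct sum of pairwise nonisomorphic
indecomposable submodules. -/
def IsBasicModuleCat (R : Type) [Ring R] (M : ModuleCat.{0} R) : Prop :=
  ∃ (k : ℕ) (N : Fin k → Submodule R M),
    DirectSum.IsInternal N ∧ (∀ i, IsIndecModule R (N i)) ∧
    ∀ i j, i ≠ j → IsEmpty ((N i) ≃ₗ[R] (N j))

/-- τ-rigidity, via the projective presentation criterion: there is a finite projective
presentation `P₁ —f→ P₀ —g→ M → 0` such that `Hom(—, M)` applied to `f` is surjective,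
i.e. `Hom_Λ(M, τM) = 0`. -/
def IsTauRigidCat (R : Type) [Ring R] (M : ModuleCat.{0} R) : Prop :=
  Module.Finite R M ∧
  ∃ (P₁ P₀ : ModuleCat.{0} R) (f : P₁ →ₗ[R] P₀) (g : P₀ →ₗ[R] M),
    Module.Finite R P₁ ∧ Module.Projective R P₁ ∧
    Module.Finite R P₀ ∧ Module.Projective R P₀ ∧
    Function.Surjective g ∧ LinearMap.range f = LinearMap.ker g ∧
    ∀ h : P₁ →ₗ[R] M, ∃ h' : P₀ →ₗ[R] M, h = h'.comp f

/-- Support τ-tilting module, via support τ-tilting pairs `(M, P)` (Adachi–Iyama–Reiten):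
`M` is τ-rigid, `P` is finitely generated projective with `Hom(P, M) = 0`, and
`|M| + |P| = |R|` where `|X|` is the number of isomorphism classes of indecomposable
direct summands. -/
def IsSupportTauTiltingCat (R : Type) [Ring R] (M : ModuleCat.{0} R) : Prop :=
  IsTauRigidCat R M ∧
  ∃ (P : ModuleCat.{0} R) (p q r : ℕ),
    Module.Finite R P ∧ Module.Projective R P ∧
    (∀ f : P →ₗ[R] M, f = 0) ∧
    HasIndecClassCount R M p ∧ HasIndecClassCount R P q ∧
    HasIndecClassCount R (ModuleCat.of R R) r ∧ p + q = r

/-- The category of (finitely generated) right `Λ`-modules, as left `Λᵐᵒᵖ`-modules. -/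
abbrev RMod (Λ : Type) [Ring Λ] := ModuleCat.{0} Λᵐᵒᵖ

/-- Basic support τ-tilting right `Λ`-module. -/
def IsBasicSupportTauTilting (Λ : Type) [Ring Λ] (M : RMod Λ) : Prop :=
  IsSupportTauTiltingCat Λᵐᵒᵖ M ∧ IsBasicModuleCat Λᵐᵒᵖ M

/-- `Λ` is τ-tilting finite: there are only finitely many isomorphism classes of basic
support τ-tilting right `Λ`-modules. -/
def IsTauTiltingFinite (Λ : Type) [Ring Λ] : Prop :=
  ∃ (n : ℕ) (L : Fin n → RMod Λ),
    ∀ M : RMod Λ, IsBasicSupportTauTilting Λ M → ∃ i, Nonempty (M ≃ₗ[Λᵐᵒᵖ] L i)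

/-- `Λ` has exactly `n` isomorphism classes of basic support τ-tilting modules. -/
def SupportTauTiltingCount (Λ : Type) [Ring Λ] (n : ℕ) : Prop :=
  ∃ L : Fin n → RMod Λ,
    (∀ i, IsBasicSupportTauTilting Λ (L i)) ∧
    (∀ i j, Nonempty ((L i) ≃ₗ[Λᵐᵒᵖ] (L j)) → i = j) ∧
    ∀ M : RMod Λ, IsBasicSupportTauTilting Λ M → ∃ i, Nonempty (M ≃ₗ[Λᵐᵒᵖ] L i)

/-- `Fac M ⊆ Fac N`: every factor module of a finite direct sum of copies of `M` is also a
factor module of a finite direct sum of copies of `N`.  This is the partial order on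
support τ-tilting modules. -/
def FacLE (Λ : Type) [Ring Λ] (M N : RMod Λ) : Prop :=
  ∀ X : RMod Λ,
    (∃ (k : ℕ) (f : (Fin k → M) →ₗ[Λᵐᵒᵖ] X), Function.Surjective f) →
    (∃ (k : ℕ) (f : (Fin k → N) →ₗ[Λᵐᵒᵖ] X), Function.Surjective f)

/-- The Hasse quiver of the poset `sτ-tilt Λ` is of type `H_{m,n}`: the poset of
isomorphism classes of basic support τ-tilting modules is isomorphic to the poset
consisting of a greatest element, a least element, and two incomparable chains with `m`
resp. `n` elements in between (hence two directed paths from `Λ` to `0` with `m` resp. `n`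
intermediate vertices). -/
def HasseType (Λ : Type) [Ring Λ] (m n : ℕ) : Prop :=
  ∃ T : WithTop (WithBot (Fin m ⊕ Fin n)) → RMod Λ,
    (∀ x, IsBasicSupportTauTilting Λ (T x)) ∧
    (∀ x y, Nonempty ((T x) ≃ₗ[Λᵐᵒᵖ] (T y)) → x = y) ∧
    (∀ M : RMod Λ, IsBasicSupportTauTilting Λ M → ∃ x, Nonempty (M ≃ₗ[Λᵐᵒᵖ] T x)) ∧
    ∀ x y, x ≤ y ↔ FacLE Λ (T x) (T y)

/-- `Λ` is τ-tilting finite with exactly `N` basic support τ-tilting modules and Hasse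
quiver of type `H_{m,n}`. -/
def TauTiltingData (Λ : Type) [Ring Λ] (N m n : ℕ) : Prop :=
  IsTauTiltingFinite Λ ∧ SupportTauTiltingCount Λ N ∧ HasseType Λ m n

/-- `B` is a factor algebra of `Λ`: there is a surjective `K`-algebra homomorphism
`Λ → B`. -/
def IsFactorAlgebra (K : Type) [CommRing K] (B Λ : Type) [Ring B] [Ring Λ]
    [Algebra K B] [Algebra K Λ] : Prop :=
  ∃ φ : Λ →ₐ[K] B, Function.Surjective φ

/-- `Λ` is a basic algebra: the regular right module decomposes into pairwise
nonisomorphic indecomposables. -/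
def IsBasicAlgebra (Λ : Type) [Ring Λ] : Prop :=
  IsBasicModuleCat Λᵐᵒᵖ (ModuleCat.of Λᵐᵒᵖ Λᵐᵒᵖ)

/-- `Λ` is representation-finite: finitely many isomorphism classes of indecomposable
finitely generated right modules. -/
def IsRepFinite (Λ : Type) [Ring Λ] : Prop :=
  ∃ (n : ℕ) (L : Fin n → RMod Λ), ∀ M : RMod Λ,
    Module.Finite Λᵐᵒᵖ M → IsIndecModule Λᵐᵒᵖ M → ∃ i, Nonempty (M ≃ₗ[Λᵐᵒᵖ] L i)

end TwoPoint

namespace TwoPoint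

/-! ### Bound quiver algebras on two-point quivers

A two-point quiver is given by an arrow type `σ` together with source and target functions
`s t : σ → Fin 2`.  The corresponding bound quiver algebra `KQ/I` is presented as the
quotient of the free algebra on the two vertex idempotents and the arrows, by the path
algebra relations together with the defining relations of `I` (paths are composed from
left to right, so a relation like `αμβ` is the product `α * μ * β`). -/

/-- Generators for the path algebra of a two-point quiver: two vertex idempotents and the
arrows. -/
inductive TPGen (σ : Type) : Type
  | v : Fin 2 → TPGen σ
  | ar : σ → TPGen σ

/-- The vertex idempotent generator. -/
def vtx (K : Type) [Field K] {σ : Type} (i : Fin 2) : FreeAlgebra K (TPGen σ) :=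
  FreeAlgebra.ι K (TPGen.v i)

/-- The arrow generator. -/
def arr (K : Type) [Field K] {σ : Type} (a : σ) : FreeAlgebra K (TPGen σ) :=
  FreeAlgebra.ι K (TPGen.ar a)

/-- The defining relations of a bound quiver algebra on a two-point quiver:
`e_i e_j = δ_{ij} e_i`, `e_1 + e_2 = 1`, `e_{s(a)} a = a = a e_{t(a)}`, together with the
prescribed relations `rels` (each pair `(x, y) ∈ rels` imposes `x = y`). -/
inductive QuivRel (K : Type) [Field K] (σ : Type) (s t : σ → Fin 2)
    (rels : Set (FreeAlgebra K (TPGen σ) × FreeAlgebra K (TPGen σ))) :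
    FreeAlgebra K (TPGen σ) → FreeAlgebra K (TPGen σ) → Prop
  | idem (i : Fin 2) : QuivRel K σ s t rels (vtx K i * vtx K i) (vtx K i)
  | orth (i j : Fin 2) : i ≠ j → QuivRel K σ s t rels (vtx K i * vtx K j) 0
  | vsum : QuivRel K σ s t rels (vtx K 0 + vtx K 1) 1
  | src (a : σ) : QuivRel K σ s t rels (vtx K (s a) * arr K a) (arr K a)
  | tgt (a : σ) : QuivRel K σ s t rels (arr K a * vtx K (t a)) (arr K a)
  | rel (p : FreeAlgebra K (TPGen σ) × FreeAlgebra K (TPGen σ)) :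
      p ∈ rels → QuivRel K σ s t rels p.1 p.2

/-- The bound quiver algebra of a two-point quiver with relations `rels`. -/
abbrev BoundQuiverAlgebra (K : Type) [Field K] (σ : Type) (s t : σ → Fin 2)
    (rels : Set (FreeAlgebra K (TPGen σ) × FreeAlgebra K (TPGen σ))) : Type :=
  RingQuot (QuivRel K σ s t rels)

/-! Concrete two-point quivers used below.  Vertices are `0` ("1") and `1` ("2"). -/

/- Quiver `μ : 1 → 2`, loop `β` at `2`. -/
namespace QA
def s : Fin 2 → Fin 2 := ![0, 1]
def t : Fin 2 → Fin 2 := ![1, 1]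
def mu (K : Type) [Field K] : FreeAlgebra K (TPGen (Fin 2)) := arr K (0 : Fin 2)
def be (K : Type) [Field K] : FreeAlgebra K (TPGen (Fin 2)) := arr K (1 : Fin 2)
end QA

/- Quiver: loop `α` at `1`, `μ : 1 → 2`, loop `β` at `2`. -/
namespace QB
def s : Fin 3 → Fin 2 := ![0, 0, 1]
def t : Fin 3 → Fin 2 := ![0, 1, 1]
def al (K : Type) [Field K] : FreeAlgebra K (TPGen (Fin 3)) := arr K (0 : Fin 3)
def mu (K : Type) [Field K] : FreeAlgebra K (TPGen (Fin 3)) := arr K (1 : Fin 3)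
def be (K : Type) [Field K] : FreeAlgebra K (TPGen (Fin 3)) := arr K (2 : Fin 3)
end QB

/- Quiver: `μ : 1 → 2`, loops `β₁, β₂` at `2`. -/
namespace QC
def s : Fin 3 → Fin 2 := ![0, 1, 1]
def t : Fin 3 → Fin 2 := ![1, 1, 1]
def mu (K : Type) [Field K] : FreeAlgebra K (TPGen (Fin 3)) := arr K (0 : Fin 3)
def b1 (K : Type) [Field K] : FreeAlgebra K (TPGen (Fin 3)) := arr K (1 : Fin 3)
def b2 (K : Type) [Field K] : FreeAlgebra K (TPGen (Fin 3)) := arr K (2 : Fin 3)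
end QC

/- Quiver: loop `α` at `1`, `μ : 1 → 2`, `ν : 2 → 1`. -/
namespace QD
def s : Fin 3 → Fin 2 := ![0, 0, 1]
def t : Fin 3 → Fin 2 := ![0, 1, 0]
def al (K : Type) [Field K] : FreeAlgebra K (TPGen (Fin 3)) := arr K (0 : Fin 3)
def mu (K : Type) [Field K] : FreeAlgebra K (TPGen (Fin 3)) := arr K (1 : Fin 3)
def nu (K : Type) [Field K] : FreeAlgebra K (TPGen (Fin 3)) := arr K (2 : Fin 3)
end QD

/- Quiver: loops `α` at `1` and `β` at `2`, `μ : 1 → 2`, `ν : 2 → 1`. -/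
namespace QE
def s : Fin 4 → Fin 2 := ![0, 1, 0, 1]
def t : Fin 4 → Fin 2 := ![0, 1, 1, 0]
def al (K : Type) [Field K] : FreeAlgebra K (TPGen (Fin 4)) := arr K (0 : Fin 4)
def be (K : Type) [Field K] : FreeAlgebra K (TPGen (Fin 4)) := arr K (1 : Fin 4)
def mu (K : Type) [Field K] : FreeAlgebra K (TPGen (Fin 4)) := arr K (2 : Fin 4)
def nu (K : Type) [Field K] : FreeAlgebra K (TPGen (Fin 4)) := arr K (3 : Fin 4)
end QE

/- Quiver: `μ : 1 → 2`, `ν : 2 → 1`. -/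
namespace QF
def s : Fin 2 → Fin 2 := ![0, 1]
def t : Fin 2 → Fin 2 := ![1, 0]
def mu (K : Type) [Field K] : FreeAlgebra K (TPGen (Fin 2)) := arr K (0 : Fin 2)
def nu (K : Type) [Field K] : FreeAlgebra K (TPGen (Fin 2)) := arr K (1 : Fin 2)
end QF

/- The Kronecker quiver: `μ₁, μ₂ : 1 → 2`. -/
namespace QG
def s : Fin 2 → Fin 2 := ![0, 0]
def t : Fin 2 → Fin 2 := ![1, 1]
end QG

/- Quiver: `μ₁, μ₂ : 1 → 2`, `ν₁, ν₂ : 2 → 1`. -/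
namespace QH
def s : Fin 4 → Fin 2 := ![0, 0, 1, 1]
def t : Fin 4 → Fin 2 := ![1, 1, 0, 0]
def mu1 (K : Type) [Field K] : FreeAlgebra K (TPGen (Fin 4)) := arr K (0 : Fin 4)
def mu2 (K : Type) [Field K] : FreeAlgebra K (TPGen (Fin 4)) := arr K (1 : Fin 4)
def nu1 (K : Type) [Field K] : FreeAlgebra K (TPGen (Fin 4)) := arr K (2 : Fin 4)
def nu2 (K : Type) [Field K] : FreeAlgebra K (TPGen (Fin 4)) := arr K (3 : Fin 4)
end QH

/- Quiver: loop `α` at `1`, `μ : 1 → 2`. -/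
namespace QI
def s : Fin 2 → Fin 2 := ![0, 0]
def t : Fin 2 → Fin 2 := ![0, 1]
def al (K : Type) [Field K] : FreeAlgebra K (TPGen (Fin 2)) := arr K (0 : Fin 2)
def mu (K : Type) [Field K] : FreeAlgebra K (TPGen (Fin 2)) := arr K (1 : Fin 2)
end QI

/- Quiver: loops `α₁, α₂` at `1`, `μ : 1 → 2`. -/
namespace QJ
def s : Fin 3 → Fin 2 := ![0, 0, 0]
def t : Fin 3 → Fin 2 := ![0, 0, 1]
def a1 (K : Type) [Field K] : FreeAlgebra K (TPGen (Fin 3)) := arr K (0 : Fin 3)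
def a2 (K : Type) [Field K] : FreeAlgebra K (TPGen (Fin 3)) := arr K (1 : Fin 3)
def mu (K : Type) [Field K] : FreeAlgebra K (TPGen (Fin 3)) := arr K (2 : Fin 3)
end QJ

/- Quiver: `μ₁, μ₂ : 1 → 2`, `ν : 2 → 1`. -/
namespace QK
def s : Fin 3 → Fin 2 := ![0, 0, 1]
def t : Fin 3 → Fin 2 := ![1, 1, 0]
def mu1 (K : Type) [Field K] : FreeAlgebra K (TPGen (Fin 3)) := arr K (0 : Fin 3)
def mu2 (K : Type) [Field K] : FreeAlgebra K (TPGen (Fin 3)) := arr K (1 : Fin 3)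
def nu (K : Type) [Field K] : FreeAlgebra K (TPGen (Fin 3)) := arr K (2 : Fin 3)
end QK

/- Quiver: `μ₁, μ₂, μ₃ : 1 → 2`. -/
namespace QL
def s : Fin 3 → Fin 2 := ![0, 0, 0]
def t : Fin 3 → Fin 2 := ![1, 1, 1]
end QL

/- Quiver: loop `α` at `1`, `μ₁, μ₂ : 1 → 2`. -/
namespace QM
def s : Fin 3 → Fin 2 := ![0, 0, 0]
def t : Fin 3 → Fin 2 := ![0, 1, 1]
def al (K : Type) [Field K] : FreeAlgebra K (TPGen (Fin 3)) := arr K (0 : Fin 3)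
def mu1 (K : Type) [Field K] : FreeAlgebra K (TPGen (Fin 3)) := arr K (1 : Fin 3)
def mu2 (K : Type) [Field K] : FreeAlgebra K (TPGen (Fin 3)) := arr K (2 : Fin 3)
end QM

end TwoPoint

namespace TwoPoint

/-! ### The algebras of Han's Table W -/

/-- `W₁`: three parallel arrows `1 → 2`, no relations. -/
abbrev TabW1 (K : Type) [Field K] : Type :=
  BoundQuiverAlgebra K (Fin 3) QL.s QL.t ∅

/-- `W₂`: `μ₁ν = μ₂ν = 0`. -/
abbrev TabW2 (K : Type) [Field K] : Type :=
  BoundQuiverAlgebra K (Fin 3) QK.s QK.t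
    {(QK.mu1 K * QK.nu K, 0), (QK.mu2 K * QK.nu K, 0)}

/-- `W₃`: `ν₂μ₁ = ν₁μ₂`, `μ₁ν₁ = μ₂ν₁ = μ₁ν₂ = μ₂ν₂ = ν₁μ₁ = 0`. -/
abbrev TabW3 (K : Type) [Field K] : Type :=
  BoundQuiverAlgebra K (Fin 4) QH.s QH.t
    {(QH.nu2 K * QH.mu1 K, QH.nu1 K * QH.mu2 K), (QH.mu1 K * QH.nu1 K, 0),
     (QH.mu2 K * QH.nu1 K, 0), (QH.mu1 K * QH.nu2 K, 0), (QH.mu2 K * QH.nu2 K, 0),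
     (QH.nu1 K * QH.mu1 K, 0)}

/-- `W₄`: `α₁² = α₂² = α₁α₂ = α₂α₁ = α₁μ = α₂μ = 0`. -/
abbrev TabW4 (K : Type) [Field K] : Type :=
  BoundQuiverAlgebra K (Fin 3) QJ.s QJ.t
    {(QJ.a1 K ^ 2, 0), (QJ.a2 K ^ 2, 0), (QJ.a1 K * QJ.a2 K, 0), (QJ.a2 K * QJ.a1 K, 0),
     (QJ.a1 K * QJ.mu K, 0), (QJ.a2 K * QJ.mu K, 0)}

/-- `W₅`: `α² = αμ₁ = αμ₂ = 0`. -/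
abbrev TabW5 (K : Type) [Field K] : Type :=
  BoundQuiverAlgebra K (Fin 3) QM.s QM.t
    {(QM.al K ^ 2, 0), (QM.al K * QM.mu1 K, 0), (QM.al K * QM.mu2 K, 0)}

/-- `W₆`: `α⁷ = α²μ = 0`. -/
abbrev TabW6 (K : Type) [Field K] : Type :=
  BoundQuiverAlgebra K (Fin 2) QI.s QI.t {(QI.al K ^ 7, 0), (QI.al K ^ 2 * QI.mu K, 0)}

/-- `W₇`: `α⁴ = α³μ = 0`. -/
abbrev TabW7 (K : Type) [Field K] : Type :=
  BoundQuiverAlgebra K (Fin 2) QI.s QI.t {(QI.al K ^ 4, 0), (QI.al K ^ 3 * QI.mu K, 0)}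

/-- `W₈`: `α² = β³ = αμ = 0`. -/
abbrev TabW8 (K : Type) [Field K] : Type :=
  BoundQuiverAlgebra K (Fin 3) QB.s QB.t
    {(QB.al K ^ 2, 0), (QB.be K ^ 3, 0), (QB.al K * QB.mu K, 0)}

/-- `W₉`: `α³ = β³ = αμ = μβ² = 0`. -/
abbrev TabW9 (K : Type) [Field K] : Type :=
  BoundQuiverAlgebra K (Fin 3) QB.s QB.t
    {(QB.al K ^ 3, 0), (QB.be K ^ 3, 0), (QB.al K * QB.mu K, 0), (QB.mu K * QB.be K ^ 2, 0)}

/-- `W₁₀`: `α² = β⁴ = αμ = μβ² = 0`. -/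
abbrev TabW10 (K : Type) [Field K] : Type :=
  BoundQuiverAlgebra K (Fin 3) QB.s QB.t
    {(QB.al K ^ 2, 0), (QB.be K ^ 4, 0), (QB.al K * QB.mu K, 0), (QB.mu K * QB.be K ^ 2, 0)}

/-- `W₁₁`: `α² = β³ = αμβ = μβ² = 0`. -/
abbrev TabW11 (K : Type) [Field K] : Type :=
  BoundQuiverAlgebra K (Fin 3) QB.s QB.t
    {(QB.al K ^ 2, 0), (QB.be K ^ 3, 0), (QB.al K * QB.mu K * QB.be K, 0),
     (QB.mu K * QB.be K ^ 2, 0)}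

/-- `W₁₂`: `α⁴ = β⁵ = μβ² = 0`, `αμ = μβ`. -/
abbrev TabW12 (K : Type) [Field K] : Type :=
  BoundQuiverAlgebra K (Fin 3) QB.s QB.t
    {(QB.al K ^ 4, 0), (QB.be K ^ 5, 0), (QB.mu K * QB.be K ^ 2, 0),
     (QB.al K * QB.mu K, QB.mu K * QB.be K)}

/-- `W₁₃`: `α³ = β⁷ = μβ² = 0`, `αμ = μβ`. -/
abbrev TabW13 (K : Type) [Field K] : Type :=
  BoundQuiverAlgebra K (Fin 3) QB.s QB.t
    {(QB.al K ^ 3, 0), (QB.be K ^ 7, 0), (QB.mu K * QB.be K ^ 2, 0),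
     (QB.al K * QB.mu K, QB.mu K * QB.be K)}

/-- `W₁₄`: `α³ = μν = νμ = α²μ = 0`. -/
abbrev TabW14 (K : Type) [Field K] : Type :=
  BoundQuiverAlgebra K (Fin 3) QD.s QD.t
    {(QD.al K ^ 3, 0), (QD.mu K * QD.nu K, 0), (QD.nu K * QD.mu K, 0),
     (QD.al K ^ 2 * QD.mu K, 0)}

/-- `W₁₅`: `α³ = μν = αμ = 0`. -/
abbrev TabW15 (K : Type) [Field K] : Type :=
  BoundQuiverAlgebra K (Fin 3) QD.s QD.t
    {(QD.al K ^ 3, 0), (QD.mu K * QD.nu K, 0), (QD.al K * QD.mu K, 0)}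

/-- `W₁₆`: `α³ = μν = ναμ = να² = α²μ = 0`. -/
abbrev TabW16 (K : Type) [Field K] : Type :=
  BoundQuiverAlgebra K (Fin 3) QD.s QD.t
    {(QD.al K ^ 3, 0), (QD.mu K * QD.nu K, 0), (QD.nu K * QD.al K * QD.mu K, 0),
     (QD.nu K * QD.al K ^ 2, 0), (QD.al K ^ 2 * QD.mu K, 0)}

/-- `W₁₇`: `α⁴ = μν = νμ = αμ = να³ = 0`. -/
abbrev TabW17 (K : Type) [Field K] : Type :=
  BoundQuiverAlgebra K (Fin 3) QD.s QD.t
    {(QD.al K ^ 4, 0), (QD.mu K * QD.nu K, 0), (QD.nu K * QD.mu K, 0),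
     (QD.al K * QD.mu K, 0), (QD.nu K * QD.al K ^ 3, 0)}

/-- `W₁₈`: `α⁴ = μν = νμ = ναμ = να² = α²μ = 0`. -/
abbrev TabW18 (K : Type) [Field K] : Type :=
  BoundQuiverAlgebra K (Fin 3) QD.s QD.t
    {(QD.al K ^ 4, 0), (QD.mu K * QD.nu K, 0), (QD.nu K * QD.mu K, 0),
     (QD.nu K * QD.al K * QD.mu K, 0), (QD.nu K * QD.al K ^ 2, 0),
     (QD.al K ^ 2 * QD.mu K, 0)}

/-- `W₁₉`: `α⁵ = μν = νμ = να = α²μ = 0`. -/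
abbrev TabW19 (K : Type) [Field K] : Type :=
  BoundQuiverAlgebra K (Fin 3) QD.s QD.t
    {(QD.al K ^ 5, 0), (QD.mu K * QD.nu K, 0), (QD.nu K * QD.mu K, 0),
     (QD.nu K * QD.al K, 0), (QD.al K ^ 2 * QD.mu K, 0)}

/-- `W₂₀`: `α² = να = νμν = αμν = 0`. -/
abbrev TabW20 (K : Type) [Field K] : Type :=
  BoundQuiverAlgebra K (Fin 3) QD.s QD.t
    {(QD.al K ^ 2, 0), (QD.nu K * QD.al K, 0), (QD.nu K * QD.mu K * QD.nu K, 0),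
     (QD.al K * QD.mu K * QD.nu K, 0)}

/-- `W₂₁`: `α² = να = μνμ = 0`. -/
abbrev TabW21 (K : Type) [Field K] : Type :=
  BoundQuiverAlgebra K (Fin 3) QD.s QD.t
    {(QD.al K ^ 2, 0), (QD.nu K * QD.al K, 0), (QD.mu K * QD.nu K * QD.mu K, 0)}

/-- `W₂₂`: `α³ = νμ = να = αμν = α²μ = 0`. -/
abbrev TabW22 (K : Type) [Field K] : Type :=
  BoundQuiverAlgebra K (Fin 3) QD.s QD.t
    {(QD.al K ^ 3, 0), (QD.nu K * QD.mu K, 0), (QD.nu K * QD.al K, 0),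
     (QD.al K * QD.mu K * QD.nu K, 0), (QD.al K ^ 2 * QD.mu K, 0)}

/-- `W₂₃`: `α² = μν`, `α³ = α²μ = 0`. -/
abbrev TabW23 (K : Type) [Field K] : Type :=
  BoundQuiverAlgebra K (Fin 3) QD.s QD.t
    {(QD.al K ^ 2, QD.mu K * QD.nu K), (QD.al K ^ 3, 0), (QD.al K ^ 2 * QD.mu K, 0)}

/-- `W₂₄`: `α³ = μν`, `α⁴ = νμ = ναμ = να² = 0`. -/
abbrev TabW24 (K : Type) [Field K] : Type :=
  BoundQuiverAlgebra K (Fin 3) QD.s QD.t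
    {(QD.al K ^ 3, QD.mu K * QD.nu K), (QD.al K ^ 4, 0), (QD.nu K * QD.mu K, 0),
     (QD.nu K * QD.al K * QD.mu K, 0), (QD.nu K * QD.al K ^ 2, 0)}

/-- `W₂₅`: `α³ = β² = νμ = μν = να = μβ = βν = α²μ = 0`. -/
abbrev TabW25 (K : Type) [Field K] : Type :=
  BoundQuiverAlgebra K (Fin 4) QE.s QE.t
    {(QE.al K ^ 3, 0), (QE.be K ^ 2, 0), (QE.nu K * QE.mu K, 0), (QE.mu K * QE.nu K, 0),
     (QE.nu K * QE.al K, 0), (QE.mu K * QE.be K, 0), (QE.be K * QE.nu K, 0),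
     (QE.al K ^ 2 * QE.mu K, 0)}

/-- `W₂₆`: `α² = β² = νμ = αμ = να = βν = 0`. -/
abbrev TabW26 (K : Type) [Field K] : Type :=
  BoundQuiverAlgebra K (Fin 4) QE.s QE.t
    {(QE.al K ^ 2, 0), (QE.be K ^ 2, 0), (QE.nu K * QE.mu K, 0), (QE.al K * QE.mu K, 0),
     (QE.nu K * QE.al K, 0), (QE.be K * QE.nu K, 0)}

/-- `W₂₇`: `α² = μν`, `β² = νμ = αμ = μβ = βνα = 0`. -/
abbrev TabW27 (K : Type) [Field K] : Type :=
  BoundQuiverAlgebra K (Fin 4) QE.s QE.t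
    {(QE.al K ^ 2, QE.mu K * QE.nu K), (QE.be K ^ 2, 0), (QE.nu K * QE.mu K, 0),
     (QE.al K * QE.mu K, 0), (QE.mu K * QE.be K, 0), (QE.be K * QE.nu K * QE.al K, 0)}

/-- `W₂₈`: `α² = μν`, `β² = νμ = αμ = βν = 0`. -/
abbrev TabW28 (K : Type) [Field K] : Type :=
  BoundQuiverAlgebra K (Fin 4) QE.s QE.t
    {(QE.al K ^ 2, QE.mu K * QE.nu K), (QE.be K ^ 2, 0), (QE.nu K * QE.mu K, 0),
     (QE.al K * QE.mu K, 0), (QE.be K * QE.nu K, 0)}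

/-- `W₂₉`: `α² = μν`, `β² = νμ = να = μβ = 0`. -/
abbrev TabW29 (K : Type) [Field K] : Type :=
  BoundQuiverAlgebra K (Fin 4) QE.s QE.t
    {(QE.al K ^ 2, QE.mu K * QE.nu K), (QE.be K ^ 2, 0), (QE.nu K * QE.mu K, 0),
     (QE.nu K * QE.al K, 0), (QE.mu K * QE.be K, 0)}

/-- `W₃₀`: `α² = μν`, `β² = νμ = να = βν = αμβ = 0`. -/
abbrev TabW30 (K : Type) [Field K] : Type :=
  BoundQuiverAlgebra K (Fin 4) QE.s QE.t
    {(QE.al K ^ 2, QE.mu K * QE.nu K), (QE.be K ^ 2, 0), (QE.nu K * QE.mu K, 0),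
     (QE.nu K * QE.al K, 0), (QE.be K * QE.nu K, 0), (QE.al K * QE.mu K * QE.be K, 0)}

/-- `W₃₁`: `αμ = μβ`, `α² = β³ = μν = να = βν = μβ² = 0`. -/
abbrev TabW31 (K : Type) [Field K] : Type :=
  BoundQuiverAlgebra K (Fin 4) QE.s QE.t
    {(QE.al K * QE.mu K, QE.mu K * QE.be K), (QE.al K ^ 2, 0), (QE.be K ^ 3, 0),
     (QE.mu K * QE.nu K, 0), (QE.nu K * QE.al K, 0), (QE.be K * QE.nu K, 0),
     (QE.mu K * QE.be K ^ 2, 0)}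

/-- `W₃₂`: `αμ = μβ`, `α² = β² = να = βν = μνμ = νμν = 0`. -/
abbrev TabW32 (K : Type) [Field K] : Type :=
  BoundQuiverAlgebra K (Fin 4) QE.s QE.t
    {(QE.al K * QE.mu K, QE.mu K * QE.be K), (QE.al K ^ 2, 0), (QE.be K ^ 2, 0),
     (QE.nu K * QE.al K, 0), (QE.be K * QE.nu K, 0), (QE.mu K * QE.nu K * QE.mu K, 0),
     (QE.nu K * QE.mu K * QE.nu K, 0)}

/-- `W₃₃`: `αμ = μβ`, `α³ = β³ = νμ = μν = να = βν = μβ² = α²μ = 0`. -/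
abbrev TabW33 (K : Type) [Field K] : Type :=
  BoundQuiverAlgebra K (Fin 4) QE.s QE.t
    {(QE.al K * QE.mu K, QE.mu K * QE.be K), (QE.al K ^ 3, 0), (QE.be K ^ 3, 0),
     (QE.nu K * QE.mu K, 0), (QE.mu K * QE.nu K, 0), (QE.nu K * QE.al K, 0),
     (QE.be K * QE.nu K, 0), (QE.mu K * QE.be K ^ 2, 0), (QE.al K ^ 2 * QE.mu K, 0)}

/-- `W₃₄`: `αμ = μβ`, `α³ = β² = νμ = να = βν = α²μ = 0`. -/
abbrev TabW34 (K : Type) [Field K] : Type :=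
  BoundQuiverAlgebra K (Fin 4) QE.s QE.t
    {(QE.al K * QE.mu K, QE.mu K * QE.be K), (QE.al K ^ 3, 0), (QE.be K ^ 2, 0),
     (QE.nu K * QE.mu K, 0), (QE.nu K * QE.al K, 0), (QE.be K * QE.nu K, 0),
     (QE.al K ^ 2 * QE.mu K, 0)}

end TwoPoint

namespace TwoPoint

/-- A right `Λ`-module `M` is a brick if it is finitely generated, nonzero, and every
endomorphism of `M` is multiplication by a scalar from `K` (i.e. `End_Λ(M) = K`). -/
def IsBrick (K : Type) [Field K] (Λ : Type) [Ring Λ] [Algebra K Λ] (M : RMod Λ) : Prop :=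
  Module.Finite Λᵐᵒᵖ M ∧ Nontrivial M ∧
  ∀ f : M →ₗ[Λᵐᵒᵖ] M, ∃ c : K, ∀ x : M, f x = algebraMap K Λᵐᵒᵖ c • x

/-- `Λ` has exactly `n` isomorphism classes of bricks. -/
def BrickCount (K : Type) [Field K] (Λ : Type) [Ring Λ] [Algebra K Λ] (n : ℕ) : Prop :=
  ∃ L : Fin n → RMod Λ,
    (∀ i, IsBrick K Λ (L i)) ∧
    (∀ i j, Nonempty ((L i) ≃ₗ[Λᵐᵒᵖ] (L j)) → i = j) ∧
    ∀ M : RMod Λ, IsBrick K Λ M → ∃ i, Nonempty (M ≃ₗ[Λᵐᵒᵖ] L i)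

/-- The setoid of bricks up to isomorphism. -/
def brickSetoid (K : Type) [Field K] (Λ : Type) [Ring Λ] [Algebra K Λ] :
    Setoid {M : RMod Λ // IsBrick K Λ M} where
  r M N := Nonempty ((M.1 : RMod Λ) ≃ₗ[Λᵐᵒᵖ] N.1)
  iseqv := by
    refine ⟨fun M => ⟨LinearEquiv.refl _ _⟩, ?_, ?_⟩
    · rintro M N ⟨e⟩; exact ⟨e.symm⟩
    · rintro M N P ⟨e⟩ ⟨f⟩; exact ⟨e.trans f⟩

end TwoPoint

namespace TwoPoint

/-! ### Representations of the two-point quiver with two loops and two opposite arrows -/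

/-- A representation of the quiver with loops `a` at `1`, `b` at `2` and arrows `u : 1 → 2`,
`n : 2 → 1`. -/
structure QRep (K : Type) [Field K] where
  V : Type
  W : Type
  [acgV : AddCommGroup V]
  [acgW : AddCommGroup W]
  [modV : Module K V]
  [modW : Module K W]
  a : V →ₗ[K] V
  b : W →ₗ[K] W
  u : V →ₗ[K] W
  n : W →ₗ[K] V

attribute [instance] QRep.acgV QRep.acgW QRep.modV QRep.modW

namespace QRep

variable {K : Type} [Field K]

/-- Morphisms of representations. -/
structure Hom (R S : QRep K) where
  f : R.V →ₗ[K] S.V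
  g : R.W →ₗ[K] S.W
  ha : ∀ v, f (R.a v) = S.a (f v)
  hb : ∀ w, g (R.b w) = S.b (g w)
  hu : ∀ v, g (R.u v) = S.u (f v)
  hn : ∀ w, f (R.n w) = S.n (g w)

/-- The composite `k ∘ h`. -/
def Hom.comp {R S T : QRep K} (k : Hom S T) (h : Hom R S) : Hom R T where
  f := k.f ∘ₗ h.f
  g := k.g ∘ₗ h.g
  ha v := by simp [h.ha, k.ha]
  hb v := by simp [h.hb, k.hb]
  hu v := by simp [h.hu, k.hu]
  hn v := by simp [h.hn, k.hn]

/-- Two representations are isomorphic. -/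
def Iso (R S : QRep K) : Prop :=
  ∃ (h : Hom R S) (k : Hom S R), (∀ v, k.f (h.f v) = v) ∧ (∀ w, k.g (h.g w) = w) ∧
    (∀ v, h.f (k.f v) = v) ∧ ∀ w, h.g (k.g w) = w

theorem Iso.symm {R S : QRep K} : R.Iso S → S.Iso R := by
  rintro ⟨h, k, h1, h2, h3, h4⟩
  exact ⟨k, h, h3, h4, h1, h2⟩

/-- All endomorphisms of `R` are scalars. -/
def IsSchur (R : QRep K) : Prop :=
  ∀ h : Hom R R, ∃ c : K, (∀ v, h.f v = c • v) ∧ ∀ w, h.g w = c • w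

/-- Bricks in the category of representations. -/
def IsBrick (R : QRep K) : Prop :=
  Nontrivial (R.V × R.W) ∧ R.IsSchur

/-- Two bricks are isomorphic as soon as one of the composites `R → S → R` is nonzero. -/
theorem IsSchur.iso_of_comp {R S : QRep K} (hR : R.IsSchur) (hS : S.IsSchur) (h : Hom R S)
    (k : Hom S R) (hk : (∃ v, k.f (h.f v) ≠ 0) ∨ ∃ w, k.g (h.g w) ≠ 0) : R.Iso S := by
  obtain ⟨c, hc1, hc2⟩ := hR (k.comp h)
  obtain ⟨d, hd1, hd2⟩ := hS (h.comp k)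
  simp only [Hom.comp, LinearMap.comp_apply] at hc1 hc2 hd1 hd2
  have hc : c ≠ 0 := by
    rintro rfl
    rcases hk with ⟨v, hv⟩ | ⟨w, hw⟩
    · exact hv (by rw [hc1, zero_smul])
    · exact hw (by rw [hc2, zero_smul])
  have hdc : d = c := by
    rcases hk with ⟨v, hv⟩ | ⟨w, hw⟩
    · have h1 : h.f (k.f (h.f v)) = c • h.f v := by rw [hc1, map_smul]
      rw [hd1, ← sub_eq_zero, ← sub_smul, smul_eq_zero] at h1
      refine sub_eq_zero.1 (h1.resolve_right fun h0 => hv ?_)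
      rw [h0, map_zero]
    · have h1 : h.g (k.g (h.g w)) = c • h.g w := by rw [hc2, map_smul]
      rw [hd2, ← sub_eq_zero, ← sub_smul, smul_eq_zero] at h1
      refine sub_eq_zero.1 (h1.resolve_right fun h0 => hw ?_)
      rw [h0, map_zero]
  subst hdc
  refine ⟨h, ⟨d⁻¹ • k.f, d⁻¹ • k.g, ?_, ?_, ?_, ?_⟩, ?_, ?_, ?_, ?_⟩
  · intro v; simp [k.ha]
  · intro v; simp [k.hb]
  · intro v; simp [k.hu]
  · intro v; simp [k.hn]
  · intro v; simp [hc1, hc]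
  · intro v; simp [hc2, hc]
  · intro v; simp [hd1, hc]
  · intro v; simp [hd2, hc]

/-- Exchange the two vertices. -/
@[simps]
def swap (R : QRep K) : QRep K where
  V := R.W
  W := R.V
  a := R.b
  b := R.a
  u := R.n
  n := R.u

/-- The action of `swap` on morphisms. -/
def Hom.swap {R S : QRep K} (h : Hom R S) : Hom R.swap S.swap :=
  ⟨h.g, h.f, h.hb, h.ha, h.hn, h.hu⟩

theorem Iso.swap {R S : QRep K} : R.Iso S → R.swap.Iso S.swap := by
  rintro ⟨h, k, h1, h2, h3, h4⟩
  exact ⟨h.swap, k.swap, h2, h1, h4, h3⟩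

theorem IsSchur.swap {R : QRep K} (hR : R.IsSchur) : R.swap.IsSchur := by
  intro h
  obtain ⟨c, h1, h2⟩ := hR h.swap
  exact ⟨c, h2, h1⟩

theorem IsBrick.swap {R : QRep K} (hR : R.IsBrick) : R.swap.IsBrick :=
  ⟨(Equiv.prodComm R.V R.W).symm.nontrivial_congr.2 hR.1, hR.2.swap⟩

end QRep

/-! ### Modules over a bound quiver algebra as representations -/

open MulOpposite

namespace QRep

variable {K : Type} [Field K] (R S : QRep K) {σ : Type}

/-- The projections onto the two vertices. -/
def proj : Fin 2 → Module.End K (R.V × R.W) :=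
  ![LinearMap.inl K R.V R.W ∘ₗ LinearMap.fst K R.V R.W,
    LinearMap.inr K R.V R.W ∘ₗ LinearMap.snd K R.V R.W]

/-- The four structure maps of `R`, as endomorphisms of the total space. -/
def opr : Fin 4 → Module.End K (R.V × R.W) :=
  ![LinearMap.inl K R.V R.W ∘ₗ R.a ∘ₗ LinearMap.fst K R.V R.W,
    LinearMap.inr K R.V R.W ∘ₗ R.b ∘ₗ LinearMap.snd K R.V R.W,
    LinearMap.inr K R.V R.W ∘ₗ R.u ∘ₗ LinearMap.fst K R.V R.W,
    LinearMap.inl K R.V R.W ∘ₗ R.n ∘ₗ LinearMap.snd K R.V R.W]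

@[simp] theorem proj_zero (x : R.V × R.W) : R.proj 0 x = (x.1, 0) := rfl
@[simp] theorem proj_one (x : R.V × R.W) : R.proj 1 x = (0, x.2) := rfl
@[simp] theorem opr_zero (x : R.V × R.W) : R.opr 0 x = (R.a x.1, 0) := rfl
@[simp] theorem opr_one (x : R.V × R.W) : R.opr 1 x = (0, R.b x.2) := rfl
@[simp] theorem opr_two (x : R.V × R.W) : R.opr 2 x = (0, R.u x.1) := rfl
@[simp] theorem opr_three (x : R.V × R.W) : R.opr 3 x = (R.n x.2, 0) := rfl

/-- The action of the generators of a bound quiver algebra on the total space of `R`, where `c`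
says which structure map, if any, an arrow acts by. -/
def gen (c : σ → Option (Fin 4)) : TPGen σ → Module.End K (R.V × R.W)
  | .v i => R.proj i
  | .ar x => (c x).elim 0 R.opr

/-- The induced action of the free algebra. -/
def lift (c : σ → Option (Fin 4)) :
    FreeAlgebra K (TPGen σ) →ₐ[K] (Module.End K (R.V × R.W))ᵐᵒᵖ :=
  FreeAlgebra.lift K fun x => op (R.gen c x)

@[simp] theorem lift_arr (c : σ → Option (Fin 4)) (x : σ) :
    R.lift c (arr K x) = op ((c x).elim 0 R.opr) := by
  simp [lift, arr, gen]

@[simp] theorem lift_vtx (c : σ → Option (Fin 4)) (i : Fin 2) :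
    R.lift c (vtx K i) = op (R.proj i) := by
  simp [lift, vtx, gen]

/-- `R` satisfies the relations `rels`, and the structure maps not indexed by `c` vanish. -/
def Sat (c : σ → Option (Fin 4)) (rels : Set (FreeAlgebra K (TPGen σ) × FreeAlgebra K (TPGen σ))) :
    Prop :=
  (∀ p ∈ rels, R.lift c p.1 = R.lift c p.2) ∧ ∀ j, (∀ x, c x ≠ some j) → R.opr j = 0

/-- `c` is compatible with sources and targets, and injective where it is defined. -/
structure Compat (s t : σ → Fin 2) (c : σ → Option (Fin 4)) : Prop where
  src : ∀ x j, c x = some j → s x = QE.s j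
  tgt : ∀ x j, c x = some j → t x = QE.t j
  inj : ∀ x y j, c x = some j → c y = some j → x = y

variable {R S}

theorem Sat.lift_rel {s t : σ → Fin 2} {c : σ → Option (Fin 4)}
    {rels : Set (FreeAlgebra K (TPGen σ) × FreeAlgebra K (TPGen σ))} (hc : Compat s t c)
    (h : R.Sat c rels) ⦃x y : FreeAlgebra K (TPGen σ)⦄ (hxy : QuivRel K σ s t rels x y) :
    R.lift c x = R.lift c y := by
  induction hxy with
  | idem i =>
    fin_cases i <;> simp [← op_mul] <;> ext <;> simp
  | orth i j hij =>
    fin_cases i <;> fin_cases j <;> simp at hij ⊢ <;> simp [← op_mul] <;> ext <;> simp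
  | vsum =>
    simp [← op_add, -op_one]
    ext <;> simp
  | src x =>
    rcases hx : c x with _ | j
    · simp [hx]
    · rw [hc.src x j hx]
      fin_cases j <;> simp [hx, QE.s, ← op_mul] <;> ext <;> simp
  | tgt x =>
    rcases hx : c x with _ | j
    · simp [hx]
    · rw [hc.tgt x j hx]
      fin_cases j <;> simp [hx, QE.t, ← op_mul] <;> ext <;> simp
  | rel p hp => exact h.1 p hp

section toMod

variable {s t : σ → Fin 2} {c : σ → Option (Fin 4)}
  {rels : Set (FreeAlgebra K (TPGen σ) × FreeAlgebra K (TPGen σ))}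

/-- The action of the bound quiver algebra on a representation satisfying its relations. -/
def Sat.hom (hc : Compat s t c) (h : R.Sat c rels) :
    (BoundQuiverAlgebra K σ s t rels)ᵐᵒᵖ →ₐ[K] Module.End K (R.V × R.W) :=
  AlgHom.opComm (RingQuot.liftAlgHom K ⟨R.lift c, h.lift_rel hc⟩)

/-- The module over the bound quiver algebra given by a representation. -/
def Sat.mod (hc : Compat s t c) (h : R.Sat c rels) : RMod (BoundQuiverAlgebra K σ s t rels) :=
  letI : Module (BoundQuiverAlgebra K σ s t rels)ᵐᵒᵖ (R.V × R.W) :=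
    Module.compHom (R.V × R.W) (h.hom hc).toRingHom
  ModuleCat.of (BoundQuiverAlgebra K σ s t rels)ᵐᵒᵖ (R.V × R.W)

/-- The underlying additive group of the module given by a representation. -/
def Sat.equiv (hc : Compat s t c) (h : R.Sat c rels) : (R.V × R.W) ≃+ (h.mod hc) :=
  AddEquiv.refl _

theorem Sat.smul_def (hc : Compat s t c) (h : R.Sat c rels)
    (z : (BoundQuiverAlgebra K σ s t rels)ᵐᵒᵖ) (x : R.V × R.W) :
    z • h.equiv hc x = h.equiv hc (h.hom hc z x) := rfl

theorem Sat.mk_smul (hc : Compat s t c) (h : R.Sat c rels) (z : FreeAlgebra K (TPGen σ))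
    (x : R.V × R.W) :
    op (RingQuot.mkAlgHom K (QuivRel K σ s t rels) z) • h.equiv hc x =
      h.equiv hc ((R.lift c z).unop x) := by
  rw [Sat.smul_def]
  simp [Sat.hom]

theorem Sat.algebraMap_smul (hc : Compat s t c) (h : R.Sat c rels) (z : K) (x : R.V × R.W) :
    algebraMap K (BoundQuiverAlgebra K σ s t rels)ᵐᵒᵖ z • h.equiv hc x = h.equiv hc (z • x) := by
  rw [Sat.smul_def, AlgHom.commutes, Module.algebraMap_end_apply]

end toMod

end QRep

namespace QRep

open MulOpposite

variable {K : Type} [Field K] {R S : QRep K} {σ : Type} {s t : σ → Fin 2}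
  {c : σ → Option (Fin 4)} {rels : Set (FreeAlgebra K (TPGen σ) × FreeAlgebra K (TPGen σ))}

theorem Hom.lift_comm (k : Hom R S) (c : σ → Option (Fin 4)) (z : FreeAlgebra K (TPGen σ))
    (x : R.V × R.W) :
    k.f.prodMap k.g ((R.lift c z).unop x) = (S.lift c z).unop (k.f.prodMap k.g x) := by
  induction z using FreeAlgebra.induction generalizing x with
  | grade0 r => simp [AlgHom.commutes, MulOpposite.algebraMap_apply]
  | grade1 y =>
    rcases y with i | y
    · change k.f.prodMap k.g ((R.lift c (vtx K i)).unop x) = (S.lift c (vtx K i)).unop _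
      fin_cases i <;> simp
    · change k.f.prodMap k.g ((R.lift c (arr K y)).unop x) = (S.lift c (arr K y)).unop _
      rcases hy : c y with _ | j
      · simp [hy]
      · fin_cases j <;> simp [hy, k.ha, k.hb, k.hu, k.hn]
  | mul y z hy hz => simp only [map_mul, unop_mul, Module.End.mul_apply, hy, hz]
  | add y z hy hz => simp only [map_add, unop_add, LinearMap.add_apply, hy, hz]

/-- The linear map of modules given by a morphism of representations. -/
def Sat.mapHom (hc : Compat s t c) (h : R.Sat c rels) (h' : S.Sat c rels) (k : Hom R S) :
    h.mod hc →ₗ[(BoundQuiverAlgebra K σ s t rels)ᵐᵒᵖ] h'.mod hc where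
  toFun x := h'.equiv hc (k.f.prodMap k.g ((h.equiv hc).symm x))
  map_add' x y := by simp only [map_add]
  map_smul' z x := by
    obtain ⟨x, rfl⟩ := (h.equiv hc).surjective x
    obtain ⟨y, hy⟩ := RingQuot.mkAlgHom_surjective K (QuivRel K σ s t rels) z.unop
    obtain rfl : z = op (RingQuot.mkAlgHom K _ y) := by rw [hy, op_unop]
    simp only [Sat.mk_smul, AddEquiv.symm_apply_apply, RingHom.id_apply, k.lift_comm]

theorem Sat.mapHom_apply (hc : Compat s t c) (h : R.Sat c rels) (h' : S.Sat c rels) (k : Hom R S)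
    (x : R.V × R.W) :
    h.mapHom hc h' k (h.equiv hc x) = h'.equiv hc (k.f x.1, k.g x.2) := by
  simp [Sat.mapHom]

theorem Sat.exists_hom (hc : Compat s t c) (h : R.Sat c rels) (h' : S.Sat c rels)
    (F : h.mod hc →ₗ[(BoundQuiverAlgebra K σ s t rels)ᵐᵒᵖ] h'.mod hc) :
    ∃ k : Hom R S, ∀ x, F (h.equiv hc x) = h'.equiv hc (k.f x.1, k.g x.2) := by
  let G : (R.V × R.W) →ₗ[K] (S.V × S.W) :=
    { toFun := fun x => (h'.equiv hc).symm (F (h.equiv hc x))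
      map_add' := fun x y => by simp only [map_add]
      map_smul' := fun r x => by
        rw [← h.algebraMap_smul hc, map_smul, RingHom.id_apply, AddEquiv.symm_apply_eq,
          ← h'.algebraMap_smul hc, AddEquiv.apply_symm_apply] }
  have hG : ∀ z x, G ((R.lift c z).unop x) = (S.lift c z).unop (G x) := fun z x => by
    change (h'.equiv hc).symm (F _) = (S.lift c z).unop ((h'.equiv hc).symm (F _))
    rw [← h.mk_smul hc, map_smul, AddEquiv.symm_apply_eq, ← h'.mk_smul hc,
      AddEquiv.apply_symm_apply]
  have hp : ∀ i x, G (R.proj i x) = S.proj i (G x) := fun i x => by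
    simpa using hG (vtx K i) x
  have ho : ∀ j x, G (R.opr j x) = S.opr j (G x) := fun j x => by
    by_cases hj : ∃ y, c y = some j
    · obtain ⟨y, hy⟩ := hj
      simpa [hy] using hG (arr K y) x
    · push Not at hj
      simp [h.2 j hj, h'.2 j hj]
  have h1 : ∀ v, G (v, 0) = ((G (v, 0)).1, 0) := fun v => by simpa using hp 0 (v, 0)
  have h2 : ∀ w, G (0, w) = (0, (G (0, w)).2) := fun w => by simpa using hp 1 (0, w)
  refine ⟨⟨LinearMap.fst K _ _ ∘ₗ G ∘ₗ LinearMap.inl K _ _,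
    LinearMap.snd K _ _ ∘ₗ G ∘ₗ LinearMap.inr K _ _, fun v => ?_, fun w => ?_, fun v => ?_,
    fun w => ?_⟩, fun x => ?_⟩
  · simpa using congrArg Prod.fst (ho 0 (v, 0))
  · simpa using congrArg Prod.snd (ho 1 (0, w))
  · simpa using congrArg Prod.snd (ho 2 (v, 0))
  · simpa using congrArg Prod.fst (ho 3 (0, w))
  · rw [← AddEquiv.symm_apply_eq]
    change G x = _
    have hx : x = (x.1, 0) + (0, x.2) := by simp
    conv_lhs => rw [hx, map_add, h1, h2]
    simp

theorem Sat.isBrick_mod (hc : Compat s t c) (h : R.Sat c rels) (hR : R.IsBrick)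
    [Module.Finite K R.V] [Module.Finite K R.W] : TwoPoint.IsBrick K _ (h.mod hc) := by
  refine ⟨?_, (h.equiv hc).symm.toEquiv.nontrivial_congr.2 hR.1, fun F => ?_⟩
  · obtain ⟨T, hT⟩ := (inferInstance : Module.Finite K (R.V × R.W)).fg_top
    classical
    refine ⟨T.image (h.equiv hc), ?_⟩
    rw [eq_top_iff]
    rintro x -
    obtain ⟨x, rfl⟩ := (h.equiv hc).surjective x
    have hx : x ∈ Submodule.span K (T : Set (R.V × R.W)) := hT ▸ trivial
    induction hx using Submodule.span_induction with
    | mem x hx => exact Submodule.subset_span (by simpa using hx)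
    | zero => rw [map_zero]; exact zero_mem _
    | add x y _ _ hx hy => rw [map_add]; exact add_mem hx hy
    | smul r x _ hx => rw [← h.algebraMap_smul hc]; exact Submodule.smul_mem _ _ hx
  · obtain ⟨k, hk⟩ := h.exists_hom hc h F
    obtain ⟨r, h1, h2⟩ := hR.2 k
    refine ⟨r, fun x => ?_⟩
    obtain ⟨x, rfl⟩ := (h.equiv hc).surjective x
    rw [hk, h.algebraMap_smul hc, h1, h2]
    rfl

theorem Sat.isBrick_of_mod (hc : Compat s t c) (h : R.Sat c rels)
    (hM : TwoPoint.IsBrick K _ (h.mod hc)) : R.IsBrick := by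
  refine ⟨(h.equiv hc).toEquiv.nontrivial_congr.2 hM.2.1, fun k => ?_⟩
  obtain ⟨r, hr⟩ := hM.2.2 (h.mapHom hc h k)
  have key : ∀ x : R.V × R.W, (k.f x.1, k.g x.2) = r • x := fun x => by
    apply (h.equiv hc).injective
    rw [← h.algebraMap_smul hc, ← hr, Sat.mapHom_apply]
  exact ⟨r, fun v => congrArg Prod.fst (key (v, 0)), fun w => congrArg Prod.snd (key (0, w))⟩

theorem Sat.iso_of_mod (hc : Compat s t c) (h : R.Sat c rels) (h' : S.Sat c rels)
    (e : h.mod hc ≃ₗ[(BoundQuiverAlgebra K σ s t rels)ᵐᵒᵖ] h'.mod hc) : R.Iso S := by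
  obtain ⟨k, hk⟩ := h.exists_hom hc h' e.toLinearMap
  obtain ⟨l, hl⟩ := h'.exists_hom hc h e.symm.toLinearMap
  have h1 : ∀ x : R.V × R.W, (l.f (k.f x.1), l.g (k.g x.2)) = x := fun x => by
    apply (h.equiv hc).injective
    rw [← hl (k.f x.1, k.g x.2), ← hk]
    simp
  have h2 : ∀ x : S.V × S.W, (k.f (l.f x.1), k.g (l.g x.2)) = x := fun x => by
    apply (h'.equiv hc).injective
    rw [← hk (l.f x.1, l.g x.2), ← hl]
    simp
  exact ⟨k, l, fun v => congrArg Prod.fst (h1 (v, 0)), fun w => congrArg Prod.snd (h1 (0, w)),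
    fun v => congrArg Prod.fst (h2 (v, 0)), fun w => congrArg Prod.snd (h2 (0, w))⟩

theorem Sat.mod_iso (hc : Compat s t c) (h : R.Sat c rels) (h' : S.Sat c rels)
    (e : R.Iso S) :
    Nonempty (h.mod hc ≃ₗ[(BoundQuiverAlgebra K σ s t rels)ᵐᵒᵖ] h'.mod hc) := by
  obtain ⟨k, l, h1, h2, h3, h4⟩ := e
  refine ⟨LinearEquiv.ofLinearMap (h.mapHom hc h' k) (h'.mapHom hc h l) ?_ ?_⟩
  · refine LinearMap.ext fun x => ?_
    obtain ⟨x, rfl⟩ := (h'.equiv hc).surjective x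
    simp [Sat.mapHom_apply, h3, h4]
  · refine LinearMap.ext fun x => ?_
    obtain ⟨x, rfl⟩ := (h.equiv hc).surjective x
    simp [Sat.mapHom_apply, h1, h2]

end QRep

namespace QRep

open MulOpposite

variable {K : Type} [Field K] {σ : Type} {s t : σ → Fin 2}
  {c : σ → Option (Fin 4)} {rels : Set (FreeAlgebra K (TPGen σ) × FreeAlgebra K (TPGen σ))}

/-- Every module on which the arrows outside the domain of `c` act by zero comes from a
representation. -/
theorem exists_rep (hc : Compat s t c) (M : RMod (BoundQuiverAlgebra K σ s t rels))
    (hM : ∀ x, c x = none → ∀ m : M,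
      op (RingQuot.mkAlgHom K (QuivRel K σ s t rels) (arr K x)) • m = 0) :
    ∃ (R : QRep K) (h : R.Sat c rels),
      Nonempty (M ≃ₗ[(BoundQuiverAlgebra K σ s t rels)ᵐᵒᵖ] h.mod hc) := by
  classical
  let : Module K M :=
    Module.compHom M (algebraMap K (BoundQuiverAlgebra K σ s t rels)ᵐᵒᵖ)
  have : IsScalarTower K (BoundQuiverAlgebra K σ s t rels)ᵐᵒᵖ M :=
    IsScalarTower.of_algebraMap_smul fun _ _ => rfl
  let mk := RingQuot.mkAlgHom K (QuivRel K σ s t rels)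
  let act : (BoundQuiverAlgebra K σ s t rels)ᵐᵒᵖ →ₐ[K] Module.End K M := Algebra.lsmul K K M
  let A : FreeAlgebra K (TPGen σ) → Module.End K M := fun z => act (op (mk z))
  have hA : ∀ z (m : M), A z m = op (mk z) • m := fun _ _ => rfl
  have hmul : ∀ y z m, A (y * z) m = A z (A y m) := fun y z m => by
    simp only [A, map_mul, op_mul, Module.End.mul_apply]
  have hadd : ∀ y z m, A (y + z) m = A y m + A z m := fun y z m => by
    simp only [A, map_add, op_add, LinearMap.add_apply]
  have hone : ∀ m, A 1 m = m := fun m => by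
    simp only [A, map_one, op_one, Module.End.one_apply]
  have hzero : ∀ m, A 0 m = 0 := fun m => by
    simp only [A, map_zero, op_zero, LinearMap.zero_apply]
  have hrel : ∀ {y z}, QuivRel K σ s t rels y z → A y = A z := fun {y z} h => by
    simp only [A, mk, RingQuot.mkAlgHom_rel K h]
  have hid : ∀ i m, A (vtx K i) (A (vtx K i) m) = A (vtx K i) m := fun i m => by
    rw [← hmul, hrel (.idem i)]
  have hor : ∀ i j m, i ≠ j → A (vtx K j) (A (vtx K i) m) = 0 := fun i j m hij => by
    rw [← hmul, hrel (.orth i j hij), hzero]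
  have hsum : ∀ m, A (vtx K 0) m + A (vtx K 1) m = m := fun m => by
    rw [← hadd, hrel .vsum, hone]
  have hsrc : ∀ x m, A (arr K x) (A (vtx K (s x)) m) = A (arr K x) m := fun x m => by
    rw [← hmul, hrel (.src x)]
  have htgt : ∀ x m, A (vtx K (t x)) (A (arr K x) m) = A (arr K x) m := fun x m => by
    rw [← hmul, hrel (.tgt x)]
  let el : Fin 4 → Module.End K M := fun j =>
    if h : ∃ x, c x = some j then A (arr K h.choose) else 0
  have hel : ∀ x j, c x = some j → el j = A (arr K x) := fun x j hx => by
    have h : ∃ x, c x = some j := ⟨x, hx⟩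
    simp only [el, dif_pos h, hc.inj _ _ j h.choose_spec hx]
  have hel0 : ∀ j, (∀ x, c x ≠ some j) → el j = 0 := fun j hj => by
    simp only [el]
    rw [dif_neg]
    simpa using hj
  have helsrc : ∀ j m, el j (A (vtx K (QE.s j)) m) = el j m := fun j m => by
    by_cases h : ∃ x, c x = some j
    · obtain ⟨x, hx⟩ := h
      rw [hel x j hx, ← hc.src x j hx, hsrc]
    · push Not at h
      simp [hel0 j h]
  have heltgt : ∀ j m, A (vtx K (QE.t j)) (el j m) = el j m := fun j m => by
    by_cases h : ∃ x, c x = some j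
    · obtain ⟨x, hx⟩ := h
      rw [hel x j hx, ← hc.tgt x j hx, htgt]
    · push Not at h
      simp [hel0 j h]
  let P : Fin 2 → Submodule K M := fun i => LinearMap.range (A (vtx K i))
  have hPmem : ∀ i m, A (vtx K i) m ∈ P i := fun i m => ⟨m, rfl⟩
  have hPfix : ∀ i m, m ∈ P i → A (vtx K i) m = m := by
    rintro i _ ⟨m, rfl⟩
    exact hid i m
  have hPmap : ∀ j (i : Fin 2), ∀ m ∈ P i, el j m ∈ P (QE.t j) := fun j i m _ => by
    rw [← heltgt]
    exact hPmem _ _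
  let R : QRep K :=
    { V := P 0
      W := P 1
      a := (el 0).restrict (hPmap 0 0)
      b := (el 1).restrict (hPmap 1 1)
      u := (el 2).restrict (hPmap 2 0)
      n := (el 3).restrict (hPmap 3 1) }
  let Φ : M ≃ₗ[K] (P 0 × P 1) :=
    { toFun := fun m => (⟨A (vtx K 0) m, hPmem 0 m⟩, ⟨A (vtx K 1) m, hPmem 1 m⟩)
      map_add' := fun x y => by ext <;> simp
      map_smul' := fun r x => by ext <;> simp
      invFun := fun x => x.1 + x.2
      left_inv := fun m => hsum m
      right_inv := fun ⟨⟨v, hv⟩, ⟨w, hw⟩⟩ => by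
        ext
        · change A (vtx K 0) (v + w) = v
          rw [map_add, hPfix 0 v hv]
          conv_lhs => rw [← hPfix 1 w hw, hor 1 0 w (by decide), add_zero]
        · change A (vtx K 1) (v + w) = w
          rw [map_add, hPfix 1 w hw]
          conv_lhs => rw [← hPfix 0 v hv, hor 0 1 v (by decide), zero_add] }
  have hΦopr : ∀ j m, Φ (el j m) = R.opr j (Φ m) := fun j m => by
    have h1 := heltgt j m
    have h2 := helsrc j m
    have h3 : ∀ i, i ≠ QE.t j → A (vtx K i) (el j m) = 0 := fun i hi => by
      rw [← h1, hor _ _ _ hi.symm]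
    ext
    · fin_cases j
      · exact h1.trans h2.symm
      · exact h3 0 (by decide)
      · exact h3 0 (by decide)
      · exact h1.trans h2.symm
    · fin_cases j
      · exact h3 1 (by decide)
      · exact h1.trans h2.symm
      · exact h1.trans h2.symm
      · exact h3 1 (by decide)
  have hΦproj : ∀ i m, Φ (A (vtx K i) m) = R.proj i (Φ m) := fun i m => by
    ext
    · fin_cases i
      · exact hid 0 m
      · exact hor 1 0 m (by decide)
    · fin_cases i
      · exact hor 0 1 m (by decide)
      · exact hid 1 m
  have hΦ : ∀ z m, Φ (A z m) = (R.lift c z).unop (Φ m) := fun z => by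
    induction z using FreeAlgebra.induction with
    | grade0 r =>
      intro m
      have h1 : A (algebraMap K _ r) m = r • m := by
        have h2 : op (mk (algebraMap K _ r)) = algebraMap K _ r := by
          rw [AlgHom.commutes, MulOpposite.algebraMap_apply]
        change act (op (mk _)) m = r • m
        rw [h2, AlgHom.commutes, Module.algebraMap_end_apply]
      rw [h1, AlgHom.commutes, MulOpposite.algebraMap_apply, unop_op, Module.algebraMap_end_apply,
        map_smul]
    | grade1 y =>
      intro m
      rcases y with i | y
      · change Φ (A (vtx K i) m) = (R.lift c (vtx K i)).unop _
        rw [hΦproj, lift_vtx, unop_op]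
      · change Φ (A (arr K y) m) = (R.lift c (arr K y)).unop _
        rcases hy : c y with _ | j
        · rw [hA, hM y hy, map_zero, lift_arr, hy]
          rfl
        · rw [← hel y j hy, hΦopr, lift_arr, hy]
          rfl
    | mul y z hy hz => intro m; rw [hmul, hz, hy, map_mul, unop_mul, Module.End.mul_apply]
    | add y z hy hz => intro m; rw [hadd, map_add, hz, hy, map_add, unop_add, LinearMap.add_apply]
  have hR : R.Sat c rels := by
    refine ⟨fun p hp => unop_injective (LinearMap.ext fun x => ?_), fun j hj => ?_⟩
    · obtain ⟨m, rfl⟩ := Φ.surjective x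
      rw [← hΦ, ← hΦ, hrel (.rel p hp)]
    · refine LinearMap.ext fun x => ?_
      obtain ⟨m, rfl⟩ := Φ.surjective x
      rw [← hΦopr, hel0 j hj]
      simp
  refine ⟨R, hR, ⟨{ Φ.toAddEquiv.trans (hR.equiv hc) with map_smul' := fun z m => ?_ }⟩⟩
  obtain ⟨y, hy⟩ := RingQuot.mkAlgHom_surjective K (QuivRel K σ s t rels) z.unop
  obtain rfl : z = op (mk y) := by rw [hy, op_unop]
  change hR.equiv hc (Φ (A y m)) = op (mk y) • hR.equiv hc (Φ m)
  rw [hΦ, ← hR.mk_smul hc]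

theorem iso_transport {A : Type} [Ring A] [Algebra K A] {M N : RMod A} (hM : TwoPoint.IsBrick K A M)
    (e : M ≃ₗ[Aᵐᵒᵖ] N) : TwoPoint.IsBrick K A N := by
  obtain ⟨h1, h2, h3⟩ := hM
  refine ⟨Module.Finite.equiv e, e.symm.toEquiv.nontrivial, fun f => ?_⟩
  obtain ⟨r, hr⟩ := h3 (e.symm.toLinearMap ∘ₗ f ∘ₗ e.toLinearMap)
  refine ⟨r, fun x => ?_⟩
  have := congrArg e (hr (e.symm x))
  simpa using this

/-- Central nilpotent elements act by zero on bricks. -/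
theorem central_smul_eq_zero {A : Type} [Ring A] [Algebra K A] {M : RMod A}
    (hM : TwoPoint.IsBrick K A M) (z : A) (hz : ∀ y, z * y = y * z) (hnil : z ^ 2 = 0) (m : M) :
    op z • m = 0 := by
  obtain ⟨-, h2, h3⟩ := hM
  let F : M →ₗ[Aᵐᵒᵖ] M :=
    { toFun := fun m => op z • m
      map_add' := fun x y => smul_add _ _ _
      map_smul' := fun r x => by
        rw [RingHom.id_apply, smul_smul, smul_smul, ← op_unop r, ← op_mul, ← op_mul, hz] }
  obtain ⟨r, hr⟩ := h3 F
  have hr' : ∀ x : M, op z • x = algebraMap K Aᵐᵒᵖ r • x := hr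
  have hsq : ∀ x : M, algebraMap K Aᵐᵒᵖ (r * r) • x = 0 := fun x => by
    rw [map_mul, mul_smul, ← hr', ← hr', smul_smul, ← op_mul, ← pow_two, hnil, op_zero, zero_smul]
  obtain ⟨x, hx⟩ := exists_ne (0 : M)
  have hr0 : r = 0 := by
    by_contra h
    apply hx
    have := hsq ((algebraMap K Aᵐᵒᵖ (r * r)⁻¹) • x)
    rwa [smul_smul, ← map_mul, mul_inv_cancel₀ (mul_ne_zero h h), map_one, one_smul] at this
  rw [hr', hr0, map_zero, zero_smul]

end QRep

/-! ### Simple tops and socles -/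

namespace QRep

variable {K : Type} [Field K]

/-- The simple representation at `1`. -/
abbrev S1 (K : Type) [Field K] : QRep K where
  V := Fin 1 → K
  W := Fin 0 → K
  a := 0
  b := 0
  u := 0
  n := 0

/-- Submodules of elements killed by all paths of length `k`. -/
def kill (R : QRep K) : ℕ → Submodule K R.V × Submodule K R.W
  | 0 => (⊥, ⊥)
  | k + 1 => ((R.kill k).1.comap R.a ⊓ (R.kill k).2.comap R.u,
      (R.kill k).2.comap R.b ⊓ (R.kill k).1.comap R.n)

/-- All paths of length `k` act by zero. -/
def NilAt (R : QRep K) (k : ℕ) : Prop :=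
  (∀ v, v ∈ (R.kill k).1) ∧ ∀ w, w ∈ (R.kill k).2

theorem NilAt.swap {R : QRep K} {k : ℕ} (h : R.NilAt k) : R.swap.NilAt k := by
  have key : ∀ k, R.swap.kill k = (R.kill k).swap := fun k => by
    induction k with
    | zero => rfl
    | succ k ih => simp only [kill, ih]; rfl
  simp only [NilAt, key]
  exact ⟨h.2, h.1⟩

/-- The socle of `R` does not contain the simple representation at `1`. -/
def Soc (R : QRep K) : Prop :=
  ∀ v, R.a v = 0 → R.u v = 0 → v = 0

/-- The top of `R` does not contain the simple representation at `2`. -/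
def Top (R : QRep K) : Prop :=
  ∀ P : Submodule K R.W, (∀ w, R.b w ∈ P) → (∀ v, R.u v ∈ P) → ∀ w, w ∈ P

/-- The top of `R` is at `1` and the socle of `R` is at `2`. -/
def Plus (R : QRep K) : Prop :=
  R.Soc ∧ R.Top

theorem Top.map {R : QRep K} (h : R.Top) {Y : Type} [AddCommGroup Y] [Module K Y]
    (φ : R.W →ₗ[K] Y) (hb : ∀ w, φ (R.b w) = 0) (hu : ∀ v, φ (R.u v) = 0) (w : R.W) :
    φ w = 0 :=
  h (LinearMap.ker φ) hb hu w

/-- A proper submodule is contained in the kernel of a nonzero functional. -/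
theorem exists_functional {X : Type} [AddCommGroup X] [Module K X] {P : Submodule K X} {x : X}
    (hx : x ∉ P) : ∃ φ : X →ₗ[K] K, (∃ y, φ y ≠ 0) ∧ ∀ y ∈ P, φ y = 0 := by
  have hP : P < ⊤ := lt_top_iff_ne_top.2 fun h => hx (h ▸ trivial)
  obtain ⟨φ, hφ, hle⟩ := P.exists_le_ker_of_lt_top hP
  refine ⟨φ, ?_, fun y hy => hle hy⟩
  by_contra! h
  exact hφ (LinearMap.ext h)

theorem Top.exists_of_not {R : QRep K} (h : ¬ R.Top) :
    ∃ φ : R.W →ₗ[K] K, (∃ w, φ w ≠ 0) ∧ (∀ w, φ (R.b w) = 0) ∧ ∀ v, φ (R.u v) = 0 := by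
  simp only [Top, not_forall] at h
  obtain ⟨P, hb, hu, w, hw⟩ := h
  obtain ⟨φ, hφ, hP⟩ := exists_functional hw
  exact ⟨φ, hφ, fun w => hP _ (hb w), fun v => hP _ (hu v)⟩

theorem NilAt.not_soc {R : QRep K} {k : ℕ} (h : R.NilAt k) (hR : Nontrivial (R.V × R.W)) :
    ¬ (R.Soc ∧ R.swap.Soc) := by
  rintro ⟨h1, h2⟩
  have key : ∀ k, (∀ v ∈ (R.kill k).1, v = 0) ∧ ∀ w ∈ (R.kill k).2, w = 0 := fun k => by
    induction k with
    | zero => simp [kill]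
    | succ k ih =>
      exact ⟨fun v hv => h1 v (ih.1 _ hv.1) (ih.2 _ hv.2),
        fun w hw => h2 w (ih.2 _ hw.1) (ih.1 _ hw.2)⟩
  obtain ⟨x, hx⟩ := exists_ne (0 : R.V × R.W)
  exact hx (Prod.ext ((key k).1 _ (h.1 _)) ((key k).2 _ (h.2 _)))

theorem NilAt.not_top {R : QRep K} {k : ℕ} (h : R.NilAt k) (hR : Nontrivial (R.V × R.W)) :
    ¬ (R.Top ∧ R.swap.Top) := by
  rintro ⟨h1, h2⟩
  induction k with
  | zero =>
    obtain ⟨x, hx⟩ := exists_ne (0 : R.V × R.W)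
    exact hx (Prod.ext (h.1 _) (h.2 _))
  | succ k ih =>
    exact ih ⟨h2 _ (fun v => (h.1 v).1) fun w => (h.2 w).2, h1 _ (fun w => (h.2 w).1)
      fun v => (h.1 v).2⟩

theorem isSchur_S1 : (S1 K).IsSchur := by
  intro h
  refine ⟨h.f (fun _ => 1) 0, fun v => ?_, fun w => funext fun i => i.elim0⟩
  have hv : v = v 0 • fun _ => (1 : K) := by
    funext i
    fin_cases i
    simp
  rw [hv, map_smul]
  funext i
  fin_cases i
  simp [mul_comm]

/-- A brick with the simple at `1` both in its top and in its socle is simple. -/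
theorem IsBrick.iso_S1 {R : QRep K} (hR : R.IsBrick) (hs : ¬ R.Soc) (ht : ¬ R.swap.Top) :
    R.Iso (S1 K) := by
  obtain ⟨φ, ⟨w, hw⟩, h1, h2⟩ := Top.exists_of_not ht
  simp only [Soc, not_forall] at hs
  obtain ⟨v, hva, hvu, hv⟩ := hs
  refine hR.2.iso_of_comp isSchur_S1
    ⟨LinearMap.pi fun _ => φ, 0, fun v => ?_, fun _ => ?_, fun _ => ?_, fun w => ?_⟩
    ⟨(LinearMap.proj 0).smulRight v, 0, fun _ => ?_, fun _ => ?_, fun _ => ?_, fun _ => ?_⟩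
    (.inl ⟨w, ?_⟩)
  · funext i; exact h1 v
  · rfl
  · rfl
  · funext i; exact h2 w
  · simp [hva]
  · simp
  · simp [hvu]
  · simp
  · exact smul_ne_zero hw hv

/-- A brick on which long paths vanish is simple or has its top at one vertex and its socle at the
other one. -/
theorem IsBrick.trichotomy {R : QRep K} (hR : R.IsBrick) {k : ℕ} (hk : R.NilAt k) :
    R.Iso (S1 K) ∨ R.Iso (S1 K).swap ∨ R.Plus ∨ R.swap.Plus := by
  have h1 := hk.not_soc hR.1
  have h2 := hk.not_top hR.1
  have h3 := hR.iso_S1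
  have h4 : ¬ R.swap.Soc → ¬ R.Top → R.Iso (S1 K).swap := fun hs ht => (hR.swap.iso_S1 hs ht).swap
  unfold Plus
  change _ ∨ _ ∨ _ ∨ R.swap.Soc ∧ R.swap.Top
  tauto

/-- Nilpotent endomorphisms of bricks vanish. -/
theorem IsBrick.endo_eq_zero {R : QRep K} (hR : R.IsBrick) (F : Hom R R) (k : ℕ)
    (hf : ∀ v, F.f^[k] v = 0) (hg : ∀ w, F.g^[k] w = 0) :
    (∀ v, F.f v = 0) ∧ ∀ w, F.g w = 0 := by
  obtain ⟨c, h1, h2⟩ := hR.2 F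
  have h1' : ∀ k v, F.f^[k] v = c ^ k • v := fun k => by
    induction k with
    | zero => simp
    | succ k ih => intro v; rw [Function.iterate_succ_apply, ih, h1, smul_smul, pow_succ]
  have h2' : ∀ k v, F.g^[k] v = c ^ k • v := fun k => by
    induction k with
    | zero => simp
    | succ k ih => intro v; rw [Function.iterate_succ_apply, ih, h2, smul_smul, pow_succ]
  have hc : c = 0 := by
    have := hR.1
    obtain ⟨x, hx⟩ := exists_ne (0 : R.V × R.W)
    by_contra hc
    refine hx (Prod.ext ?_ ?_)
    · simpa [h1', hc] using hf x.1
    · simpa [h2', hc] using hg x.2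
  subst hc
  exact ⟨fun v => by rw [h1, zero_smul], fun w => by rw [h2, zero_smul]⟩

end QRep

/-! ### The standard representations -/

namespace QRep

variable {K : Type} [Field K]

/-- The representation `1 → 2`. -/
abbrev X11 (K : Type) [Field K] : QRep K where
  V := Fin 1 → K
  W := Fin 1 → K
  a := 0
  b := 0
  u := { toFun := fun v => ![v 0]
         map_add' := by simp
         map_smul' := by simp }
  n := 0

/-- The representation `1 → 1 → 2`. -/
abbrev X21 (K : Type) [Field K] : QRep K where
  V := Fin 2 → K
  W := Fin 1 → K
  a := { toFun := fun v => ![0, v 0]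
         map_add' := by simp
         map_smul' := by simp }
  b := 0
  u := { toFun := fun v => ![v 1]
         map_add' := by simp
         map_smul' := by simp }
  n := 0

/-- The representation `1 → 2 → 2`. -/
abbrev X12 (K : Type) [Field K] : QRep K where
  V := Fin 1 → K
  W := Fin 2 → K
  a := 0
  b := { toFun := fun v => ![0, v 0]
         map_add' := by simp
         map_smul' := by simp }
  u := { toFun := fun v => ![v 0, 0]
         map_add' := by simp
         map_smul' := by simp }
  n := 0

/-- The representation `1 → 1 → 1 → 2`. -/
abbrev X31 (K : Type) [Field K] : QRep K where
  V := Fin 3 → K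
  W := Fin 1 → K
  a := { toFun := fun v => ![0, v 0, v 1]
         map_add' := by simp
         map_smul' := by simp }
  b := 0
  u := { toFun := fun v => ![v 2]
         map_add' := by simp
         map_smul' := by simp }
  n := 0

/-- The representation `1 → 1 → 1` with arrows from the last two basis vectors to
two basis vectors at `2`. -/
abbrev X32 (K : Type) [Field K] : QRep K where
  V := Fin 3 → K
  W := Fin 2 → K
  a := { toFun := fun v => ![0, v 0, v 1]
         map_add' := by simp
         map_smul' := by simp }
  b := 0
  u := { toFun := fun v => ![v 1, v 2]
         map_add' := by simp
         map_smul' := by simp }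
  n := 0

/-- The representation `1 → 2 → 2 → 2`. -/
abbrev X13 (K : Type) [Field K] : QRep K where
  V := Fin 1 → K
  W := Fin 3 → K
  a := 0
  b := { toFun := fun v => ![0, v 0, v 1]
         map_add' := by simp
         map_smul' := by simp }
  u := { toFun := fun v => ![v 0, 0, 0]
         map_add' := by simp
         map_smul' := by simp }
  n := 0

/-- The representation `2 → 2 → 2` with arrows from two basis vectors at `1` to the
first two basis vectors. -/
abbrev X23 (K : Type) [Field K] : QRep K where
  V := Fin 2 → K
  W := Fin 3 → K
  a := 0
  b := { toFun := fun v => ![0, v 0, v 1]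
         map_add' := by simp
         map_smul' := by simp }
  u := { toFun := fun v => ![v 0, v 1, 0]
         map_add' := by simp
         map_smul' := by simp }
  n := 0

theorem eq_basis_1 (v : Fin 1 → K) : v = v 0 • ![1] := by
  funext i
  fin_cases i
  simp

theorem map_vec_zero_1 {Y : Type} [AddCommGroup Y] [Module K Y] (f : (Fin 1 → K) →ₗ[K] Y) :
    f ![0] = 0 := by
  rw [show (![0] : Fin 1 → K) = 0 by simp [← List.ofFn_inj], map_zero]

theorem eq_basis_2 (v : Fin 2 → K) : v = v 0 • ![1, 0] + v 1 • ![0, 1] := by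
  funext i
  fin_cases i <;> simp

theorem map_vec_zero_2 {Y : Type} [AddCommGroup Y] [Module K Y] (f : (Fin 2 → K) →ₗ[K] Y) :
    f ![0, 0] = 0 := by
  rw [show (![0, 0] : Fin 2 → K) = 0 by simp [← List.ofFn_inj], map_zero]

theorem exists_vec_1 {X : Type} (v : Fin 1 → X) : ∃ x0, v = ![x0] :=
  ⟨v 0, by simp [← List.ofFn_inj]⟩

theorem exists_vec_2 {X : Type} (v : Fin 2 → X) : ∃ x0 x1, v = ![x0, x1] :=
  ⟨v 0, v 1, by simp [← List.ofFn_inj]⟩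

theorem eq_basis_3 (v : Fin 3 → K) :
    v = v 0 • ![1, 0, 0] + v 1 • ![0, 1, 0] + v 2 • ![0, 0, 1] := by
  funext i
  fin_cases i <;> simp

theorem exists_vec_3 {X : Type} (v : Fin 3 → X) : ∃ x0 x1 x2, v = ![x0, x1, x2] :=
  ⟨v 0, v 1, v 2, by simp [← List.ofFn_inj]⟩

theorem isSchur_X11 : (X11 K).IsSchur := by
  intro h
  obtain ⟨p0, f0⟩ := exists_vec_1 (h.f ![1])
  have g0 := h.hu ![1]
  simp [f0] at g0
  refine ⟨p0, fun v => ?_, fun w => ?_⟩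
  · rw [eq_basis_1 v]
    simp only [map_smul, f0]
    funext i
    fin_cases i
    simp [mul_comm]
  · rw [eq_basis_1 w]
    simp only [map_smul, g0]
    funext i
    fin_cases i
    simp [mul_comm]

theorem isSchur_X21 : (X21 K).IsSchur := by
  intro h
  obtain ⟨p0, p1, f0⟩ := exists_vec_2 (h.f ![1, 0])
  have f1 := h.ha ![1, 0]
  have u0 := congrFun (h.hu ![1, 0]) 0
  have g0 := h.hu ![0, 1]
  simp [f0] at f1
  simp [f0, map_vec_zero_1] at u0
  simp [f1] at g0
  obtain rfl : p1 = 0 := u0.symm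
  refine ⟨p0, fun v => ?_, fun w => ?_⟩
  · rw [eq_basis_2 v]
    simp only [map_add, map_smul, f0, f1]
    funext i
    fin_cases i <;> simp [mul_comm _ p0]
  · rw [eq_basis_1 w]
    simp only [map_smul, g0]
    funext i
    fin_cases i
    simp [mul_comm]

theorem isSchur_X12 : (X12 K).IsSchur := by
  intro h
  obtain ⟨p0, f0⟩ := exists_vec_1 (h.f ![1])
  have g0 := h.hu ![1]
  have g1 := h.hb ![1, 0]
  simp [f0] at g0
  simp [g0] at g1
  refine ⟨p0, fun v => ?_, fun w => ?_⟩
  · rw [eq_basis_1 v]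
    simp only [map_smul, f0]
    funext i
    fin_cases i
    simp [mul_comm]
  · rw [eq_basis_2 w]
    simp only [map_add, map_smul, g0, g1]
    funext i
    fin_cases i <;> simp [mul_comm _ p0]

theorem isSchur_X31 : (X31 K).IsSchur := by
  intro h
  obtain ⟨p0, p1, p2, f0⟩ := exists_vec_3 (h.f ![1, 0, 0])
  have f1 := h.ha ![1, 0, 0]
  have f2 := h.ha ![0, 1, 0]
  have u0 := congrFun (h.hu ![1, 0, 0]) 0
  have u1 := congrFun (h.hu ![0, 1, 0]) 0
  have g0 := h.hu ![0, 0, 1]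
  simp [f0] at f1
  simp [f1] at f2
  simp [f0, map_vec_zero_1] at u0
  simp [f1, map_vec_zero_1] at u1
  simp [f2] at g0
  obtain rfl : p2 = 0 := u0.symm
  obtain rfl : p1 = 0 := u1.symm
  refine ⟨p0, fun v => ?_, fun w => ?_⟩
  · rw [eq_basis_3 v]
    simp only [map_add, map_smul, f0, f1, f2]
    funext i
    fin_cases i <;> simp [mul_comm _ p0]
  · rw [eq_basis_1 w]
    simp only [map_smul, g0]
    funext i
    fin_cases i
    simp [mul_comm]

theorem isSchur_X32 : (X32 K).IsSchur := by
  intro h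
  obtain ⟨p0, p1, p2, f0⟩ := exists_vec_3 (h.f ![1, 0, 0])
  have f1 := h.ha ![1, 0, 0]
  have f2 := h.ha ![0, 1, 0]
  have u0 := congrFun (h.hu ![1, 0, 0]) 0
  have u1 := congrFun (h.hu ![1, 0, 0]) 1
  have g0 := h.hu ![0, 1, 0]
  have g1 := h.hu ![0, 0, 1]
  simp [f0] at f1
  simp [f1] at f2
  simp [f0, map_vec_zero_2] at u0
  simp [f0, map_vec_zero_2] at u1
  simp [f1] at g0
  simp [f2] at g1
  obtain rfl : p1 = 0 := u0.symm
  obtain rfl : p2 = 0 := u1.symm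
  refine ⟨p0, fun v => ?_, fun w => ?_⟩
  · rw [eq_basis_3 v]
    simp only [map_add, map_smul, f0, f1, f2]
    funext i
    fin_cases i <;> simp [mul_comm _ p0]
  · rw [eq_basis_2 w]
    simp only [map_add, map_smul, g0, g1]
    funext i
    fin_cases i <;> simp [mul_comm _ p0]

theorem isSchur_X13 : (X13 K).IsSchur := by
  intro h
  obtain ⟨p0, f0⟩ := exists_vec_1 (h.f ![1])
  have g0 := h.hu ![1]
  have g1 := h.hb ![1, 0, 0]
  have g2 := h.hb ![0, 1, 0]
  simp [f0] at g0
  simp [g0] at g1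
  simp [g1] at g2
  refine ⟨p0, fun v => ?_, fun w => ?_⟩
  · rw [eq_basis_1 v]
    simp only [map_smul, f0]
    funext i
    fin_cases i
    simp [mul_comm]
  · rw [eq_basis_3 w]
    simp only [map_add, map_smul, g0, g1, g2]
    funext i
    fin_cases i <;> simp [mul_comm _ p0]

theorem isSchur_X23 : (X23 K).IsSchur := by
  intro h
  obtain ⟨p0, p1, f0⟩ := exists_vec_2 (h.f ![1, 0])
  obtain ⟨q0, q1, f1⟩ := exists_vec_2 (h.f ![0, 1])
  have g0 := h.hu ![1, 0]
  have g1 := h.hb ![1, 0, 0]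
  have g2 := h.hb ![0, 1, 0]
  have u1 := h.hu ![0, 1]
  simp [f0] at g0
  simp [g0] at g1
  simp [g1] at g2
  simp [f1, g1] at u1
  obtain ⟨h0, h1, h2⟩ := u1
  obtain rfl : q0 = 0 := h0.symm
  obtain rfl : p0 = q1 := h1
  obtain rfl : p1 = 0 := h2
  refine ⟨p0, fun v => ?_, fun w => ?_⟩
  · rw [eq_basis_2 v]
    simp only [map_add, map_smul, f0, f1]
    funext i
    fin_cases i <;> simp [mul_comm _ p0]
  · rw [eq_basis_3 w]
    simp only [map_add, map_smul, g0, g1, g2]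
    funext i
    fin_cases i <;> simp [mul_comm _ p0]

end QRep

/-! ### Recognising the standard representations -/

namespace QRep

variable {K : Type} [Field K]

theorem Top.decomp {R : QRep K} (h : R.Top) (w : R.W) : ∃ v w', w = R.u v + R.b w' := by
  have := h (LinearMap.range R.u ⊔ LinearMap.range R.b)
    (fun w => Submodule.mem_sup_right ⟨w, rfl⟩) (fun v => Submodule.mem_sup_left ⟨v, rfl⟩) w
  obtain ⟨_, ⟨v, rfl⟩, _, ⟨w', rfl⟩, rfl⟩ := Submodule.mem_sup.1 this
  exact ⟨v, w', rfl⟩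

theorem IsBrick.iso_X11 {R : QRep K} (hR : R.IsBrick) (hn : ∀ w, R.n w = 0) (φ : R.W →ₗ[K] K)
    (hφ : ∃ w, φ w ≠ 0) (hb : ∀ w, φ (R.b w) = 0) (hua : ∀ v, φ (R.u (R.a v)) = 0) (v : R.V)
    (hv : R.u v ≠ 0) (ha : R.a v = 0) (hbu : R.b (R.u v) = 0) : R.Iso (X11 K) := by
  obtain ⟨w, hw⟩ := hφ
  refine hR.2.iso_of_comp isSchur_X11
    ⟨LinearMap.pi ![φ ∘ₗ R.u], LinearMap.pi ![φ], fun v => ?_, fun w => ?_, fun v => ?_,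
      fun w => ?_⟩
    ⟨(LinearMap.proj 0).smulRight v, (LinearMap.proj 0).smulRight (R.u v), fun v => ?_,
      fun w => ?_, fun v => ?_, fun w => ?_⟩ (.inr ⟨w, ?_⟩)
  · funext i; fin_cases i; simp [hua]
  · funext i; fin_cases i; simp [hb]
  · funext i; fin_cases i; simp
  · funext i; fin_cases i; simp [hn]
  · simp [ha]
  · simp [hbu]
  · simp
  · simp [hn]
  · simp [hw, hv]

theorem IsBrick.iso_X21 {R : QRep K} (hR : R.IsBrick) (hn : ∀ w, R.n w = 0) (φ : R.W →ₗ[K] K)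
    (hφ : ∃ w, φ w ≠ 0) (hb : ∀ w, φ (R.b w) = 0) (hua : ∀ v, φ (R.u (R.a (R.a v))) = 0)
    (v : R.V) (hv : R.u (R.a v) ≠ 0) (hu : R.u v = 0) (ha : R.a (R.a v) = 0)
    (hbu : R.b (R.u (R.a v)) = 0) : R.Iso (X21 K) := by
  obtain ⟨w, hw⟩ := hφ
  refine hR.2.iso_of_comp isSchur_X21
    ⟨LinearMap.pi ![φ ∘ₗ R.u ∘ₗ R.a, φ ∘ₗ R.u], LinearMap.pi ![φ], fun v => ?_, fun w => ?_,
      fun v => ?_, fun w => ?_⟩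
    ⟨(LinearMap.proj 0).smulRight v + (LinearMap.proj 1).smulRight (R.a v),
      (LinearMap.proj 0).smulRight (R.u (R.a v)), fun v => ?_,
      fun w => ?_, fun v => ?_, fun w => ?_⟩ (.inr ⟨w, ?_⟩)
  · funext i; fin_cases i <;> simp [hua]
  · funext i; fin_cases i; simp [hb]
  · funext i; fin_cases i; simp
  · funext i; fin_cases i <;> simp [hn]
  · simp [ha]
  · simp [hbu]
  · simp [hu]
  · simp [hn]
  · simp [hw, hv]

theorem IsBrick.iso_X31 {R : QRep K} (hR : R.IsBrick) (hn : ∀ w, R.n w = 0)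
    (hb : ∀ w, R.b w = 0) (ha : ∀ v, R.a (R.a (R.a v)) = 0)
    (v : R.V) (hv : R.u (R.a (R.a v)) ≠ 0) (hu : R.u v = 0) (hua : R.u (R.a v) = 0) :
    R.Iso (X31 K) := by
  obtain ⟨φ, ⟨w, hw⟩, -⟩ := exists_functional (P := ⊥) (fun h => hv ((Submodule.mem_bot K).1 h))
  refine hR.2.iso_of_comp isSchur_X31
    ⟨LinearMap.pi ![φ ∘ₗ R.u ∘ₗ R.a ∘ₗ R.a, φ ∘ₗ R.u ∘ₗ R.a, φ ∘ₗ R.u], LinearMap.pi ![φ],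
      fun v => ?_, fun w => ?_, fun v => ?_, fun w => ?_⟩
    ⟨(LinearMap.proj 0).smulRight v + (LinearMap.proj 1).smulRight (R.a v) +
        (LinearMap.proj 2).smulRight (R.a (R.a v)),
      (LinearMap.proj 0).smulRight (R.u (R.a (R.a v))), fun v => ?_,
      fun w => ?_, fun v => ?_, fun w => ?_⟩ (.inr ⟨w, ?_⟩)
  · funext i; fin_cases i <;> simp [ha]
  · funext i; fin_cases i; simp [hb]
  · funext i; fin_cases i; simp
  · funext i; fin_cases i <;> simp [hn]
  · simp [ha]
  · simp [hb]
  · simp [hu, hua]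
  · simp [hn]
  · simp [hw, hv]

theorem IsBrick.iso_X12 {R : QRep K} (hR : R.IsBrick) (hn : ∀ w, R.n w = 0) (φ : R.W →ₗ[K] K)
    (hφ : ∃ v, φ (R.b (R.u v)) ≠ 0) (hu : ∀ v, φ (R.u v) = 0) (hb : ∀ w, φ (R.b (R.b w)) = 0)
    (hbua : ∀ v, φ (R.b (R.u (R.a v))) = 0) (v : R.V) (hv : v ≠ 0) (ha : R.a v = 0)
    (hbu : R.b (R.b (R.u v)) = 0) : R.Iso (X12 K) := by
  obtain ⟨w, hw⟩ := hφ
  refine hR.2.iso_of_comp isSchur_X12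
    ⟨LinearMap.pi ![φ ∘ₗ R.b ∘ₗ R.u], LinearMap.pi ![φ ∘ₗ R.b, φ], fun v => ?_, fun w => ?_,
      fun v => ?_, fun w => ?_⟩
    ⟨(LinearMap.proj 0).smulRight v,
      (LinearMap.proj 0).smulRight (R.u v) + (LinearMap.proj 1).smulRight (R.b (R.u v)),
      fun v => ?_, fun w => ?_, fun v => ?_, fun w => ?_⟩ (.inl ⟨w, ?_⟩)
  · funext i; fin_cases i; simp [hbua]
  · funext i; fin_cases i <;> simp [hb]
  · funext i; fin_cases i <;> simp [hu]
  · funext i; fin_cases i; simp [hn]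
  · simp [ha]
  · simp [hbu]
  · simp
  · simp [hn]
  · simp [hw, hv]

theorem IsBrick.iso_X13 {R : QRep K} (hR : R.IsBrick) (hn : ∀ w, R.n w = 0)
    (ha : ∀ v, R.a v = 0) (hb : ∀ w, R.b (R.b (R.b w)) = 0) (φ : R.W →ₗ[K] K)
    (hφ : ∃ v, φ (R.b (R.b (R.u v))) ≠ 0) (hu : ∀ v, φ (R.u v) = 0)
    (hbu : ∀ v, φ (R.b (R.u v)) = 0) : R.Iso (X13 K) := by
  obtain ⟨v, hv⟩ := hφ
  have hv0 : v ≠ 0 := by rintro rfl; simp at hv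
  refine hR.2.iso_of_comp isSchur_X13
    ⟨LinearMap.pi ![φ ∘ₗ R.b ∘ₗ R.b ∘ₗ R.u], LinearMap.pi ![φ ∘ₗ R.b ∘ₗ R.b, φ ∘ₗ R.b, φ],
      fun v => ?_, fun w => ?_, fun v => ?_, fun w => ?_⟩
    ⟨(LinearMap.proj 0).smulRight v,
      (LinearMap.proj 0).smulRight (R.u v) + (LinearMap.proj 1).smulRight (R.b (R.u v)) +
        (LinearMap.proj 2).smulRight (R.b (R.b (R.u v))),
      fun v => ?_, fun w => ?_, fun v => ?_, fun w => ?_⟩ (.inl ⟨v, ?_⟩)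
  · funext i; fin_cases i; simp [ha]
  · funext i; fin_cases i <;> simp [hb]
  · funext i; fin_cases i <;> simp [hu, hbu]
  · funext i; fin_cases i; simp [hn]
  · simp [ha]
  · simp [hb]
  · simp
  · simp [hn]
  · simp [hv, hv0]

theorem IsBrick.iso_X23 {R : QRep K} (hR : R.IsBrick) (hn : ∀ w, R.n w = 0)
    (ha : ∀ v, R.a v = 0) (hb : ∀ w, R.b (R.b (R.b w)) = 0) (φ : R.W →ₗ[K] K)
    (hφ : ∃ w, φ (R.b (R.b w)) ≠ 0) (hu : ∀ v, φ (R.u v) = 0) (v v' : R.V) (hv : R.u v ≠ 0)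
    (hvv : R.b (R.u v) = R.u v') : R.Iso (X23 K) := by
  obtain ⟨w, hw⟩ := hφ
  have h0 : ∃ w, φ (R.b (R.b w)) • R.u v + φ (R.b w) • R.b (R.u v) +
      φ w • R.b (R.b (R.u v)) ≠ 0 := by
    by_contra! h
    have h1 := h (R.b (R.b w))
    have h2 := h (R.b w)
    have h3 := h w
    simp [hb, hw] at h1
    simp [hb, hw, h1] at h2
    simp [hw, h2, hv] at h3
  obtain ⟨w, hw⟩ := h0
  refine hR.2.iso_of_comp isSchur_X23
    ⟨LinearMap.pi ![φ ∘ₗ R.b ∘ₗ R.b ∘ₗ R.u, φ ∘ₗ R.b ∘ₗ R.u],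
      LinearMap.pi ![φ ∘ₗ R.b ∘ₗ R.b, φ ∘ₗ R.b, φ],
      fun v => ?_, fun w => ?_, fun v => ?_, fun w => ?_⟩
    ⟨(LinearMap.proj 0).smulRight v + (LinearMap.proj 1).smulRight v',
      (LinearMap.proj 0).smulRight (R.u v) + (LinearMap.proj 1).smulRight (R.b (R.u v)) +
        (LinearMap.proj 2).smulRight (R.b (R.b (R.u v))),
      fun v => ?_, fun w => ?_, fun v => ?_, fun w => ?_⟩ (.inr ⟨w, by simpa using hw⟩)
  · funext i; fin_cases i <;> simp [ha]
  · funext i; fin_cases i <;> simp [hb]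
  · funext i; fin_cases i <;> simp [hu]
  · funext i; fin_cases i <;> simp [hn]
  · simp [ha]
  · simp [hb]
  · simp [hvv]
  · simp [hn]

theorem IsBrick.iso_X32 {R : QRep K} (hR : R.IsBrick) (hn : ∀ w, R.n w = 0)
    (hb : ∀ w, R.b w = 0) (ha : ∀ v, R.a (R.a (R.a v)) = 0)
    (hu : Function.Surjective R.u) (ψ : R.V →ₗ[K] K) (hψ : ∃ v, ψ v ≠ 0)
    (hk : ∀ v, R.u v = 0 → ψ v = 0) (hak : ∀ v, R.u v = 0 → ψ (R.a v) = 0) (v : R.V)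
    (hv : R.a (R.a v) ≠ 0) (hv0 : R.u v = 0) : R.Iso (X32 K) := by
  obtain ⟨w, hw⟩ := hψ
  obtain ⟨σ, hσ⟩ := R.u.exists_rightInverse_of_surjective (LinearMap.range_eq_top.2 hu)
  have hσ' : ∀ v, R.u (σ (R.u v) - v) = 0 := fun v => by
    rw [map_sub, ← LinearMap.comp_apply, hσ, LinearMap.id_apply, sub_self]
  have h1 : ∀ v, ψ (σ (R.u v)) = ψ v := fun v => by
    rw [← sub_eq_zero, ← map_sub, hk _ (hσ' v)]
  have h2 : ∀ v, ψ (R.a (σ (R.u v))) = ψ (R.a v) := fun v => by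
    rw [← sub_eq_zero, ← map_sub, ← map_sub, hak _ (hσ' v)]
  have h0 : ∃ w, ψ (R.a (R.a w)) • v + ψ (R.a w) • R.a v + ψ w • R.a (R.a v) ≠ 0 := by
    by_contra! h
    have h3 := h w
    have h1 := congrArg (fun x => R.a (R.a x)) h3
    have h2 := congrArg R.a h3
    simp [ha, hv] at h1
    simp [ha, hv, h1] at h2
    simp [hw, h2, hv, h1] at h3
  obtain ⟨w, hw⟩ := h0
  refine hR.2.iso_of_comp isSchur_X32
    ⟨LinearMap.pi ![ψ ∘ₗ R.a ∘ₗ R.a, ψ ∘ₗ R.a, ψ],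
      LinearMap.pi ![ψ ∘ₗ R.a ∘ₗ σ, ψ ∘ₗ σ],
      fun v => ?_, fun w => ?_, fun v => ?_, fun w => ?_⟩
    ⟨(LinearMap.proj 0).smulRight v + (LinearMap.proj 1).smulRight (R.a v) +
        (LinearMap.proj 2).smulRight (R.a (R.a v)),
      (LinearMap.proj 0).smulRight (R.u (R.a v)) +
        (LinearMap.proj 1).smulRight (R.u (R.a (R.a v))),
      fun v => ?_, fun w => ?_, fun v => ?_, fun w => ?_⟩ (.inl ⟨w, by simpa using hw⟩)
  · funext i; fin_cases i <;> simp [ha]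
  · funext i; fin_cases i <;> simp [hb]
  · funext i; fin_cases i <;> simp [h1, h2]
  · funext i; fin_cases i <;> simp [hn]
  · simp [ha]
  · simp [hb]
  · simp [hv0]
  · simp [hn]

end QRep

/-! ### Bricks with top at `1` and socle at `2` -/

namespace QRep

variable {K : Type} [Field K]

/-- A decomposition `X = P ⊕ a P` gives rise to a nilpotent operator commuting with `a`. -/
theorem exists_commuting {X : Type} [AddCommGroup X] [Module K X] (a : X →ₗ[K] X)
    (ha : ∀ x, a (a (a x)) = 0) (P : Submodule K X) (hP : ∀ x, ∃ q ∈ P, x - a q ∈ P)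
    (hP' : ∀ q ∈ P, a q ∈ P → q = 0) :
    ∃ F : X →ₗ[K] X, (∀ x, F (a x) = a (F x)) ∧ (∀ x ∈ P, F x ∈ P) ∧
      (∀ x, F (F (F x)) = 0) ∧ ((∀ x, F x = 0) → ∀ x ∈ P, a (a x) = 0) := by
  obtain ⟨D, hD⟩ : ∃ D : X →ₗ[K] X, ∀ x, D x ∈ P ∧ x - a (D x) ∈ P := by
    let e := LinearEquiv.ofBijective (P.mkQ ∘ₗ a ∘ₗ P.subtype) ⟨by
      rw [injective_iff_map_eq_zero]
      rintro ⟨q, hq⟩ h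
      simp only [LinearMap.comp_apply, Submodule.subtype_apply, Submodule.mkQ_apply,
        Submodule.Quotient.mk_eq_zero] at h
      exact Subtype.ext (hP' q hq h), by
      intro y
      obtain ⟨x, rfl⟩ := P.mkQ_surjective y
      obtain ⟨q, hq, h⟩ := hP x
      refine ⟨⟨q, hq⟩, ?_⟩
      simp only [LinearMap.comp_apply, Submodule.subtype_apply]
      rw [Eq.comm, ← sub_eq_zero, ← map_sub]
      exact (Submodule.Quotient.mk_eq_zero P).2 h⟩
    refine ⟨P.subtype ∘ₗ e.symm.toLinearMap ∘ₗ P.mkQ, fun x => ⟨Subtype.prop _, ?_⟩⟩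
    have h : P.mkQ (a (e.symm (P.mkQ x))) = P.mkQ x := e.apply_symm_apply _
    exact (Submodule.Quotient.mk_eq_zero P).1
      ((map_sub P.mkQ _ _).trans (sub_eq_zero.2 h.symm))
  have huniq : ∀ x, ∀ q ∈ P, x - a q ∈ P → D x = q := fun x q hq hx => by
    refine sub_eq_zero.1 (hP' _ (P.sub_mem (hD x).1 hq) ?_)
    rw [map_sub]
    simpa using P.sub_mem hx (hD x).2
  have hD0 : ∀ x ∈ P, D x = 0 := fun x hx => huniq x 0 P.zero_mem (by simpa using hx)
  have hDa : ∀ x ∈ P, D (a x) = x := fun x hx => huniq _ x hx (by simp)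
  obtain ⟨Q, hQ⟩ : ∃ Q : X →ₗ[K] X, ∀ x, Q x = D (a (a x)) := ⟨D ∘ₗ a ∘ₗ a, fun x => rfl⟩
  have hQP : ∀ x, Q x ∈ P := fun x => hQ x ▸ (hD _).1
  have hQa : ∀ x, Q (a x) = 0 := fun x => by rw [hQ, ha, map_zero]
  have haa : ∀ x ∈ P, a (a x) = a (Q x) - Q (Q x) := fun x hx => by
    have hp : a (a x) - a (Q x) ∈ P := by
      rw [hQ]
      exact (hD (a (a x))).2
    have h1 : D (a (a (a x) - a (Q x)) + a (a (Q x))) = 0 := by simp [ha]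
    rw [map_add, hDa _ hp, ← hQ] at h1
    rw [← sub_eq_zero, ← h1]
    abel
  have hQQQ : ∀ x ∈ P, Q (Q (Q x)) = 0 := fun x hx => by
    have h1 : a (a (a x)) = 0 := ha x
    rw [haa x hx, map_sub, haa _ (hQP x)] at h1
    simpa using h1
  have hQD : ∀ x, Q x = Q (x - a (D x)) := fun x => by rw [map_sub, hQa, sub_zero]
  have hQ3 : ∀ x, Q (Q (Q x)) = 0 := fun x => by rw [hQD x, hQQQ _ (hD x).2]
  have hDax : ∀ x, D (a x) = x - a (D x) + Q (D x) := fun x => by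
    refine huniq _ _ (P.add_mem (hD x).2 (hQP _)) ?_
    rw [map_add, map_sub, haa _ (hD x).1]
    have : a x - (a x - (a (Q (D x)) - Q (Q (D x))) + a (Q (D x))) = - Q (Q (D x)) := by abel
    rw [this]
    exact P.neg_mem (hQP _)
  have hDQ : ∀ x, D (Q x) = 0 := fun x => hD0 _ (hQP x)
  have hDaQ : ∀ x, D (a (Q x)) = Q x := fun x => hDa _ (hQP x)
  refine ⟨Q + a ∘ₗ Q ∘ₗ D, fun x => ?_, fun x hx => ?_, fun x => ?_, fun h x hx => ?_⟩
  · simp only [LinearMap.add_apply, LinearMap.comp_apply, hQa, hDax, map_add, map_sub,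
      haa _ (hQP (D x)), hQQQ _ (hD x).1]
    simp
  · simp [hD0 x hx, hQP]
  · simp [hQa, hQ3, hDQ, hDaQ]
  · have h1 : Q x = 0 := by simpa [hD0 x hx] using h x
    rw [haa x hx, h1, map_zero, map_zero, sub_zero]

theorem Iso.exists_a_ne {R : QRep K} (h : R.Iso (X21 K)) : ∃ v, R.a v ≠ 0 := by
  obtain ⟨h, k, -, -, h3, -⟩ := h
  refine ⟨k.f ![1, 0], fun h0 => ?_⟩
  have := h.ha (k.f ![1, 0])
  rw [h3, h0, map_zero] at this
  exact zero_ne_one (congrFun this 1)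

theorem Iso.exists_b_ne {R : QRep K} (h : R.Iso (X12 K)) : ∃ w, R.b w ≠ 0 := by
  obtain ⟨h, k, -, -, -, h3⟩ := h
  refine ⟨k.g ![1, 0], fun h0 => ?_⟩
  have := h.hb (k.g ![1, 0])
  rw [h3, h0, map_zero] at this
  exact zero_ne_one (congrFun this 1)

theorem IsBrick.core_D {R : QRep K} (hR : R.IsBrick) (hP : R.Plus) (hn : ∀ w, R.n w = 0)
    (ha : ∀ v, R.a (R.a v) = 0) (hb : ∀ w, R.b (R.b w) = 0)
    (hbua : ∀ v, R.b (R.u (R.a v)) = 0) :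
    R.Iso (X11 K) ∨ R.Iso (X21 K) ∨ R.Iso (X12 K) := by
  have hdec : ∀ w, ∃ v v', w = R.u v + R.b (R.u v') := fun w => by
    obtain ⟨v, w', rfl⟩ := hP.2.decomp w
    obtain ⟨v', w'', rfl⟩ := hP.2.decomp w'
    exact ⟨v, v', by simp [hb]⟩
  obtain ⟨v0, hv0⟩ : ∃ v : R.V, v ≠ 0 := by
    by_contra! h
    have := hR.1
    obtain ⟨x, hx⟩ := exists_ne (0 : R.V × R.W)
    refine hx (Prod.ext (h _) ?_)
    obtain ⟨v, v', h2⟩ := hdec x.2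
    rw [h2, h v, h v']
    simp
  obtain ⟨v1, hv1, hav1⟩ : ∃ v, v ≠ 0 ∧ R.a v = 0 := by
    by_cases h : R.a v0 = 0
    · exact ⟨v0, hv0, h⟩
    · exact ⟨_, h, ha _⟩
  by_cases hinj : ∀ v, R.u v = 0 → v = 0
  · by_cases hsur : ∀ w, w ∈ LinearMap.range R.u
    · left
      obtain ⟨v, hv, hav, hbv⟩ : ∃ v, v ≠ 0 ∧ R.a v = 0 ∧ R.b (R.u v) = 0 := by
        by_cases h : R.a v0 = 0
        · by_cases h' : ∀ v, R.a v = 0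
          · by_cases h2 : R.b (R.u v0) = 0
            · exact ⟨v0, hv0, h, h2⟩
            · obtain ⟨v', hv'⟩ := hsur (R.b (R.u v0))
              refine ⟨v', ?_, h' _, by rw [hv', hb]⟩
              rintro rfl
              exact h2 (by rw [← hv', map_zero])
          · push Not at h'
            obtain ⟨v, hv⟩ := h'
            exact ⟨_, hv, ha _, hbua _⟩
        · exact ⟨_, h, ha _, hbua _⟩
      obtain ⟨w, hw⟩ : ∃ w, w ∉ LinearMap.range R.b ⊔ LinearMap.range (R.u ∘ₗ R.a) := by
        by_contra! h
        have h' : ∀ w, ∃ w' v, R.b w' + R.u (R.a v) = w := fun w => by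
          obtain ⟨_, ⟨w', rfl⟩, _, ⟨v', rfl⟩, rfl⟩ := Submodule.mem_sup.1 (h w)
          exact ⟨w', v', rfl⟩
        have hb0 : ∀ w, R.b w = 0 := fun w => by
          obtain ⟨w', v', rfl⟩ := h' w
          simp [hb, hbua]
        have ha0 : ∀ v, ∃ v', v = R.a v' := fun v => by
          obtain ⟨w', v', h⟩ := h' (R.u v)
          refine ⟨v', sub_eq_zero.1 (hinj _ ?_)⟩
          rw [map_sub, ← h, hb0]
          simp
        obtain ⟨v', rfl⟩ := ha0 v0
        obtain ⟨v'', rfl⟩ := ha0 v'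
        exact hv0 (ha _)
      obtain ⟨φ, hφ, hφ0⟩ := exists_functional hw
      exact hR.iso_X11 hn φ hφ (fun w => hφ0 _ (Submodule.mem_sup_left ⟨w, rfl⟩))
        (fun v => hφ0 _ (Submodule.mem_sup_right ⟨v, rfl⟩)) v (fun h => hv (hinj _ h)) hav hbv
    · right; right
      push Not at hsur
      obtain ⟨w, hw⟩ := hsur
      obtain ⟨φ, ⟨y, hy⟩, hφ0⟩ := exists_functional hw
      have hφu : ∀ v, φ (R.u v) = 0 := fun v => hφ0 _ ⟨v, rfl⟩
      obtain ⟨v, v', rfl⟩ := hdec y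
      exact hR.iso_X12 hn φ ⟨v', by simpa [hφu] using hy⟩ hφu (by simp [hb]) (by simp [hbua]) v1
        hv1 hav1 (hb _)
  · right; left
    push Not at hinj
    obtain ⟨v, hv, hv'⟩ := hinj
    have hua : R.u (R.a v) ≠ 0 := fun h => hv' (hP.1 _ (hP.1 _ (ha _) h) hv)
    obtain ⟨w, hw⟩ : ∃ w, w ∉ LinearMap.range R.b := by
      by_contra! h
      obtain ⟨w, hw⟩ := h (R.u (R.a v))
      obtain ⟨w', rfl⟩ := h w
      exact hua (by rw [← hw, hb])
    obtain ⟨φ, hφ, hφ0⟩ := exists_functional hw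
    exact hR.iso_X21 hn φ hφ (fun w => hφ0 _ ⟨w, rfl⟩) (by simp [ha]) v hua hv (ha _) (hbua _)

theorem IsBrick.core_C {R : QRep K} (hR : R.IsBrick) (hP : R.Plus) (hn : ∀ w, R.n w = 0)
    (hb : ∀ w, R.b w = 0) (ha : ∀ v, R.a (R.a (R.a v)) = 0) :
    R.Iso (X11 K) ∨ R.Iso (X21 K) ∨ R.Iso (X31 K) ∨ R.Iso (X32 K) := by
  have hsur : Function.Surjective R.u := fun w => by
    obtain ⟨v, w', rfl⟩ := hP.2.decomp w
    exact ⟨v, by simp [hb]⟩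
  obtain ⟨σ, hσ⟩ := R.u.exists_rightInverse_of_surjective (LinearMap.range_eq_top.2 hsur)
  have hσ' : ∀ v, R.u (σ (R.u v) - v) = 0 := fun v => by
    rw [map_sub, ← LinearMap.comp_apply, hσ, LinearMap.id_apply, sub_self]
  -- Operators commuting with `a` and stabilising the kernel of `u` extend to endomorphisms.
  have hext : ∀ F : R.V →ₗ[K] R.V, (∀ v, F (R.a v) = R.a (F v)) →
      (∀ v, R.u v = 0 → R.u (F v) = 0) → (∀ v, F (F (F v)) = 0) → ∀ v, F v = 0 := by
    intro F hF hFu hF3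
    have h1 : ∀ v, R.u (F (σ (R.u v))) = R.u (F v) := fun v => by
      rw [← sub_eq_zero, ← map_sub, ← map_sub, hFu _ (hσ' v)]
    refine (hR.endo_eq_zero ⟨F, R.u ∘ₗ F ∘ₗ σ, hF, by simp [hb], by simpa using h1,
      by simp [hn]⟩ 3 hF3 fun w => ?_).1
    obtain ⟨v, rfl⟩ := hsur w
    simp [h1, hF3]
  by_cases h1 : ∃ v, v ≠ 0 ∧ R.u v = 0 ∧ R.u (R.a v) = 0
  · obtain ⟨v, hv, hu, hua⟩ := h1
    exact .inr (.inr (.inl (hR.iso_X31 hn hb ha v (fun h => hv (hP.1 _ (hP.1 _ (hP.1 _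
      (ha _) h) hua) hu)) hu hua)))
  push Not at h1
  have h1' : ∀ v, R.u v = 0 → R.u (R.a v) = 0 → v = 0 := fun v hu hua => by
    by_contra hv
    exact h1 v hv hu hua
  by_cases hinj : ∀ v, R.u v = 0 → v = 0
  · left
    have ha0 : ∀ v, R.a v = 0 := hext R.a (fun _ => rfl) (fun v hv => by simp [hinj v hv]) ha
    rcases hR.core_D hP hn (by simp [ha0]) (by simp [hb]) (by simp [hb]) with h | h | h
    · exact h
    · obtain ⟨v, hv⟩ := h.exists_a_ne
      exact absurd (ha0 v) hv
    · obtain ⟨w, hw⟩ := h.exists_b_ne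
      exact absurd (hb w) hw
  push Not at hinj
  obtain ⟨v0, hv0, hv0'⟩ := hinj
  by_cases haa : ∀ v, R.u v = 0 → R.a (R.a v) = 0
  · right; left
    obtain ⟨w, hw⟩ : ∃ w, w ∉ LinearMap.range (R.u ∘ₗ R.a ∘ₗ R.a) := by
      by_contra! h
      have haa0 : ∀ v, R.a (R.a v) = 0 := fun v => by
        obtain ⟨v', hv'⟩ := h (R.u v)
        have := haa (v - R.a (R.a v')) (by rw [map_sub, ← hv']; simp)
        simpa [ha] using this
      obtain ⟨v', hv'⟩ := h (R.u (R.a v0))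
      exact hv0' (h1' v0 hv0 (by rw [← hv']; simp [haa0]))
    obtain ⟨φ, hφ, hφ0⟩ := exists_functional hw
    exact hR.iso_X21 hn φ hφ (by simp [hb]) (fun v => hφ0 _ ⟨v, rfl⟩) v0
      (fun h => hv0' (h1' v0 hv0 h)) hv0 (haa _ hv0) (hb _)
  · right; right; right
    push Not at haa
    obtain ⟨v, hv, hav⟩ := haa
    have hex : ∃ w, w ∉ LinearMap.ker R.u ⊔ (LinearMap.ker R.u).map R.a := by
      by_contra! h
      obtain ⟨F, hF1, hF2, hF3, hF4⟩ := exists_commuting R.a ha (LinearMap.ker R.u)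
        (fun x => by
          obtain ⟨p, hp, _, ⟨q, hq, rfl⟩, rfl⟩ := Submodule.mem_sup.1 (h x)
          exact ⟨q, hq, by simpa using hp⟩) (fun q hq hq' => h1' q hq hq')
      exact hav (hF4 (hext F hF1 hF2 hF3) v hv)
    obtain ⟨w, hw⟩ := hex
    obtain ⟨ψ, hψ, hψ0⟩ := exists_functional hw
    exact hR.iso_X32 hn hb ha hsur ψ hψ (fun v hv => hψ0 _ (Submodule.mem_sup_left hv))
      (fun v hv => hψ0 _ (Submodule.mem_sup_right ⟨v, hv, rfl⟩)) v hav hv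

theorem IsBrick.core_C' {R : QRep K} (hR : R.IsBrick) (hP : R.Plus) (hn : ∀ w, R.n w = 0)
    (ha : ∀ v, R.a v = 0) (hb : ∀ w, R.b (R.b (R.b w)) = 0) :
    R.Iso (X11 K) ∨ R.Iso (X12 K) ∨ R.Iso (X13 K) ∨ R.Iso (X23 K) := by
  have hinj : ∀ v, R.u v = 0 → v = 0 := fun v => hP.1 v (ha v)
  obtain ⟨σ, hσ⟩ := R.u.exists_leftInverse_of_injective
    (LinearMap.ker_eq_bot'.2 hinj)
  have hσ' : ∀ v, σ (R.u v) = v := fun v => LinearMap.congr_fun hσ v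
  -- Operators commuting with `b` and stabilising the image of `u` extend to endomorphisms.
  have hext : ∀ F : R.W →ₗ[K] R.W, (∀ v, F (R.b v) = R.b (F v)) →
      (∀ w ∈ LinearMap.range R.u, F w ∈ LinearMap.range R.u) → (∀ v, F (F (F v)) = 0) →
      ∀ v, F v = 0 := by
    intro F hF hFu hF3
    have h1 : ∀ v, R.u (σ (F (R.u v))) = F (R.u v) := fun v => by
      obtain ⟨v', hv'⟩ := hFu _ ⟨v, rfl⟩
      rw [← hv', hσ']
    refine (hR.endo_eq_zero ⟨σ ∘ₗ F ∘ₗ R.u, F, by simp [ha], hF, by simp [h1],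
      by simp [hn]⟩ 3 (fun v => ?_) hF3).2
    have h2 : R.u (σ (F (F (R.u v)))) = F (F (R.u v)) := by rw [← h1, h1 (σ _)]
    simp [h1, h2, hF3]
  have hdec : ∀ w, ∃ v v' v'', w = R.u v + R.b (R.u v') + R.b (R.b (R.u v'')) := fun w => by
    obtain ⟨v, w', rfl⟩ := hP.2.decomp w
    obtain ⟨v', w'', rfl⟩ := hP.2.decomp w'
    obtain ⟨v'', w''', rfl⟩ := hP.2.decomp w''
    exact ⟨v, v', v'', by simp [hb, add_assoc]⟩
  obtain ⟨v0, hv0⟩ : ∃ v : R.V, v ≠ 0 := by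
    by_contra! h
    have := hR.1
    obtain ⟨x, hx⟩ := exists_ne (0 : R.V × R.W)
    refine hx (Prod.ext (h _) ?_)
    obtain ⟨v, v', v'', h2⟩ := hdec x.2
    rw [h2, h v, h v', h v'']
    simp
  by_cases hsup : ∀ w, w ∈ LinearMap.range R.u ⊔ LinearMap.range (R.b ∘ₗ R.u)
  swap
  · right; right; left
    push Not at hsup
    obtain ⟨w, hw⟩ := hsup
    obtain ⟨φ, ⟨y, hy⟩, hφ0⟩ := exists_functional hw
    have hφu : ∀ v, φ (R.u v) = 0 := fun v => hφ0 _ (Submodule.mem_sup_left ⟨v, rfl⟩)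
    have hφbu : ∀ v, φ (R.b (R.u v)) = 0 := fun v => hφ0 _ (Submodule.mem_sup_right ⟨v, rfl⟩)
    obtain ⟨v, v', v'', rfl⟩ := hdec y
    exact hR.iso_X13 hn ha hb φ ⟨v'', by simpa [hφu, hφbu] using hy⟩ hφu hφbu
  have hdec' : ∀ w, ∃ v v', w = R.u v + R.b (R.u v') := fun w => by
    obtain ⟨_, ⟨v, rfl⟩, _, ⟨v', rfl⟩, rfl⟩ := Submodule.mem_sup.1 (hsup w)
    exact ⟨v, v', rfl⟩
  by_cases hsur : ∀ w, w ∈ LinearMap.range R.u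
  · left
    have hb0 : ∀ w, R.b w = 0 := hext R.b (fun _ => rfl) (fun w _ => hsur _) hb
    rcases hR.core_D hP hn (by simp [ha]) (by simp [hb0]) (by simp [ha]) with h | h | h
    · exact h
    · obtain ⟨v, hv⟩ := h.exists_a_ne
      exact absurd (ha v) hv
    · obtain ⟨w, hw⟩ := h.exists_b_ne
      exact absurd (hb0 w) hw
  push Not at hsur
  obtain ⟨y, hy⟩ := hsur
  obtain ⟨φ, ⟨y, hy⟩, hφ0⟩ := exists_functional hy
  have hφu : ∀ v, φ (R.u v) = 0 := fun v => hφ0 _ ⟨v, rfl⟩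
  by_cases hφ : ∀ ψ : R.W →ₗ[K] K, (∀ v, ψ (R.u v) = 0) → ∀ w, ψ (R.b (R.b w)) = 0
  · right; left
    obtain ⟨v, hv, hbv⟩ : ∃ v, v ≠ 0 ∧ R.b (R.b (R.u v)) = 0 := by
      by_cases h : R.b (R.b (R.u v0)) = 0
      · exact ⟨v0, hv0, h⟩
      · have h2 : R.b (R.b (R.u v0)) ∈ LinearMap.range R.u := by
          by_contra h3
          obtain ⟨f, hf, hf0⟩ := Submodule.exists_le_ker_of_notMem h3
          exact hf (hφ f (fun v => hf0 ⟨v, rfl⟩) _)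
        obtain ⟨v', hv'⟩ := h2
        refine ⟨v', ?_, by rw [hv', hb]⟩
        rintro rfl
        exact h (by rw [← hv', map_zero])
    obtain ⟨v1, v2, rfl⟩ := hdec' y
    exact hR.iso_X12 hn φ ⟨v2, by simpa [hφu] using hy⟩ hφu (hφ φ hφu) (by simp [ha]) v hv (ha _)
      hbv
  · right; right; right
    push Not at hφ
    obtain ⟨ψ, hψu, w, hw⟩ := hφ
    have hex : ∃ v v', R.u v ≠ 0 ∧ R.b (R.u v) = R.u v' := by
      by_contra! h
      obtain ⟨F, hF1, hF2, hF3, hF4⟩ := exists_commuting R.b hb (LinearMap.range R.u)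
        (fun x => by
          obtain ⟨v, v', rfl⟩ := hdec' x
          exact ⟨R.u v', ⟨v', rfl⟩, v, by simp⟩) (by
          rintro _ ⟨v, rfl⟩ ⟨v', hv'⟩
          by_contra h0
          exact h v v' h0 hv'.symm)
      have h2 := hF4 (hext F hF1 hF2 hF3)
      obtain ⟨v, v', rfl⟩ := hdec' w
      refine hw ?_
      rw [map_add, map_add, hb, add_zero, h2 _ ⟨v, rfl⟩, map_zero]
    obtain ⟨v, v', hv, hvv⟩ := hex
    exact hR.iso_X23 hn ha hb ψ ⟨w, hw⟩ hψu v v' hv hvv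

end QRep

/-! ### Counting bricks -/

open MulOpposite

/-- Names for the bricks with top at `1` and socle at `2` that are needed, and for the simple
representation at `1`. -/
inductive Shape
  | pt
  | x11
  | x21
  | x12
  | x31
  | x32
  | x13
  | x23

namespace Shape

variable (K : Type) [Field K]

/-- The representation with a given name. -/
def rep : Shape → QRep K
  | pt => QRep.S1 K
  | x11 => QRep.X11 K
  | x21 => QRep.X21 K
  | x12 => QRep.X12 K
  | x31 => QRep.X31 K
  | x32 => QRep.X32 K
  | x13 => QRep.X13 K
  | x23 => QRep.X23 K

/-- The dimensions of the two components of a representation. -/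
def dim : Shape → ℕ × ℕ
  | pt => (1, 0)
  | x11 => (1, 1)
  | x21 => (2, 1)
  | x12 => (1, 2)
  | x31 => (3, 1)
  | x32 => (3, 2)
  | x13 => (1, 3)
  | x23 => (2, 3)

variable {K}

instance (x : Shape) : Module.Finite K (x.rep K).V := by
  cases x <;> exact inferInstanceAs (Module.Finite K (Fin _ → K))

instance (x : Shape) : Module.Finite K (x.rep K).W := by
  cases x <;> exact inferInstanceAs (Module.Finite K (Fin _ → K))

theorem finrank_V (x : Shape) : Module.finrank K (x.rep K).V = x.dim.1 := by
  cases x <;> exact Module.finrank_fin_fun K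

theorem finrank_W (x : Shape) : Module.finrank K (x.rep K).W = x.dim.2 := by
  cases x <;> exact Module.finrank_fin_fun K

theorem n_eq_zero (x : Shape) (w : (x.rep K).W) : (x.rep K).n w = 0 := by
  cases x <;> rfl

theorem u_ne_zero (x : Shape) (hx : x ≠ pt) : ∃ v, (x.rep K).u v ≠ 0 := by
  cases x
  · exact absurd rfl hx
  · exact ⟨![1], fun h => one_ne_zero (congrFun h 0)⟩
  · exact ⟨![0, 1], fun h => one_ne_zero (congrFun h 0)⟩
  · exact ⟨![1], fun h => one_ne_zero (congrFun h 0)⟩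
  · exact ⟨![0, 0, 1], fun h => one_ne_zero (congrFun h 0)⟩
  · exact ⟨![0, 0, 1], fun h => one_ne_zero (congrFun h 1)⟩
  · exact ⟨![1], fun h => one_ne_zero (congrFun h 0)⟩
  · exact ⟨![0, 1], fun h => one_ne_zero (congrFun h 1)⟩

theorem isBrick_rep (x : Shape) : (x.rep K).IsBrick := by
  refine ⟨?_, ?_⟩
  · have : Nontrivial (x.rep K).V := by
      cases x <;> exact inferInstanceAs (Nontrivial (Fin (_ + 1) → K))
    infer_instance
  · cases x
    · exact QRep.isSchur_S1
    · exact QRep.isSchur_X11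
    · exact QRep.isSchur_X21
    · exact QRep.isSchur_X12
    · exact QRep.isSchur_X31
    · exact QRep.isSchur_X32
    · exact QRep.isSchur_X13
    · exact QRep.isSchur_X23

end Shape

namespace QRep

variable {K : Type} [Field K]

theorem Iso.finrank_eq {R S : QRep K} (h : R.Iso S) :
    Module.finrank K R.V = Module.finrank K S.V ∧ Module.finrank K R.W = Module.finrank K S.W := by
  obtain ⟨h, k, h1, h2, h3, h4⟩ := h
  exact ⟨(LinearEquiv.ofLinearMap h.f k.f (LinearMap.ext h3) (LinearMap.ext h1)).finrank_eq,
    (LinearEquiv.ofLinearMap h.g k.g (LinearMap.ext h4) (LinearMap.ext h2)).finrank_eq⟩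

theorem eq_of_iso {x y : Shape} (h : (x.rep K).Iso (y.rep K)) : x = y := by
  have h1 := h.finrank_eq
  simp only [Shape.finrank_V, Shape.finrank_W] at h1
  cases x <;> cases y <;> simp [Shape.dim] at h1 ⊢

theorem not_iso_swap (x y : Shape) : ¬ (x.rep K).Iso (y.rep K).swap := by
  intro h
  by_cases hx : x = .pt
  · subst hx
    have h1 := h.finrank_eq
    have h2 : Module.finrank K (y.rep K).swap.V = y.dim.2 := Shape.finrank_W y
    have h3 : Module.finrank K (y.rep K).swap.W = y.dim.1 := Shape.finrank_V y
    rw [h2, h3, Shape.finrank_V, Shape.finrank_W] at h1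
    cases y <;> simp [Shape.dim] at h1
  · obtain ⟨h, k, h1, h2, h3, h4⟩ := h
    obtain ⟨v, hv⟩ := Shape.u_ne_zero (K := K) x hx
    refine hv ?_
    have h5 : (y.rep K).swap.u (h.f v) = 0 := Shape.n_eq_zero y _
    rw [← h2 ((x.rep K).u v), h.hu, h5, map_zero]

/-- The representations named by shapes, and their images under exchanging the vertices. -/
def repL (K : Type) [Field K] : Bool × Shape → QRep K
  | (false, x) => x.rep K
  | (true, x) => (x.rep K).swap

theorem repL_inj {x y : Bool × Shape} (h : (repL K x).Iso (repL K y)) : x = y := by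
  rcases x with ⟨_ | _, x⟩ <;> rcases y with ⟨_ | _, y⟩
  · rw [eq_of_iso h]
  · exact absurd h (not_iso_swap x y)
  · exact absurd h.symm (not_iso_swap y x)
  · rw [eq_of_iso (Iso.swap h)]

theorem repL_isBrick (x : Bool × Shape) : (repL K x).IsBrick := by
  rcases x with ⟨_ | _, x⟩
  · exact x.isBrick_rep
  · exact x.isBrick_rep.swap

instance (x : Bool × Shape) : Module.Finite K (repL K x).V := by
  rcases x with ⟨_ | _, x⟩
  · exact inferInstanceAs (Module.Finite K (x.rep K).V)
  · exact inferInstanceAs (Module.Finite K (x.rep K).W)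

instance (x : Bool × Shape) : Module.Finite K (repL K x).W := by
  rcases x with ⟨_ | _, x⟩
  · exact inferInstanceAs (Module.Finite K (x.rep K).W)
  · exact inferInstanceAs (Module.Finite K (x.rep K).V)

variable {σ : Type} {s t : σ → Fin 2} {c : σ → Option (Fin 4)}
  {rels : Set (FreeAlgebra K (TPGen σ) × FreeAlgebra K (TPGen σ))}

/-- To count bricks over a bound quiver algebra, list those with top at `1` and socle at `2`, and
those with top at `2` and socle at `1`. -/
theorem brickCount_of' (hc : Compat s t c)
    (hM : ∀ M : RMod (BoundQuiverAlgebra K σ s t rels), TwoPoint.IsBrick K _ M →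
      ∀ x, c x = none → ∀ m : M,
        op (RingQuot.mkAlgHom K (QuivRel K σ s t rels) (arr K x)) • m = 0)
    {P : ∀ {V W : Type} [AddCommGroup V] [AddCommGroup W] [Module K V] [Module K W],
      (V →ₗ[K] V) → (W →ₗ[K] W) → (V →ₗ[K] W) → (W →ₗ[K] V) → Prop}
    (hP : ∀ R : QRep K, R.Sat c rels ↔ P R.a R.b R.u R.n) (lp lm : List Shape)
    (k : ℕ) (hk : ∀ R : QRep K, P R.a R.b R.u R.n → R.NilAt k)
    (hlp : (.pt :: lp).Nodup) (hlm : (.pt :: lm).Nodup)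
    (hSp : ∀ x ∈ Shape.pt :: lp, P (x.rep K).a (x.rep K).b (x.rep K).u (x.rep K).n)
    (hSm : ∀ x ∈ Shape.pt :: lm, P (x.rep K).b (x.rep K).a (x.rep K).n (x.rep K).u)
    (hp : ∀ R : QRep K, P R.a R.b R.u R.n → R.IsBrick → R.Plus → ∃ x ∈ lp, R.Iso (x.rep K))
    (hm : ∀ R : QRep K, P R.b R.a R.n R.u → R.IsBrick → R.Plus → ∃ x ∈ lm, R.Iso (x.rep K)) :
    BrickCount K (BoundQuiverAlgebra K σ s t rels) (lp.length + lm.length + 2) := by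
  obtain ⟨l, hl⟩ : ∃ l, l = (Shape.pt :: lp).map (Prod.mk false) ++
      (Shape.pt :: lm).map (Prod.mk true) := ⟨_, rfl⟩
  have hlen : lp.length + lm.length + 2 = l.length := by
    simp [hl]
    omega
  have hnd : l.Nodup := by
    rw [hl, List.nodup_append]
    refine ⟨hlp.map (Prod.mk_right_injective _), hlm.map (Prod.mk_right_injective _), ?_⟩
    intro x hx y hy
    obtain ⟨_, -, rfl⟩ := List.mem_map.1 hx
    obtain ⟨_, -, rfl⟩ := List.mem_map.1 hy
    simp
  have hmem : ∀ x, x ∈ l ↔ (∃ y ∈ Shape.pt :: lp, (false, y) = x) ∨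
      ∃ y ∈ Shape.pt :: lm, (true, y) = x := fun x => by
    rw [hl, List.mem_append, List.mem_map, List.mem_map]
  have hS : ∀ x ∈ l, (repL K x).Sat c rels := fun x hx => by
    rw [hP]
    rcases (hmem x).1 hx with ⟨y, hy, rfl⟩ | ⟨y, hy, rfl⟩
    · exact hSp y hy
    · exact hSm y hy
  rw [hlen]
  refine ⟨fun i => (hS _ (l.get_mem i)).mod hc, fun i => (hS _ (l.get_mem i)).isBrick_mod hc
    (repL_isBrick _), fun i j ⟨e⟩ => ?_, fun M hM' => ?_⟩
  · have := repL_inj ((hS _ (l.get_mem i)).iso_of_mod hc (hS _ (l.get_mem j)) e)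
    exact List.nodup_iff_injective_get.1 hnd this
  · obtain ⟨R, h, ⟨e⟩⟩ := exists_rep hc M (hM M hM')
    have hR := h.isBrick_of_mod hc (iso_transport hM' e)
    have hPR := (hP R).1 h
    have key : ∃ x ∈ l, R.Iso (repL K x) := by
      rcases hR.trichotomy (hk R hPR) with h | h | h | h
      · exact ⟨(false, .pt), (hmem _).2 (.inl ⟨_, List.mem_cons_self, rfl⟩), h⟩
      · exact ⟨(true, .pt), (hmem _).2 (.inr ⟨_, List.mem_cons_self, rfl⟩), h⟩
      · obtain ⟨x, hx, h⟩ := hp R hPR hR h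
        exact ⟨(false, x), (hmem _).2 (.inl ⟨_, List.mem_cons_of_mem _ hx, rfl⟩), h⟩
      · obtain ⟨x, hx, h⟩ := hm R.swap hPR hR.swap h
        exact ⟨(true, x), (hmem _).2 (.inr ⟨_, List.mem_cons_of_mem _ hx, rfl⟩), h.swap⟩
    obtain ⟨x, hx, h'⟩ := key
    obtain ⟨i, rfl⟩ := List.get_of_mem hx
    obtain ⟨f⟩ := h.mod_iso hc (hS _ hx) h'
    exact ⟨i, ⟨e.trans f⟩⟩

/-- The version of `brickCount_of'` where every arrow of the quiver is one of the four arrows. -/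
theorem brickCount_of (hc : Compat s t c) (hn : ∀ x, c x ≠ none)
    {P : ∀ {V W : Type} [AddCommGroup V] [AddCommGroup W] [Module K V] [Module K W],
      (V →ₗ[K] V) → (W →ₗ[K] W) → (V →ₗ[K] W) → (W →ₗ[K] V) → Prop}
    (hP : ∀ R : QRep K, R.Sat c rels ↔ P R.a R.b R.u R.n) (lp lm : List Shape)
    (k : ℕ) (hk : ∀ R : QRep K, P R.a R.b R.u R.n → R.NilAt k)
    (hlp : (.pt :: lp).Nodup) (hlm : (.pt :: lm).Nodup)
    (hSp : ∀ x ∈ Shape.pt :: lp, P (x.rep K).a (x.rep K).b (x.rep K).u (x.rep K).n)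
    (hSm : ∀ x ∈ Shape.pt :: lm, P (x.rep K).b (x.rep K).a (x.rep K).n (x.rep K).u)
    (hp : ∀ R : QRep K, P R.a R.b R.u R.n → R.IsBrick → R.Plus → ∃ x ∈ lp, R.Iso (x.rep K))
    (hm : ∀ R : QRep K, P R.b R.a R.n R.u → R.IsBrick → R.Plus → ∃ x ∈ lm, R.Iso (x.rep K)) :
    BrickCount K (BoundQuiverAlgebra K σ s t rels) (lp.length + lm.length + 2) :=
  brickCount_of' hc (fun _ _ x hx => absurd hx (hn x)) hP lp lm k hk hlp hlm hSp hSm hp hm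

end QRep

/-! ### Tools for the individual algebras -/

namespace QRep

variable {K : Type} [Field K] {R : QRep K}

theorem IsBrick.shapes_D (hR : R.IsBrick) (hP : R.Plus) (hn : ∀ w, R.n w = 0)
    (ha : ∀ v, R.a (R.a v) = 0) (hb : ∀ w, R.b (R.b w) = 0) (hbua : ∀ v, R.b (R.u (R.a v)) = 0) :
    ∃ x ∈ [Shape.x11, .x21, .x12], R.Iso (x.rep K) := by
  rcases hR.core_D hP hn ha hb hbua with h | h | h
  · exact ⟨.x11, by simp, h⟩
  · exact ⟨.x21, by simp, h⟩
  · exact ⟨.x12, by simp, h⟩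

theorem IsBrick.shapes_C (hR : R.IsBrick) (hP : R.Plus) (hn : ∀ w, R.n w = 0)
    (hb : ∀ w, R.b w = 0) (ha : ∀ v, R.a (R.a (R.a v)) = 0) :
    ∃ x ∈ [Shape.x11, .x21, .x31, .x32], R.Iso (x.rep K) := by
  rcases hR.core_C hP hn hb ha with h | h | h | h
  · exact ⟨.x11, by simp, h⟩
  · exact ⟨.x21, by simp, h⟩
  · exact ⟨.x31, by simp, h⟩
  · exact ⟨.x32, by simp, h⟩

theorem IsBrick.shapes_C' (hR : R.IsBrick) (hP : R.Plus) (hn : ∀ w, R.n w = 0)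
    (ha : ∀ v, R.a v = 0) (hb : ∀ w, R.b (R.b (R.b w)) = 0) :
    ∃ x ∈ [Shape.x11, .x12, .x13, .x23], R.Iso (x.rep K) := by
  rcases hR.core_C' hP hn ha hb with h | h | h | h
  · exact ⟨.x11, by simp, h⟩
  · exact ⟨.x12, by simp, h⟩
  · exact ⟨.x13, by simp, h⟩
  · exact ⟨.x23, by simp, h⟩

theorem IsBrick.shapes_a (hR : R.IsBrick) (hP : R.Plus) (hn : ∀ w, R.n w = 0)
    (hb : ∀ w, R.b w = 0) (ha : ∀ v, R.a (R.a v) = 0) :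
    ∃ x ∈ [Shape.x11, .x21], R.Iso (x.rep K) := by
  rcases hR.core_D hP hn ha (by simp [hb]) (by simp [hb]) with h | h | h
  · exact ⟨.x11, by simp, h⟩
  · exact ⟨.x21, by simp, h⟩
  · obtain ⟨w, hw⟩ := h.exists_b_ne
    exact absurd (hb w) hw

theorem IsBrick.shapes_b (hR : R.IsBrick) (hP : R.Plus) (hn : ∀ w, R.n w = 0)
    (ha : ∀ v, R.a v = 0) (hb : ∀ w, R.b (R.b w) = 0) :
    ∃ x ∈ [Shape.x11, .x12], R.Iso (x.rep K) := by
  rcases hR.core_D hP hn (by simp [ha]) hb (by simp [ha]) with h | h | h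
  · exact ⟨.x11, by simp, h⟩
  · obtain ⟨v, hv⟩ := h.exists_a_ne
    exact absurd (ha v) hv
  · exact ⟨.x12, by simp, h⟩

theorem IsBrick.shapes (hR : R.IsBrick) (hP : R.Plus) (hn : ∀ w, R.n w = 0)
    (ha : ∀ v, R.a v = 0) (hb : ∀ w, R.b w = 0) : ∃ x ∈ [Shape.x11], R.Iso (x.rep K) := by
  obtain ⟨x, hx, h⟩ := hR.shapes_a hP hn hb (by simp [ha])
  simp only [List.mem_cons, List.not_mem_nil, or_false] at hx
  rcases hx with rfl | rfl
  · exact ⟨.x11, by simp, h⟩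
  · obtain ⟨v, hv⟩ := Iso.exists_a_ne h
    exact absurd (ha v) hv

theorem mem_kill_succ_fst (k : ℕ) (v : R.V) :
    v ∈ (R.kill (k + 1)).1 ↔ R.a v ∈ (R.kill k).1 ∧ R.u v ∈ (R.kill k).2 := Iff.rfl

theorem mem_kill_succ_snd (k : ℕ) (w : R.W) :
    w ∈ (R.kill (k + 1)).2 ↔ R.b w ∈ (R.kill k).2 ∧ R.n w ∈ (R.kill k).1 := Iff.rfl

/-- If `u ∘ a ^ j` vanishes then so does `a ^ j`, provided that `a` is nilpotent. -/
theorem Soc.iterate_eq_zero (h : R.Soc) (j k : ℕ) (hu : ∀ v, R.u (R.a^[j] v) = 0)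
    (hk : ∀ v, R.a^[k] v = 0) : ∀ v, R.a^[j] v = 0 := by
  have key : ∀ i, (∀ v, R.a^[j + i] v = 0) → ∀ v, R.a^[j] v = 0 := fun i => by
    induction i with
    | zero => exact id
    | succ i ih =>
      refine fun hi => ih fun v => h _ ?_ ?_
      · rw [← Function.iterate_succ_apply' R.a]
        exact hi v
      · rw [Function.iterate_add_apply]
        exact hu _
  refine key k fun v => ?_
  rw [Nat.add_comm, Function.iterate_add_apply]
  exact hk _

/-- If `b ^ j ∘ u` vanishes then so does `b ^ j`, provided that `b` is nilpotent. -/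
theorem Top.iterate_eq_zero (h : R.Top) (j k : ℕ) (hu : ∀ v, R.b^[j] (R.u v) = 0)
    (hk : ∀ w, R.b^[k] w = 0) : ∀ w, R.b^[j] w = 0 := by
  have key : ∀ i, (∀ w, R.b^[j + i] w = 0) → ∀ w, R.b^[j] w = 0 := fun i => by
    induction i with
    | zero => exact id
    | succ i ih =>
      refine fun hi => ih fun w => ?_
      have := h.map (R.b ^ (j + i)) (fun w => ?_) (fun v => ?_) w
      · simpa [Module.End.pow_apply] using this
      · rw [Module.End.pow_apply]
        exact hi w
      · rw [Module.End.pow_apply, Nat.add_comm, Function.iterate_add_apply, hu]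
        simp
  refine key k fun w => ?_
  rw [Function.iterate_add_apply, hk]
  simp

theorem Soc.a_eq_zero (h : R.Soc) (k : ℕ) (hu : ∀ v, R.u (R.a v) = 0) (hk : ∀ v, R.a^[k] v = 0) :
    ∀ v, R.a v = 0 := h.iterate_eq_zero 1 k hu hk

theorem Top.b_eq_zero (h : R.Top) (k : ℕ) (hu : ∀ v, R.b (R.u v) = 0) (hk : ∀ w, R.b^[k] w = 0) :
    ∀ w, R.b w = 0 := h.iterate_eq_zero 1 k hu hk

/-- In a brick with top at `1` and socle at `2`, the arrow `u` does not vanish. -/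
theorem IsBrick.false_of_u (hR : R.IsBrick) (hP : R.Plus) (hu : ∀ v, R.u v = 0) (k : ℕ)
    (ha : ∀ v, R.a^[k] v = 0) (hb : ∀ w, R.b^[k] w = 0) : False := by
  have := hR.1
  obtain ⟨x, hx⟩ := exists_ne (0 : R.V × R.W)
  exact hx (Prod.ext (hP.1.iterate_eq_zero 0 k (fun _ => hu _) ha x.1)
    (hP.2.iterate_eq_zero 0 k (fun _ => hu _) hb x.2))

/-- If `a + b` is a nilpotent endomorphism of a brick then it vanishes. -/
theorem IsBrick.loops_eq_zero (hR : R.IsBrick) (k : ℕ) (ha : ∀ v, R.a^[k] v = 0)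
    (hb : ∀ w, R.b^[k] w = 0) (hu : ∀ v, R.u (R.a v) = R.b (R.u v))
    (hn : ∀ w, R.n (R.b w) = R.a (R.n w)) : (∀ v, R.a v = 0) ∧ ∀ w, R.b w = 0 :=
  hR.endo_eq_zero ⟨R.a, R.b, fun _ => rfl, fun _ => rfl, fun v => (hu v).symm,
    fun w => (hn w).symm⟩ k ha hb

/-- If `un + nu` is an endomorphism of a brick with square zero then it vanishes. -/
theorem IsBrick.cycles_eq_zero (hR : R.IsBrick) (ha : ∀ v, R.n (R.u (R.a v)) = R.a (R.n (R.u v)))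
    (hb : ∀ w, R.u (R.n (R.b w)) = R.b (R.u (R.n w)))
    (hV : ∀ v, R.n (R.u (R.n (R.u v))) = 0) (hW : ∀ w, R.u (R.n (R.u (R.n w))) = 0) :
    (∀ v, R.n (R.u v) = 0) ∧ ∀ w, R.u (R.n w) = 0 :=
  hR.endo_eq_zero ⟨R.n ∘ₗ R.u, R.u ∘ₗ R.n, ha, hb, fun _ => rfl, fun _ => rfl⟩ 2 hV hW

end QRep

namespace Shape

variable {K : Type} [Field K]

theorem pt_a (v : (pt.rep K).V) : (pt.rep K).a v = 0 := rfl
theorem pt_b (w : (pt.rep K).W) : (pt.rep K).b w = 0 := rfl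
theorem pt_u (v : (pt.rep K).V) : (pt.rep K).u v = 0 := rfl
theorem x11_a (v : (x11.rep K).V) : (x11.rep K).a v = 0 := rfl
theorem x11_b (w : (x11.rep K).W) : (x11.rep K).b w = 0 := rfl
theorem x21_b (w : (x21.rep K).W) : (x21.rep K).b w = 0 := rfl
theorem x31_b (w : (x31.rep K).W) : (x31.rep K).b w = 0 := rfl
theorem x32_b (w : (x32.rep K).W) : (x32.rep K).b w = 0 := rfl
theorem x12_a (v : (x12.rep K).V) : (x12.rep K).a v = 0 := rfl
theorem x13_a (v : (x13.rep K).V) : (x13.rep K).a v = 0 := rfl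
theorem x23_a (v : (x23.rep K).V) : (x23.rep K).a v = 0 := rfl

theorem x21_aa (v : (x21.rep K).V) : (x21.rep K).a ((x21.rep K).a v) = 0 := by
  funext i
  fin_cases i <;> rfl

theorem x31_aaa (v : (x31.rep K).V) :
    (x31.rep K).a ((x31.rep K).a ((x31.rep K).a v)) = 0 := by
  funext i
  fin_cases i <;> rfl

theorem x32_aaa (v : (x32.rep K).V) :
    (x32.rep K).a ((x32.rep K).a ((x32.rep K).a v)) = 0 := by
  funext i
  fin_cases i <;> rfl

theorem x12_bb (w : (x12.rep K).W) : (x12.rep K).b ((x12.rep K).b w) = 0 := by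
  funext i
  fin_cases i <;> rfl

theorem x13_bbb (w : (x13.rep K).W) :
    (x13.rep K).b ((x13.rep K).b ((x13.rep K).b w)) = 0 := by
  funext i
  fin_cases i <;> rfl

theorem x23_bbb (w : (x23.rep K).W) :
    (x23.rep K).b ((x23.rep K).b ((x23.rep K).b w)) = 0 := by
  funext i
  fin_cases i <;> rfl

attribute [simp] n_eq_zero pt_a pt_b pt_u x11_a x11_b x21_b x31_b x32_b x12_a x13_a x23_a
  x21_aa x31_aaa x32_aaa x12_bb x13_bbb x23_bbb

end Shape

/-- How the arrows of the quiver `QB` act. -/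
abbrev QB.c : Fin 3 → Option (Fin 4) := ![some 0, some 2, some 1]

/-- How the arrows of the quiver `QD` act. -/
abbrev QD.c : Fin 3 → Option (Fin 4) := ![some 0, some 2, some 3]

/-- How the arrows of the quiver `QE` act. -/
abbrev QE.c : Fin 4 → Option (Fin 4) := ![some 0, some 1, some 2, some 3]

/-- How the arrows of the quiver `QI` act. -/
abbrev QI.c : Fin 2 → Option (Fin 4) := ![some 0, some 2]

/-- How the arrows of the quiver `QJ` act. -/
abbrev QJ.c : Fin 3 → Option (Fin 4) := ![none, none, some 2]

theorem QB.compat : QRep.Compat QB.s QB.t QB.c := ⟨by decide, by decide, by decide⟩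
theorem QD.compat : QRep.Compat QD.s QD.t QD.c := ⟨by decide, by decide, by decide⟩
theorem QE.compat : QRep.Compat QE.s QE.t QE.c := ⟨by decide, by decide, by decide⟩
theorem QI.compat : QRep.Compat QI.s QI.t QI.c := ⟨by decide, by decide, by decide⟩
theorem QJ.compat : QRep.Compat QJ.s QJ.t QJ.c := ⟨by decide, by decide, by decide⟩

/-! ### The algebra with two loops at one vertex -/

open MulOpposite

namespace QRep

variable {K : Type} [Field K]

/-- An element commuting with the generators of a quotient of a free algebra is central. -/
theorem mul_comm_of_generators {X : Type} {r : FreeAlgebra K X → FreeAlgebra K X → Prop}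
    {z : RingQuot r} (hz : ∀ x, z * RingQuot.mkAlgHom K r (FreeAlgebra.ι K x) =
      RingQuot.mkAlgHom K r (FreeAlgebra.ι K x) * z) (y : RingQuot r) : z * y = y * z := by
  obtain ⟨y, rfl⟩ := RingQuot.mkAlgHom_surjective K r y
  induction y using FreeAlgebra.induction with
  | grade0 k => rw [AlgHom.commutes, Algebra.commutes]
  | grade1 x => exact hz x
  | mul x y hx hy => rw [map_mul, ← mul_assoc, hx, mul_assoc, hy, mul_assoc]
  | add x y hx hy => rw [map_add, mul_add, add_mul, hx, hy]

/-- A loop at `1` all of whose products with arrows vanish acts as zero on every brick. -/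
theorem loop_smul_eq_zero {σ : Type} {s t : σ → Fin 2}
    {rels : Set (FreeAlgebra K (TPGen σ) × FreeAlgebra K (TPGen σ))} {x : σ} (hs : s x = 0)
    (ht : t x = 0) (hl : ∀ y, (arr K x * arr K y, 0) ∈ rels)
    (hr : ∀ y, t y = 0 → (arr K y * arr K x, 0) ∈ rels)
    {M : RMod (BoundQuiverAlgebra K σ s t rels)} (hM : TwoPoint.IsBrick K _ M) (m : M) :
    op (RingQuot.mkAlgHom K (QuivRel K σ s t rels) (arr K x)) • m = 0 := by
  have hrel {p q} (h : QuivRel K σ s t rels p q) := RingQuot.mkAlgHom_rel K h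
  set π := RingQuot.mkAlgHom K (QuivRel K σ s t rels)
  have hsrc : π (vtx K 0) * π (arr K x) = π (arr K x) := by
    rw [← map_mul, ← hs, hrel (.src x)]
  have htgt : π (arr K x) * π (vtx K 0) = π (arr K x) := by
    rw [← map_mul, ← ht, hrel (.tgt x)]
  have h01 : π (vtx K 0) * π (vtx K 1) = 0 := by
    rw [← map_mul, hrel (.orth 0 1 (by decide)), map_zero]
  have h10 : π (vtx K 1) * π (vtx K 0) = 0 := by
    rw [← map_mul, hrel (.orth 1 0 (by decide)), map_zero]
  have hl' : ∀ y, π (arr K x) * π (arr K y) = 0 := fun y => by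
    rw [← map_mul, hrel (.rel _ (hl y)), map_zero]
  have hr' : ∀ y, π (arr K y) * π (arr K x) = 0 := fun y => by
    rcases (by omega : t y = 0 ∨ t y = 1) with h | h
    · rw [← map_mul, hrel (.rel _ (hr y h)), map_zero]
    · rw [← hrel (.tgt y), h, map_mul, ← hsrc, mul_assoc, ← mul_assoc _ (π (vtx K 0)), h10,
        zero_mul, mul_zero]
  refine central_smul_eq_zero hM _ (mul_comm_of_generators ?_) (by rw [pow_two, hl' x]) m
  rintro (i | y)
  · change π (arr K x) * π (vtx K i) = π (vtx K i) * π (arr K x)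
    fin_cases i
    · exact htgt.trans hsrc.symm
    · change π (arr K x) * π (vtx K 1) = π (vtx K 1) * π (arr K x)
      rw [← htgt, mul_assoc, h01, mul_zero, htgt, ← hsrc, ← mul_assoc, h10, zero_mul]
  · exact (hl' y).trans (hr' y).symm

theorem brickCount_W4 : BrickCount K (TabW4 K) 3 := by
  refine brickCount_of' QJ.compat (fun M hM x hx m => ?_) (P := fun a b u n =>
      (∀ v, a v = 0) ∧ (∀ w, b w = 0) ∧ (∀ w, n w = 0))
    (fun R => by simp [Sat, QJ.a1, QJ.a2, QJ.mu, pow_succ, Fin.forall_fin_succ,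
      LinearMap.ext_iff])
    [.x11] [] 2 ?_ (by simp) (by simp) ?_ ?_ ?_ ?_
  · fin_cases x
    · refine loop_smul_eq_zero (x := 0) rfl rfl ?_ ?_ hM m <;>
        simp [Fin.forall_fin_succ, QJ.a1, QJ.a2, QJ.mu, QJ.t, pow_two]
    · refine loop_smul_eq_zero (x := 1) rfl rfl ?_ ?_ hM m <;>
        simp [Fin.forall_fin_succ, QJ.a1, QJ.a2, QJ.mu, QJ.t, pow_two]
    · simp at hx
  · rintro R ⟨ha, hb, hn⟩
    simp [NilAt, mem_kill_succ_fst, mem_kill_succ_snd, ha, hb, hn]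
  · simp
  · simp
  · rintro R ⟨ha, hb, hn⟩ hR hP
    exact hR.shapes hP hn ha hb
  · rintro R ⟨hb, ha, hu⟩ hR hP
    exact (hR.false_of_u hP hu 1 ha hb).elim

end QRep

/-! ### The algebras of Table W -/

open MulOpposite

namespace QRep

variable {K : Type} [Field K]

theorem brickCount_W6 : BrickCount K (TabW6 K) 4 := by
  refine brickCount_of QI.compat (by decide) (P := fun a b u n =>
      (∀ v, a (a (a (a (a (a (a v)))))) = 0) ∧ (∀ v, u (a (a v)) = 0) ∧ (∀ w, b w = 0) ∧
      (∀ w, n w = 0))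
    (fun R => by simp [Sat, QI.al, QI.mu, pow_succ, ← op_mul, Fin.forall_fin_succ,
      LinearMap.ext_iff, and_assoc])
    [.x11, .x21] [] 7 ?_ (by simp) (by simp) ?_ ?_ ?_ ?_
  · rintro R ⟨haaaaaaa, haau, hb, hn⟩
    simp [NilAt, mem_kill_succ_fst, mem_kill_succ_snd, haaaaaaa, haau, hb, hn]
  · simp
  · simp
  · rintro R ⟨haaaaaaa, haau, hb, hn⟩ hR hP
    have haa := hP.1.iterate_eq_zero 2 7 haau haaaaaaa
    exact hR.shapes_a hP hn hb haa
  · rintro R ⟨hbbbbbbb, hbbn, ha, hu⟩ hR hP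
    exact (hR.false_of_u hP hu 7 (by simp [show R.a = 0 from LinearMap.ext ha]) hbbbbbbb).elim

theorem brickCount_W7 : BrickCount K (TabW7 K) 6 := by
  refine brickCount_of QI.compat (by decide) (P := fun a b u n =>
      (∀ v, a (a (a (a v))) = 0) ∧ (∀ v, u (a (a (a v))) = 0) ∧ (∀ w, b w = 0) ∧ (∀ w, n w = 0))
    (fun R => by simp [Sat, QI.al, QI.mu, pow_succ, ← op_mul, Fin.forall_fin_succ,
      LinearMap.ext_iff, and_assoc])
    [.x11, .x21, .x31, .x32] [] 4 ?_ (by simp) (by simp) ?_ ?_ ?_ ?_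
  · rintro R ⟨haaaa, haaau, hb, hn⟩
    simp [NilAt, mem_kill_succ_fst, mem_kill_succ_snd, haaaa, haaau, hb, hn]
  · simp
  · simp
  · rintro R ⟨haaaa, haaau, hb, hn⟩ hR hP
    have haaa := hP.1.iterate_eq_zero 3 4 haaau haaaa
    exact hR.shapes_C hP hn hb haaa
  · rintro R ⟨hbbbb, hbbbn, ha, hu⟩ hR hP
    exact (hR.false_of_u hP hu 4 (by simp [show R.a = 0 from LinearMap.ext ha]) hbbbb).elim

theorem brickCount_W8 : BrickCount K (TabW8 K) 6 := by
  refine brickCount_of QB.compat (by decide) (P := fun a b u n =>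
      (∀ v, a (a v) = 0) ∧ (∀ w, b (b (b w)) = 0) ∧ (∀ v, u (a v) = 0) ∧ (∀ w, n w = 0))
    (fun R => by simp [Sat, QB.al, QB.mu, QB.be, pow_succ, ← op_mul, Fin.forall_fin_succ,
      LinearMap.ext_iff, and_assoc])
    [.x11, .x12, .x13, .x23] [] 4 ?_ (by simp) (by simp) ?_ ?_ ?_ ?_
  · rintro R ⟨haa, hbbb, hau, hn⟩
    simp [NilAt, mem_kill_succ_fst, mem_kill_succ_snd, haa, hbbb, hau, hn]
  · simp
  · simp
  · rintro R ⟨haa, hbbb, hau, hn⟩ hR hP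
    have ha := hP.1.a_eq_zero 2 hau haa
    exact hR.shapes_C' hP hn ha hbbb
  · rintro R ⟨hbb, haaa, hbn, hu⟩ hR hP
    exact (hR.false_of_u hP hu 3 haaa fun w => hbb (R.b w)).elim

theorem brickCount_W9 : BrickCount K (TabW9 K) 4 := by
  refine brickCount_of QB.compat (by decide) (P := fun a b u n =>
      (∀ v, a (a (a v)) = 0) ∧ (∀ w, b (b (b w)) = 0) ∧ (∀ v, u (a v) = 0) ∧
      (∀ v, b (b (u v)) = 0) ∧ (∀ w, n w = 0))
    (fun R => by simp [Sat, QB.al, QB.mu, QB.be, pow_succ, ← op_mul, Fin.forall_fin_succ,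
      LinearMap.ext_iff, and_assoc])
    [.x11, .x12] [] 3 ?_ (by simp) (by simp) ?_ ?_ ?_ ?_
  · rintro R ⟨haaa, hbbb, hau, hubb, hn⟩
    simp [NilAt, mem_kill_succ_fst, mem_kill_succ_snd, haaa, hbbb, hau, hubb, hn]
  · simp
  · simp
  · rintro R ⟨haaa, hbbb, hau, hubb, hn⟩ hR hP
    have ha := hP.1.a_eq_zero 3 hau haaa
    have hbb := hP.2.iterate_eq_zero 2 3 hubb hbbb
    exact hR.shapes_b hP hn ha hbb
  · rintro R ⟨hbbb, haaa, hbn, hnaa, hu⟩ hR hP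
    exact (hR.false_of_u hP hu 3 haaa hbbb).elim

theorem brickCount_W10 : BrickCount K (TabW10 K) 4 := by
  refine brickCount_of QB.compat (by decide) (P := fun a b u n =>
      (∀ v, a (a v) = 0) ∧ (∀ w, b (b (b (b w))) = 0) ∧ (∀ v, u (a v) = 0) ∧
      (∀ v, b (b (u v)) = 0) ∧ (∀ w, n w = 0))
    (fun R => by simp [Sat, QB.al, QB.mu, QB.be, pow_succ, ← op_mul, Fin.forall_fin_succ,
      LinearMap.ext_iff, and_assoc])
    [.x11, .x12] [] 4 ?_ (by simp) (by simp) ?_ ?_ ?_ ?_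
  · rintro R ⟨haa, hbbbb, hau, hubb, hn⟩
    simp [NilAt, mem_kill_succ_fst, mem_kill_succ_snd, haa, hbbbb, hau, hubb, hn]
  · simp
  · simp
  · rintro R ⟨haa, hbbbb, hau, hubb, hn⟩ hR hP
    have ha := hP.1.a_eq_zero 2 hau haa
    have hbb := hP.2.iterate_eq_zero 2 4 hubb hbbbb
    exact hR.shapes_b hP hn ha hbb
  · rintro R ⟨hbb, haaaa, hbn, hnaa, hu⟩ hR hP
    exact (hR.false_of_u hP hu 4 haaaa fun w => hbb (R.b (R.b w))).elim

theorem brickCount_W11 : BrickCount K (TabW11 K) 5 := by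
  refine brickCount_of QB.compat (by decide) (P := fun a b u n =>
      (∀ v, a (a v) = 0) ∧ (∀ w, b (b (b w)) = 0) ∧ (∀ v, b (u (a v)) = 0) ∧
      (∀ v, b (b (u v)) = 0) ∧ (∀ w, n w = 0))
    (fun R => by simp [Sat, QB.al, QB.mu, QB.be, pow_succ, ← op_mul, Fin.forall_fin_succ,
      LinearMap.ext_iff, and_assoc])
    [.x11, .x21, .x12] [] 3 ?_ (by simp) (by simp) ?_ ?_ ?_ ?_
  · rintro R ⟨haa, hbbb, haub, hubb, hn⟩
    simp [NilAt, mem_kill_succ_fst, mem_kill_succ_snd, haa, hbbb, haub, hubb, hn]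
  · simp
  · simp
  · rintro R ⟨haa, hbbb, haub, hubb, hn⟩ hR hP
    have hbb := hP.2.iterate_eq_zero 2 3 hubb hbbb
    exact hR.shapes_D hP hn haa hbb haub
  · rintro R ⟨hbb, haaa, hbna, hnaa, hu⟩ hR hP
    exact (hR.false_of_u hP hu 3 haaa fun w => hbb (R.b w)).elim

theorem brickCount_W12 : BrickCount K (TabW12 K) 3 := by
  refine brickCount_of QB.compat (by decide) (P := fun a b u n =>
      (∀ v, a (a (a (a v))) = 0) ∧ (∀ w, b (b (b (b (b w)))) = 0) ∧ (∀ v, b (b (u v)) = 0) ∧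
      (∀ v, u (a v) = b (u v)) ∧ (∀ w, n w = 0))
    (fun R => by simp [Sat, QB.al, QB.mu, QB.be, pow_succ, ← op_mul, Fin.forall_fin_succ,
      LinearMap.ext_iff, and_assoc])
    [.x11] [] 5 ?_ (by simp) (by simp) ?_ ?_ ?_ ?_
  · rintro R ⟨haaaa, hbbbbb, hubb, hau, hn⟩
    simp [NilAt, mem_kill_succ_fst, mem_kill_succ_snd, haaaa, hbbbbb, hubb, hau, hn]
  · simp
  · simp
  · rintro R ⟨haaaa, hbbbbb, hubb, hau, hn⟩ hR hP
    obtain ⟨ha, hb⟩ := hR.loops_eq_zero 5 (fun v => haaaa (R.a v)) hbbbbb hau (by simp [hn])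
    exact hR.shapes hP hn ha hb
  · rintro R ⟨hbbbb, haaaaa, hnaa, hbn, hu⟩ hR hP
    exact (hR.false_of_u hP hu 5 haaaaa fun w => hbbbb (R.b w)).elim

theorem brickCount_W13 : BrickCount K (TabW13 K) 3 := by
  refine brickCount_of QB.compat (by decide) (P := fun a b u n =>
      (∀ v, a (a (a v)) = 0) ∧ (∀ w, b (b (b (b (b (b (b w)))))) = 0) ∧ (∀ v, b (b (u v)) = 0) ∧
      (∀ v, u (a v) = b (u v)) ∧ (∀ w, n w = 0))
    (fun R => by simp [Sat, QB.al, QB.mu, QB.be, pow_succ, ← op_mul, Fin.forall_fin_succ,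
      LinearMap.ext_iff, and_assoc])
    [.x11] [] 7 ?_ (by simp) (by simp) ?_ ?_ ?_ ?_
  · rintro R ⟨haaa, hbbbbbbb, hubb, hau, hn⟩
    simp [NilAt, mem_kill_succ_fst, mem_kill_succ_snd, haaa, hbbbbbbb, hubb, hau, hn]
  · simp
  · simp
  · rintro R ⟨haaa, hbbbbbbb, hubb, hau, hn⟩ hR hP
    obtain ⟨ha, hb⟩ := hR.loops_eq_zero 7 (fun v => haaa (R.a^[4] v)) hbbbbbbb hau (by simp [hn])
    exact hR.shapes hP hn ha hb
  · rintro R ⟨hbbb, haaaaaaa, hnaa, hbn, hu⟩ hR hP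
    exact (hR.false_of_u hP hu 7 haaaaaaa fun w => hbbb (R.b^[4] w)).elim

theorem brickCount_W14 : BrickCount K (TabW14 K) 8 := by
  refine brickCount_of QD.compat (by decide) (P := fun a b u n =>
      (∀ v, a (a (a v)) = 0) ∧ (∀ v, n (u v) = 0) ∧ (∀ w, u (n w) = 0) ∧ (∀ v, u (a (a v)) = 0) ∧
      (∀ w, b w = 0))
    (fun R => by simp [Sat, QD.al, QD.mu, QD.nu, pow_succ, ← op_mul, Fin.forall_fin_succ,
      LinearMap.ext_iff, and_assoc])
    [.x11, .x21] [.x11, .x12, .x13, .x23] 4 ?_ (by simp) (by simp) ?_ ?_ ?_ ?_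
  · rintro R ⟨haaa, hun, hnu, haau, hb⟩
    simp [NilAt, mem_kill_succ_fst, mem_kill_succ_snd, haaa, hun, hnu, haau, hb]
  · simp
  · simp
  · rintro R ⟨haaa, hun, hnu, haau, hb⟩ hR hP
    have hn := hP.2.map R.n (by simp [hb]) hun
    have haa := hP.1.iterate_eq_zero 2 3 haau haaa
    exact hR.shapes_a hP hn hb haa
  · rintro R ⟨hbbb, hnu, hun, hbbn, ha⟩ hR hP
    have hn : ∀ w, R.n w = 0 := fun w => hP.1 _ (ha _) (hnu w)
    exact hR.shapes_C' hP hn ha hbbb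

theorem brickCount_W15 : BrickCount K (TabW15 K) 7 := by
  refine brickCount_of QD.compat (by decide) (P := fun a b u n =>
      (∀ v, a (a (a v)) = 0) ∧ (∀ v, n (u v) = 0) ∧ (∀ v, u (a v) = 0) ∧ (∀ w, b w = 0))
    (fun R => by simp [Sat, QD.al, QD.mu, QD.nu, pow_succ, ← op_mul, Fin.forall_fin_succ,
      LinearMap.ext_iff, and_assoc])
    [.x11] [.x11, .x12, .x13, .x23] 4 ?_ (by simp) (by simp) ?_ ?_ ?_ ?_
  · rintro R ⟨haaa, hun, hau, hb⟩
    simp [NilAt, mem_kill_succ_fst, mem_kill_succ_snd, haaa, hun, hau, hb]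
  · simp
  · simp
  · rintro R ⟨haaa, hun, hau, hb⟩ hR hP
    have hn := hP.2.map R.n (by simp [hb]) hun
    have ha := hP.1.a_eq_zero 3 hau haaa
    exact hR.shapes hP hn ha hb
  · rintro R ⟨hbbb, hnu, hbn, ha⟩ hR hP
    have hn : ∀ w, R.n w = 0 := fun w => hP.1 _ (ha _) (hnu w)
    exact hR.shapes_C' hP hn ha hbbb

theorem brickCount_W16 : BrickCount K (TabW16 K) 6 := by
  refine brickCount_of QD.compat (by decide) (P := fun a b u n =>
      (∀ v, a (a (a v)) = 0) ∧ (∀ v, n (u v) = 0) ∧ (∀ w, u (a (n w)) = 0) ∧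
      (∀ w, a (a (n w)) = 0) ∧ (∀ v, u (a (a v)) = 0) ∧ (∀ w, b w = 0))
    (fun R => by simp [Sat, QD.al, QD.mu, QD.nu, pow_succ, ← op_mul, Fin.forall_fin_succ,
      LinearMap.ext_iff, and_assoc])
    [.x11, .x21] [.x11, .x12] 3 ?_ (by simp) (by simp) ?_ ?_ ?_ ?_
  · rintro R ⟨haaa, hun, hnau, hnaa, haau, hb⟩
    simp [NilAt, mem_kill_succ_fst, mem_kill_succ_snd, haaa, hun, hnau, hnaa, haau, hb]
  · simp
  · simp
  · rintro R ⟨haaa, hun, hnau, hnaa, haau, hb⟩ hR hP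
    have hn := hP.2.map R.n (by simp [hb]) hun
    have haa := hP.1.iterate_eq_zero 2 3 haau haaa
    exact hR.shapes_a hP hn hb haa
  · rintro R ⟨hbbb, hnu, hubn, hubb, hbbn, ha⟩ hR hP
    have hn : ∀ w, R.n w = 0 := fun w => hP.1 _ (ha _) (hnu w)
    have hbb := hP.2.iterate_eq_zero 2 3 hubb hbbb
    exact hR.shapes_b hP hn ha hbb

theorem brickCount_W17 : BrickCount K (TabW17 K) 7 := by
  refine brickCount_of QD.compat (by decide) (P := fun a b u n =>
      (∀ v, a (a (a (a v))) = 0) ∧ (∀ v, n (u v) = 0) ∧ (∀ w, u (n w) = 0) ∧ (∀ v, u (a v) = 0) ∧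
      (∀ w, a (a (a (n w))) = 0) ∧ (∀ w, b w = 0))
    (fun R => by simp [Sat, QD.al, QD.mu, QD.nu, pow_succ, ← op_mul, Fin.forall_fin_succ,
      LinearMap.ext_iff, and_assoc])
    [.x11] [.x11, .x12, .x13, .x23] 4 ?_ (by simp) (by simp) ?_ ?_ ?_ ?_
  · rintro R ⟨haaaa, hun, hnu, hau, hnaaa, hb⟩
    simp [NilAt, mem_kill_succ_fst, mem_kill_succ_snd, haaaa, hun, hnu, hau, hnaaa, hb]
  · simp
  · simp
  · rintro R ⟨haaaa, hun, hnu, hau, hnaaa, hb⟩ hR hP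
    have hn := hP.2.map R.n (by simp [hb]) hun
    have ha := hP.1.a_eq_zero 4 hau haaaa
    exact hR.shapes hP hn ha hb
  · rintro R ⟨hbbbb, hnu, hun, hbn, hubbb, ha⟩ hR hP
    have hn : ∀ w, R.n w = 0 := fun w => hP.1 _ (ha _) (hnu w)
    have hbbb := hP.2.iterate_eq_zero 3 4 hubbb hbbbb
    exact hR.shapes_C' hP hn ha hbbb

theorem brickCount_W18 : BrickCount K (TabW18 K) 6 := by
  refine brickCount_of QD.compat (by decide) (P := fun a b u n =>
      (∀ v, a (a (a (a v))) = 0) ∧ (∀ v, n (u v) = 0) ∧ (∀ w, u (n w) = 0) ∧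
      (∀ w, u (a (n w)) = 0) ∧ (∀ w, a (a (n w)) = 0) ∧ (∀ v, u (a (a v)) = 0) ∧ (∀ w, b w = 0))
    (fun R => by simp [Sat, QD.al, QD.mu, QD.nu, pow_succ, ← op_mul, Fin.forall_fin_succ,
      LinearMap.ext_iff, and_assoc])
    [.x11, .x21] [.x11, .x12] 4 ?_ (by simp) (by simp) ?_ ?_ ?_ ?_
  · rintro R ⟨haaaa, hun, hnu, hnau, hnaa, haau, hb⟩
    simp [NilAt, mem_kill_succ_fst, mem_kill_succ_snd, haaaa, hun, hnu, hnau, hnaa, haau, hb]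
  · simp
  · simp
  · rintro R ⟨haaaa, hun, hnu, hnau, hnaa, haau, hb⟩ hR hP
    have hn := hP.2.map R.n (by simp [hb]) hun
    have haa := hP.1.iterate_eq_zero 2 4 haau haaaa
    exact hR.shapes_a hP hn hb haa
  · rintro R ⟨hbbbb, hnu, hun, hubn, hubb, hbbn, ha⟩ hR hP
    have hn : ∀ w, R.n w = 0 := fun w => hP.1 _ (ha _) (hnu w)
    have hbb := hP.2.iterate_eq_zero 2 4 hubb hbbbb
    exact hR.shapes_b hP hn ha hbb

theorem brickCount_W19 : BrickCount K (TabW19 K) 5 := by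
  refine brickCount_of QD.compat (by decide) (P := fun a b u n =>
      (∀ v, a (a (a (a (a v)))) = 0) ∧ (∀ v, n (u v) = 0) ∧ (∀ w, u (n w) = 0) ∧
      (∀ w, a (n w) = 0) ∧ (∀ v, u (a (a v)) = 0) ∧ (∀ w, b w = 0))
    (fun R => by simp [Sat, QD.al, QD.mu, QD.nu, pow_succ, ← op_mul, Fin.forall_fin_succ,
      LinearMap.ext_iff, and_assoc])
    [.x11, .x21] [.x11] 5 ?_ (by simp) (by simp) ?_ ?_ ?_ ?_
  · rintro R ⟨haaaaa, hun, hnu, hna, haau, hb⟩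
    simp [NilAt, mem_kill_succ_fst, mem_kill_succ_snd, haaaaa, hun, hnu, hna, haau, hb]
  · simp
  · simp
  · rintro R ⟨haaaaa, hun, hnu, hna, haau, hb⟩ hR hP
    have hn := hP.2.map R.n (by simp [hb]) hun
    have haa := hP.1.iterate_eq_zero 2 5 haau haaaaa
    exact hR.shapes_a hP hn hb haa
  · rintro R ⟨hbbbbb, hnu, hun, hub, hbbn, ha⟩ hR hP
    have hn : ∀ w, R.n w = 0 := fun w => hP.1 _ (ha _) (hnu w)
    have hb := hP.2.b_eq_zero 5 hub hbbbbb
    exact hR.shapes hP hn ha hb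

theorem brickCount_W20 : BrickCount K (TabW20 K) 5 := by
  refine brickCount_of QD.compat (by decide) (P := fun a b u n =>
      (∀ v, a (a v) = 0) ∧ (∀ w, a (n w) = 0) ∧ (∀ w, n (u (n w)) = 0) ∧ (∀ v, n (u (a v)) = 0) ∧
      (∀ w, b w = 0))
    (fun R => by simp [Sat, QD.al, QD.mu, QD.nu, pow_succ, ← op_mul, Fin.forall_fin_succ,
      LinearMap.ext_iff, and_assoc])
    [.x11, .x21] [.x11] 4 ?_ (by simp) (by simp) ?_ ?_ ?_ ?_
  · rintro R ⟨haa, hna, hnun, haun, hb⟩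
    simp [NilAt, mem_kill_succ_fst, mem_kill_succ_snd, haa, hna, hnun, haun, hb]
  · simp
  · simp
  · rintro R ⟨haa, hna, hnun, haun, hb⟩ hR hP
    have hun :=
      (hR.cycles_eq_zero (by simp [haun, hna]) (by simp [hb]) (by simp [hnun]) (by simp [hnun])).1
    have hn := hP.2.map R.n (by simp [hb]) hun
    exact hR.shapes_a hP hn hb haa
  · rintro R ⟨hbb, hub, hunu, hbnu, ha⟩ hR hP
    have hnu :=
      (hR.cycles_eq_zero (by simp [ha]) (by simp [hbnu, hub]) (by simp [hunu]) (by simp [hunu])).2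
    have hn : ∀ w, R.n w = 0 := fun w => hP.1 _ (ha _) (hnu w)
    have hb := hP.2.b_eq_zero 2 hub hbb
    exact hR.shapes hP hn ha hb

theorem brickCount_W21 : BrickCount K (TabW21 K) 5 := by
  refine brickCount_of QD.compat (by decide) (P := fun a b u n =>
      (∀ v, a (a v) = 0) ∧ (∀ w, a (n w) = 0) ∧ (∀ v, u (n (u v)) = 0) ∧ (∀ w, b w = 0))
    (fun R => by simp [Sat, QD.al, QD.mu, QD.nu, pow_succ, ← op_mul, Fin.forall_fin_succ,
      LinearMap.ext_iff, and_assoc])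
    [.x11, .x21] [.x11] 4 ?_ (by simp) (by simp) ?_ ?_ ?_ ?_
  · rintro R ⟨haa, hna, hunu, hb⟩
    simp [NilAt, mem_kill_succ_fst, mem_kill_succ_snd, haa, hna, hunu, hb]
  · simp
  · simp
  · rintro R ⟨haa, hna, hunu, hb⟩ hR hP
    have hun : ∀ v, R.n (R.u v) = 0 := fun v => hP.1 _ (hna _) (hunu v)
    have hn := hP.2.map R.n (by simp [hb]) hun
    exact hR.shapes_a hP hn hb haa
  · rintro R ⟨hbb, hub, hnun, ha⟩ hR hP
    have hb := hP.2.b_eq_zero 2 hub hbb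
    have hnu :=
      (hR.cycles_eq_zero (by simp [ha]) (by simp [hb]) (by simp [hnun]) (by simp [hnun])).2
    have hn : ∀ w, R.n w = 0 := fun w => hP.1 _ (ha _) (hnu w)
    exact hR.shapes hP hn ha hb

theorem brickCount_W22 : BrickCount K (TabW22 K) 5 := by
  refine brickCount_of QD.compat (by decide) (P := fun a b u n =>
      (∀ v, a (a (a v)) = 0) ∧ (∀ w, u (n w) = 0) ∧ (∀ w, a (n w) = 0) ∧ (∀ v, n (u (a v)) = 0) ∧
      (∀ v, u (a (a v)) = 0) ∧ (∀ w, b w = 0))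
    (fun R => by simp [Sat, QD.al, QD.mu, QD.nu, pow_succ, ← op_mul, Fin.forall_fin_succ,
      LinearMap.ext_iff, and_assoc])
    [.x11, .x21] [.x11] 3 ?_ (by simp) (by simp) ?_ ?_ ?_ ?_
  · rintro R ⟨haaa, hnu, hna, haun, haau, hb⟩
    simp [NilAt, mem_kill_succ_fst, mem_kill_succ_snd, haaa, hnu, hna, haun, haau, hb]
  · simp
  · simp
  · rintro R ⟨haaa, hnu, hna, haun, haau, hb⟩ hR hP
    have hn : ∀ w, R.n w = 0 := fun w => hP.1 _ (hna w) (hnu w)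
    have haa := hP.1.iterate_eq_zero 2 3 haau haaa
    exact hR.shapes_a hP hn hb haa
  · rintro R ⟨hbbb, hun, hub, hbnu, hbbn, ha⟩ hR hP
    have hb := hP.2.b_eq_zero 3 hub hbbb
    have hn := hP.2.map R.n (by simp [hb]) hun
    exact hR.shapes hP hn ha hb

theorem brickCount_W23 : BrickCount K (TabW23 K) 6 := by
  refine brickCount_of QD.compat (by decide) (P := fun a b u n =>
      (∀ v, a (a v) = n (u v)) ∧ (∀ v, a (a (a v)) = 0) ∧ (∀ v, u (a (a v)) = 0) ∧ (∀ w, b w = 0))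
    (fun R => by simp [Sat, QD.al, QD.mu, QD.nu, pow_succ, ← op_mul, Fin.forall_fin_succ,
      LinearMap.ext_iff, and_assoc])
    [.x11, .x21] [.x11, .x12] 4 ?_ (by simp) (by simp) ?_ ?_ ?_ ?_
  · rintro R ⟨haa, haaa, haau, hb⟩
    simp [NilAt, mem_kill_succ_fst, mem_kill_succ_snd, ← haa, haaa, haau, hb]
  · simp
  · simp
  · rintro R ⟨haa, haaa, haau, hb⟩ hR hP
    have hun :=
      (hR.cycles_eq_zero (by simp [← haa]) (by simp [hb]) (by simp [← haa, haaa])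
        (by simp [← haa, haau])).1
    have hn := hP.2.map R.n (by simp [hb]) hun
    have haa : ∀ v, R.a (R.a v) = 0 := fun v => (haa v).trans (hun v)
    exact hR.shapes_a hP hn hb haa
  · rintro R ⟨hbb, hbbb, hbbn, ha⟩ hR hP
    have hnu :=
      (hR.cycles_eq_zero (by simp [ha]) (by simp [← hbb]) (by simp [← hbb, hbbn])
        (by simp [← hbb, hbbn])).2
    have hn : ∀ w, R.n w = 0 := fun w => hP.1 _ (ha _) (hnu w)
    have hbb : ∀ w, R.b (R.b w) = 0 := fun w => (hbb w).trans (hnu w)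
    exact hR.shapes_b hP hn ha hbb

theorem brickCount_W24 : BrickCount K (TabW24 K) 8 := by
  refine brickCount_of QD.compat (by decide) (P := fun a b u n =>
      (∀ v, a (a (a v)) = n (u v)) ∧ (∀ v, a (a (a (a v))) = 0) ∧ (∀ w, u (n w) = 0) ∧
      (∀ w, u (a (n w)) = 0) ∧ (∀ w, a (a (n w)) = 0) ∧ (∀ w, b w = 0))
    (fun R => by simp [Sat, QD.al, QD.mu, QD.nu, pow_succ, ← op_mul, Fin.forall_fin_succ,
      LinearMap.ext_iff, and_assoc])
    [.x11, .x21, .x31, .x32] [.x11, .x12] 4 ?_ (by simp) (by simp) ?_ ?_ ?_ ?_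
  · rintro R ⟨haaa, haaaa, hnu, hnau, hnaa, hb⟩
    have haaau : ∀ v, R.u (R.a (R.a (R.a v))) = 0 := fun v => by rw [haaa, hnu]
    simp [NilAt, mem_kill_succ_fst, mem_kill_succ_snd, ← haaa, haaaa, hnu, hnau, hnaa, hb, haaau]
  · simp
  · simp
  · rintro R ⟨haaa, haaaa, hnu, hnau, hnaa, hb⟩ hR hP
    have hna : ∀ w, R.a (R.n w) = 0 := fun w => hP.1 _ (hnaa w) (hnau w)
    have hn : ∀ w, R.n w = 0 := fun w => hP.1 _ (hna w) (hnu w)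
    have haaa : ∀ v, R.a (R.a (R.a v)) = 0 := fun v => (haaa v).trans (hn _)
    exact hR.shapes_C hP hn hb haaa
  · rintro R ⟨hbbb, hbbbb, hun, hubn, hubb, ha⟩ hR hP
    have hbb := hP.2.iterate_eq_zero 2 4 hubb hbbbb
    have hnu : ∀ w, R.u (R.n w) = 0 := fun w => (hbbb w).symm.trans (hbb (R.b w))
    have hn : ∀ w, R.n w = 0 := fun w => hP.1 _ (ha _) (hnu w)
    exact hR.shapes_b hP hn ha hbb

theorem brickCount_W25 : BrickCount K (TabW25 K) 5 := by
  refine brickCount_of QE.compat (by decide) (P := fun a b u n =>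
      (∀ v, a (a (a v)) = 0) ∧ (∀ w, b (b w) = 0) ∧ (∀ w, u (n w) = 0) ∧ (∀ v, n (u v) = 0) ∧
      (∀ w, a (n w) = 0) ∧ (∀ v, b (u v) = 0) ∧ (∀ w, n (b w) = 0) ∧ (∀ v, u (a (a v)) = 0))
    (fun R => by simp [Sat, QE.al, QE.mu, QE.be, QE.nu, pow_succ, ← op_mul, Fin.forall_fin_succ,
      LinearMap.ext_iff])
    [.x11, .x21] [.x11] 3 ?_ (by simp) (by simp) ?_ ?_ ?_ ?_
  · rintro R ⟨haaa, hbb, hnu, hun, hna, hub, hbn, haau⟩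
    simp [NilAt, mem_kill_succ_fst, mem_kill_succ_snd, haaa, hbb, hnu, hun, hna, hub, hbn, haau]
  · simp
  · simp
  · rintro R ⟨haaa, hbb, hnu, hun, hna, hub, hbn, haau⟩ hR hP
    have hb := hP.2.b_eq_zero 2 hub hbb
    have hn := hP.2.map R.n hbn hun
    have haa := hP.1.iterate_eq_zero 2 3 haau haaa
    exact hR.shapes_a hP hn hb haa
  · rintro R ⟨hbbb, haa, hun, hnu, hub, hna, hau, hbbn⟩ hR hP
    have hb := hP.2.b_eq_zero 3 hub hbbb
    have hn : ∀ w, R.n w = 0 := fun w => hP.1 _ (hna w) (hnu w)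
    have ha := hP.1.a_eq_zero 2 hau haa
    exact hR.shapes hP hn ha hb

theorem brickCount_W26 : BrickCount K (TabW26 K) 5 := by
  refine brickCount_of QE.compat (by decide) (P := fun a b u n =>
      (∀ v, a (a v) = 0) ∧ (∀ w, b (b w) = 0) ∧ (∀ w, u (n w) = 0) ∧ (∀ v, u (a v) = 0) ∧
      (∀ w, a (n w) = 0) ∧ (∀ w, n (b w) = 0))
    (fun R => by simp [Sat, QE.al, QE.mu, QE.be, QE.nu, pow_succ, ← op_mul, Fin.forall_fin_succ,
      LinearMap.ext_iff])
    [.x11, .x12] [.x11] 3 ?_ (by simp) (by simp) ?_ ?_ ?_ ?_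
  · rintro R ⟨haa, hbb, hnu, hau, hna, hbn⟩
    simp [NilAt, mem_kill_succ_fst, mem_kill_succ_snd, haa, hbb, hnu, hau, hna, hbn]
  · simp
  · simp
  · rintro R ⟨haa, hbb, hnu, hau, hna, hbn⟩ hR hP
    have ha := hP.1.a_eq_zero 2 hau haa
    have hn : ∀ w, R.n w = 0 := fun w => hP.1 _ (hna w) (hnu w)
    exact hR.shapes_b hP hn ha hbb
  · rintro R ⟨hbb, haa, hun, hbn, hub, hau⟩ hR hP
    have hb := hP.2.b_eq_zero 2 hub hbb
    have ha := hP.1.a_eq_zero 2 hau haa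
    have hn := hP.2.map R.n hbn hun
    exact hR.shapes hP hn ha hb

theorem brickCount_W27 : BrickCount K (TabW27 K) 6 := by
  refine brickCount_of QE.compat (by decide) (P := fun a b u n =>
      (∀ v, a (a v) = n (u v)) ∧ (∀ w, b (b w) = 0) ∧ (∀ w, u (n w) = 0) ∧ (∀ v, u (a v) = 0) ∧
      (∀ v, b (u v) = 0) ∧ (∀ w, a (n (b w)) = 0))
    (fun R => by simp [Sat, QE.al, QE.mu, QE.be, QE.nu, pow_succ, ← op_mul, Fin.forall_fin_succ,
      LinearMap.ext_iff])
    [.x11] [.x11, .x21, .x12] 3 ?_ (by simp) (by simp) ?_ ?_ ?_ ?_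
  · rintro R ⟨haa, hbb, hnu, hau, hub, hbna⟩
    have huna : ∀ v, R.a (R.n (R.u v)) = 0 := fun v => by rw [← haa, haa, hau, map_zero]
    simp [NilAt, mem_kill_succ_fst, mem_kill_succ_snd, haa, hbb, hnu, hau, hub, hbna, huna]
  · simp
  · simp
  · rintro R ⟨haa, hbb, hnu, hau, hub, hbna⟩ hR hP
    have hb := hP.2.b_eq_zero 2 hub hbb
    have ha : ∀ v, R.a v = 0 := hP.1.a_eq_zero 3 hau fun v => (haa (R.a v)).trans (by simp [hau])
    have hun : ∀ v, R.n (R.u v) = 0 := fun v => (haa v).symm.trans (ha _)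
    have hn := hP.2.map R.n (by simp [hb]) hun
    exact hR.shapes hP hn ha hb
  · rintro R ⟨hbb, haa, hun, hbn, hna, haub⟩ hR hP
    have hn := hP.2.map R.n hbn hun
    have hbb : ∀ w, R.b (R.b w) = 0 := fun w => (hbb w).trans (by simp [hn])
    exact hR.shapes_D hP hn haa hbb haub

theorem brickCount_W28 : BrickCount K (TabW28 K) 6 := by
  refine brickCount_of QE.compat (by decide) (P := fun a b u n =>
      (∀ v, a (a v) = n (u v)) ∧ (∀ w, b (b w) = 0) ∧ (∀ w, u (n w) = 0) ∧ (∀ v, u (a v) = 0) ∧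
      (∀ w, n (b w) = 0))
    (fun R => by simp [Sat, QE.al, QE.mu, QE.be, QE.nu, pow_succ, ← op_mul, Fin.forall_fin_succ,
      LinearMap.ext_iff])
    [.x11, .x12] [.x11, .x12] 3 ?_ (by simp) (by simp) ?_ ?_ ?_ ?_
  · rintro R ⟨haa, hbb, hnu, hau, hbn⟩
    have huna : ∀ v, R.a (R.n (R.u v)) = 0 := fun v => by rw [← haa, haa, hau, map_zero]
    simp [NilAt, mem_kill_succ_fst, mem_kill_succ_snd, haa, hbb, hnu, hau, hbn, huna]
  · simp
  · simp
  · rintro R ⟨haa, hbb, hnu, hau, hbn⟩ hR hP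
    have ha : ∀ v, R.a v = 0 := hP.1.a_eq_zero 3 hau fun v => (haa (R.a v)).trans (by simp [hau])
    have hun : ∀ v, R.n (R.u v) = 0 := fun v => (haa v).symm.trans (ha _)
    have hn := hP.2.map R.n hbn hun
    exact hR.shapes_b hP hn ha hbb
  · rintro R ⟨hbb, haa, hun, hbn, hau⟩ hR hP
    have ha := hP.1.a_eq_zero 2 hau haa
    have hn := hP.2.map R.n hbn hun
    have hbb : ∀ w, R.b (R.b w) = 0 := fun w => (hbb w).trans (by simp [hn])
    exact hR.shapes_b hP hn ha hbb

theorem brickCount_W29 : BrickCount K (TabW29 K) 6 := by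
  refine brickCount_of QE.compat (by decide) (P := fun a b u n =>
      (∀ v, a (a v) = n (u v)) ∧ (∀ w, b (b w) = 0) ∧ (∀ w, u (n w) = 0) ∧ (∀ w, a (n w) = 0) ∧
      (∀ v, b (u v) = 0))
    (fun R => by simp [Sat, QE.al, QE.mu, QE.be, QE.nu, pow_succ, ← op_mul, Fin.forall_fin_succ,
      LinearMap.ext_iff])
    [.x11, .x21] [.x11, .x21] 3 ?_ (by simp) (by simp) ?_ ?_ ?_ ?_
  · rintro R ⟨haa, hbb, hnu, hna, hub⟩
    have haun : ∀ v, R.n (R.u (R.a v)) = 0 := fun v => by rw [← haa, haa v, hna]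
    simp [NilAt, mem_kill_succ_fst, mem_kill_succ_snd, haa, hbb, hnu, hna, hub, haun]
  · simp
  · simp
  · rintro R ⟨haa, hbb, hnu, hna, hub⟩ hR hP
    have hb := hP.2.b_eq_zero 2 hub hbb
    have hn : ∀ w, R.n w = 0 := fun w => hP.1 _ (hna w) (hnu w)
    have haa : ∀ v, R.a (R.a v) = 0 := fun v => (haa v).trans (hn _)
    exact hR.shapes_a hP hn hb haa
  · rintro R ⟨hbb, haa, hun, hub, hna⟩ hR hP
    have hb : ∀ w, R.b w = 0 := hP.2.b_eq_zero 3 hub fun w => by simp [hbb, hub]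
    have hnu : ∀ w, R.u (R.n w) = 0 := fun w => (hbb w).symm.trans (hb _)
    have hn : ∀ w, R.n w = 0 := fun w => hP.1 _ (hna w) (hnu w)
    exact hR.shapes_a hP hn hb haa

theorem brickCount_W30 : BrickCount K (TabW30 K) 6 := by
  refine brickCount_of QE.compat (by decide) (P := fun a b u n =>
      (∀ v, a (a v) = n (u v)) ∧ (∀ w, b (b w) = 0) ∧ (∀ w, u (n w) = 0) ∧ (∀ w, a (n w) = 0) ∧
      (∀ w, n (b w) = 0) ∧ (∀ v, b (u (a v)) = 0))
    (fun R => by simp [Sat, QE.al, QE.mu, QE.be, QE.nu, pow_succ, ← op_mul, Fin.forall_fin_succ,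
      LinearMap.ext_iff])
    [.x11, .x21, .x12] [.x11] 3 ?_ (by simp) (by simp) ?_ ?_ ?_ ?_
  · rintro R ⟨haa, hbb, hnu, hna, hbn, haub⟩
    have haun : ∀ v, R.n (R.u (R.a v)) = 0 := fun v => by rw [← haa, haa v, hna]
    simp [NilAt, mem_kill_succ_fst, mem_kill_succ_snd, haa, hbb, hnu, hna, hbn, haub, haun]
  · simp
  · simp
  · rintro R ⟨haa, hbb, hnu, hna, hbn, haub⟩ hR hP
    have hn : ∀ w, R.n w = 0 := fun w => hP.1 _ (hna w) (hnu w)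
    have haa : ∀ v, R.a (R.a v) = 0 := fun v => (haa v).trans (hn _)
    exact hR.shapes_D hP hn haa hbb haub
  · rintro R ⟨hbb, haa, hun, hub, hau, hbna⟩ hR hP
    have hb : ∀ w, R.b w = 0 := hP.2.b_eq_zero 3 hub fun w => by simp [hbb, hub]
    have ha := hP.1.a_eq_zero 2 hau haa
    have hn := hP.2.map R.n (by simp [hb]) hun
    exact hR.shapes hP hn ha hb

theorem brickCount_W31 : BrickCount K (TabW31 K) 4 := by
  refine brickCount_of QE.compat (by decide) (P := fun a b u n =>
      (∀ v, u (a v) = b (u v)) ∧ (∀ v, a (a v) = 0) ∧ (∀ w, b (b (b w)) = 0) ∧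
      (∀ v, n (u v) = 0) ∧ (∀ w, a (n w) = 0) ∧ (∀ w, n (b w) = 0) ∧ (∀ v, b (b (u v)) = 0))
    (fun R => by simp [Sat, QE.al, QE.mu, QE.be, QE.nu, pow_succ, ← op_mul, Fin.forall_fin_succ,
      LinearMap.ext_iff])
    [.x11] [.x11] 3 ?_ (by simp) (by simp) ?_ ?_ ?_ ?_
  · rintro R ⟨hau, haa, hbbb, hun, hna, hbn, hubb⟩
    have hnub : ∀ w, R.b (R.u (R.n w)) = 0 := fun w => by rw [← hau, hna, map_zero]
    simp [NilAt, mem_kill_succ_fst, mem_kill_succ_snd, hau, haa, hbbb, hun, hna, hbn, hubb, hnub]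
  · simp
  · simp
  · rintro R ⟨hau, haa, hbbb, hun, hna, hbn, hubb⟩ hR hP
    obtain ⟨ha, hb⟩ := hR.loops_eq_zero 3 (fun v => haa (R.a v)) hbbb hau (by simp [hbn, hna])
    have hn := hP.2.map R.n hbn hun
    exact hR.shapes hP hn ha hb
  · rintro R ⟨hbn, hbb, haaa, hnu, hub, hau, hnaa⟩ hR hP
    obtain ⟨ha, hb⟩ := hR.loops_eq_zero 3 haaa (fun w => hbb (R.b w)) (by simp [hau, hub]) hbn
    have hn : ∀ w, R.n w = 0 := fun w => hP.1 _ (ha _) (hnu w)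
    exact hR.shapes hP hn ha hb

theorem brickCount_W32 : BrickCount K (TabW32 K) 4 := by
  refine brickCount_of QE.compat (by decide) (P := fun a b u n =>
      (∀ v, u (a v) = b (u v)) ∧ (∀ v, a (a v) = 0) ∧ (∀ w, b (b w) = 0) ∧ (∀ w, a (n w) = 0) ∧
      (∀ w, n (b w) = 0) ∧ (∀ v, u (n (u v)) = 0) ∧ (∀ w, n (u (n w)) = 0))
    (fun R => by simp [Sat, QE.al, QE.mu, QE.be, QE.nu, pow_succ, ← op_mul, Fin.forall_fin_succ,
      LinearMap.ext_iff])
    [.x11] [.x11] 3 ?_ (by simp) (by simp) ?_ ?_ ?_ ?_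
  · rintro R ⟨hau, haa, hbb, hna, hbn, hunu, hnun⟩
    have hnub : ∀ w, R.b (R.u (R.n w)) = 0 := fun w => by rw [← hau, hna, map_zero]
    simp [NilAt, mem_kill_succ_fst, mem_kill_succ_snd, hau, haa, hbb, hna, hbn, hunu, hnun, hnub]
  · simp
  · simp
  · rintro R ⟨hau, haa, hbb, hna, hbn, hunu, hnun⟩ hR hP
    obtain ⟨ha, hb⟩ := hR.loops_eq_zero 2 haa hbb hau (by simp [hbn, hna])
    have hun :=
      (hR.cycles_eq_zero (by simp [ha]) (by simp [hb]) (by simp [hunu]) (by simp [hunu])).1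
    have hn := hP.2.map R.n hbn hun
    exact hR.shapes hP hn ha hb
  · rintro R ⟨hbn, hbb, haa, hub, hau, hnun, hunu⟩ hR hP
    obtain ⟨ha, hb⟩ := hR.loops_eq_zero 2 haa hbb (by simp [hau, hub]) hbn
    have hun :=
      (hR.cycles_eq_zero (by simp [ha]) (by simp [hb]) (by simp [hunu]) (by simp [hunu])).1
    have hn := hP.2.map R.n (by simp [hb]) hun
    exact hR.shapes hP hn ha hb

theorem brickCount_W33 : BrickCount K (TabW33 K) 4 := by
  refine brickCount_of QE.compat (by decide) (P := fun a b u n =>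
      (∀ v, u (a v) = b (u v)) ∧ (∀ v, a (a (a v)) = 0) ∧ (∀ w, b (b (b w)) = 0) ∧
      (∀ w, u (n w) = 0) ∧ (∀ v, n (u v) = 0) ∧ (∀ w, a (n w) = 0) ∧ (∀ w, n (b w) = 0) ∧
      (∀ v, b (b (u v)) = 0) ∧ (∀ v, u (a (a v)) = 0))
    (fun R => by simp [Sat, QE.al, QE.mu, QE.be, QE.nu, pow_succ, ← op_mul, Fin.forall_fin_succ,
      LinearMap.ext_iff])
    [.x11] [.x11] 3 ?_ (by simp) (by simp) ?_ ?_ ?_ ?_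
  · rintro R ⟨hau, haaa, hbbb, hnu, hun, hna, hbn, hubb, haau⟩
    simp [NilAt, mem_kill_succ_fst, mem_kill_succ_snd, hau, haaa, hbbb, hnu, hun, hna, hbn, hubb]
  · simp
  · simp
  · rintro R ⟨hau, haaa, hbbb, hnu, hun, hna, hbn, hubb, haau⟩ hR hP
    obtain ⟨ha, hb⟩ := hR.loops_eq_zero 3 haaa hbbb hau (by simp [hbn, hna])
    have hn := hP.2.map R.n hbn hun
    exact hR.shapes hP hn ha hb
  · rintro R ⟨hbn, hbbb, haaa, hun, hnu, hub, hau, hnaa, hbbn⟩ hR hP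
    obtain ⟨ha, hb⟩ := hR.loops_eq_zero 3 haaa hbbb (by simp [hau, hub]) hbn
    have hn := hP.2.map R.n (by simp [hb]) hun
    exact hR.shapes hP hn ha hb

theorem brickCount_W34 : BrickCount K (TabW34 K) 4 := by
  refine brickCount_of QE.compat (by decide) (P := fun a b u n =>
      (∀ v, u (a v) = b (u v)) ∧ (∀ v, a (a (a v)) = 0) ∧ (∀ w, b (b w) = 0) ∧
      (∀ w, u (n w) = 0) ∧ (∀ w, a (n w) = 0) ∧ (∀ w, n (b w) = 0) ∧ (∀ v, u (a (a v)) = 0))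
    (fun R => by simp [Sat, QE.al, QE.mu, QE.be, QE.nu, pow_succ, ← op_mul, Fin.forall_fin_succ,
      LinearMap.ext_iff])
    [.x11] [.x11] 3 ?_ (by simp) (by simp) ?_ ?_ ?_ ?_
  · rintro R ⟨hau, haaa, hbb, hnu, hna, hbn, haau⟩
    simp [NilAt, mem_kill_succ_fst, mem_kill_succ_snd, hau, haaa, hbb, hnu, hna, hbn]
  · simp
  · simp
  · rintro R ⟨hau, haaa, hbb, hnu, hna, hbn, haau⟩ hR hP
    obtain ⟨ha, hb⟩ := hR.loops_eq_zero 3 haaa (fun w => hbb (R.b w)) hau (by simp [hbn, hna])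
    have hn : ∀ w, R.n w = 0 := fun w => hP.1 _ (hna w) (hnu w)
    exact hR.shapes hP hn ha hb
  · rintro R ⟨hbn, hbbb, haa, hun, hub, hau, hbbn⟩ hR hP
    obtain ⟨ha, hb⟩ := hR.loops_eq_zero 3 (fun v => haa (R.a v)) hbbb (by simp [hau, hub]) hbn
    have hn := hP.2.map R.n (by simp [hb]) hun
    exact hR.shapes hP hn ha hb

end QRep

end TwoPoint

namespace TwoPoint

/-- Corollary 4.1.  The numbers of isomorphism classes of bricks over
the Table W algebras. -/
theorem table_W_brick_count (K : Type) [Field K] [IsAlgClosed K] :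
    BrickCount K (TabW4 K) 3 ∧
    BrickCount K (TabW6 K) 4 ∧
    BrickCount K (TabW7 K) 6 ∧
    BrickCount K (TabW8 K) 6 ∧
    BrickCount K (TabW9 K) 4 ∧
    BrickCount K (TabW10 K) 4 ∧
    BrickCount K (TabW11 K) 5 ∧
    BrickCount K (TabW12 K) 3 ∧
    BrickCount K (TabW13 K) 3 ∧
    BrickCount K (TabW14 K) 8 ∧
    BrickCount K (TabW15 K) 7 ∧
    BrickCount K (TabW16 K) 6 ∧
    BrickCount K (TabW17 K) 7 ∧
    BrickCount K (TabW18 K) 6 ∧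
    BrickCount K (TabW19 K) 5 ∧
    BrickCount K (TabW20 K) 5 ∧
    BrickCount K (TabW21 K) 5 ∧
    BrickCount K (TabW22 K) 5 ∧
    BrickCount K (TabW23 K) 6 ∧
    BrickCount K (TabW24 K) 8 ∧
    BrickCount K (TabW25 K) 5 ∧
    BrickCount K (TabW26 K) 5 ∧
    BrickCount K (TabW27 K) 6 ∧
    BrickCount K (TabW28 K) 6 ∧
    BrickCount K (TabW29 K) 6 ∧
    BrickCount K (TabW30 K) 6 ∧
    BrickCount K (TabW31 K) 4 ∧
    BrickCount K (TabW32 K) 4 ∧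
    BrickCount K (TabW33 K) 4 ∧
    BrickCount K (TabW34 K) 4 := by
  exact ⟨QRep.brickCount_W4, QRep.brickCount_W6, QRep.brickCount_W7, QRep.brickCount_W8,
    QRep.brickCount_W9, QRep.brickCount_W10, QRep.brickCount_W11, QRep.brickCount_W12,
    QRep.brickCount_W13, QRep.brickCount_W14, QRep.brickCount_W15, QRep.brickCount_W16,
    QRep.brickCount_W17, QRep.brickCount_W18, QRep.brickCount_W19, QRep.brickCount_W20,
    QRep.brickCount_W21, QRep.brickCount_W22, QRep.brickCount_W23, QRep.brickCount_W24,
    QRep.brickCount_W25, QRep.brickCount_W26, QRep.brickCount_W27, QRep.brickCount_W28,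
    QRep.brickCount_W29, QRep.brickCount_W30, QRep.brickCount_W31, QRep.brickCount_W32,
    QRep.brickCount_W33, QRep.brickCount_W34⟩

end TwoPoint
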